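/- Let H satisfy the Hurst hypotheses with 1/2 < H(x) < 1 and Leb(D) > 0, and let μ be a centered Gaussian measure on the real Hilbert space L²(0,1) with covariance kernel G(x,y) = ∫₀^{min(x,y)} K(x,z,H(x)) · K(y,z,H(y)) dz, where K(x,y,H) := c_*(H) · y^{1/2−H} · ∫_y^x (z−y)^{H−3/2} z^{H−1/2} dz for 0 < y < x ≤ 1 and K(x,y,H) := 0 for y ≥ x (the covariance of the multifractal Brownian motion with functional Hurst parameter H). Then, with M := Leb(D), lim_{ε→0⁺} ε^{1/H_min} · log μ({f : ‖f‖_{L²(0,1)} ≤ ε}) = − (H_min·M)/((2H_min+1)·sin(π/(2H_min+1))) · (Γ(2H_min+1)·sin(πH_min)·M/((2H_min+1)·sin(π/(2H_min+1))))^{1/(2H_min)}. -/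

import Mathlib

open MeasureTheory Set Filter Metric
open scoped ENNReal NNReal Real

noncomputable section

/-- `c_*(H) = (H(2H−1)Γ(3/2−H)/(Γ(2−2H)Γ(H−1/2)))^{1/2}`. -/
def cstar (H : ℝ) : ℝ :=
  Real.sqrt (H * (2 * H - 1) * Real.Gamma (3/2 - H) /
    (Real.Gamma (2 - 2*H) * Real.Gamma (H - 1/2)))

/-- The kernel `K(x, y, H)` of the multifractal Brownian motion. -/
def Kker (x y Hv : ℝ) : ℝ :=
  if 0 < y ∧ y < x then
    cstar Hv * y ^ ((1:ℝ)/2 - Hv) * ∫ z in Ioo y x, (z - y) ^ (Hv - 3/2) * z ^ (Hv - 1/2)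
  else 0

/-- Covariance kernel of the multifractal Brownian motion with functional Hurst
parameter `H`. -/
def GmfBM (H : ℝ → ℝ) (x y : ℝ) : ℝ :=
  ∫ z in Ioo (0:ℝ) (min x y), Kker x z (H x) * Kker y z (H y)

/-- Hölder continuity of exponent `r` on a set. -/
def HolderOn (f : ℝ → ℝ) (r : ℝ) (s : Set ℝ) : Prop :=
  ∃ C : ℝ, ∀ x ∈ s, ∀ y ∈ s, |f x - f y| ≤ C * |x - y| ^ r

open scoped Topology

local notation "𝕃" => Lp ℝ 2 (volume.restrict (Ioo (0:ℝ) 1))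

abbrev GaH [MeasurableSpace 𝕃] (μ : Measure 𝕃) : Prop := ∀ L : 𝕃 →L[ℝ] ℝ, ∃ v : ℝ≥0, μ.map L = ProbabilityTheory.gaussianReal 0 v

abbrev CoH [MeasurableSpace 𝕃] (H : ℝ → ℝ) (μ : Measure 𝕃) : Prop := ∀ u v : 𝕃, ∫ f, (@inner ℝ _ _ u f) * (@inner ℝ _ _ v f) ∂μ =
  ∫ x in Ioo (0:ℝ) 1, ∫ y in Ioo (0:ℝ) 1, GmfBM H x y * u x * v y

local notation "𝟘" => (0:ℝ)
local notation "𝔓" => (by positivity)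
local notation "𝔉" => (by fun_prop)
local notation "𝔏" => (by linarith)

section
open Real
section
theorem jlog {ι : Type*} (s : Finset ι) (p l : ι → ℝ) (hp : ∀ i ∈ s, 0 ≤ p i) (hl : ∀ i ∈ s, 0 ≤ l i)
    (hs : ∑ i ∈ s, p i ≤ 1) :
    ∑ i ∈ s, p i * log (1 + l i) ≤ log (1 + ∑ i ∈ s, p i * l i) := by
  set m := ∑ i ∈ s, p i * l i with hm
  have hm0 : 0 ≤ m := Finset.sum_nonneg fun i hi => mul_nonneg (hp i hi) (hl i hi)
  have h1 : ∀ i ∈ s, p i * log (1 + l i) ≤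
      p i * (log (1 + m) - m / (1 + m)) + (p i * l i) / (1 + m) := by
    intro i hi
    have h2 : log ((1 + l i) / (1 + m)) ≤ (1 + l i) / (1 + m) - 1 :=
      log_le_sub_one_of_pos (div_pos (by linarith [hl i hi]) 𝔏)
    rw [log_div (by linarith [hl i hi]) 𝔏] at h2
    have h3 : (1 + l i) / (1 + m) - 1 = l i / (1 + m) - m / (1 + m) := by
      field_simp; ring
    have := mul_le_mul_of_nonneg_left (show log (1 + l i) ≤ log (1 + m) - m / (1 + m)
      + l i / (1 + m) by linarith) (hp i hi)
    calc _ ≤ _ := this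
      _ = _ := by ring
  refine (Finset.sum_le_sum h1).trans ?_
  rw [Finset.sum_add_distrib, ← Finset.sum_mul, ← Finset.sum_div, ← hm]
  have h4 : m / (1 + m) ≤ log (1 + m) := by
    have := one_sub_inv_le_log_of_pos (show 0 < 1 + m by linarith)
    have h5 : 1 - (1 + m)⁻¹ = m / (1 + m) := by field_simp; ring
    linarith
  nlinarith

variable {ι : Type*} [Fintype ι]

theorem onb_sq (w : OrthonormalBasis ι ℝ (EuclideanSpace ℝ ι)) (x : EuclideanSpace ℝ ι) :
    ∑ l, (inner ℝ (w l) x : ℝ) ^ 2 = ‖x‖ ^ 2 := by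
  have := w.sum_sq_norm_inner_right x
  simpa using this

theorem onb_sq' (w : OrthonormalBasis ι ℝ (EuclideanSpace ℝ ι)) (x : EuclideanSpace ℝ ι) :
    ∑ l, (inner ℝ x (w l) : ℝ) ^ 2 = ‖x‖ ^ 2 := by
  have := w.sum_sq_norm_inner_left x
  simpa using this

def Dg (Q : EuclideanSpace ℝ ι → ℝ) (u : OrthonormalBasis ι ℝ (EuclideanSpace ℝ ι)) (l : ι → ℝ) :
    Prop := (∀ i, 0 ≤ l i) ∧ ∀ x, Q x = ∑ i, l i * (inner ℝ (u i) x : ℝ) ^ 2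

theorem Dg.apply {Q : EuclideanSpace ℝ ι → ℝ} {u l} (h : Dg Q u l) (i : ι) : Q (u i) = l i := by
  classical
  rw [h.2]
  simp [orthonormal_iff_ite.1 u.orthonormal]

theorem had {Q : EuclideanSpace ℝ ι → ℝ} {u l} (h : Dg Q u l)
    (w : OrthonormalBasis ι ℝ (EuclideanSpace ℝ ι)) :
    ∑ i, log (1 + l i) ≤ ∑ j, log (1 + Q (w j)) := by
  have h1 : ∀ i, log (1 + l i) = ∑ j, (inner ℝ (u i) (w j) : ℝ) ^ 2 * log (1 + l i) := by
    intro i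
    rw [← Finset.sum_mul, onb_sq' w]
    simp
  rw [Finset.sum_congr rfl fun i _ => h1 i, Finset.sum_comm]
  refine Finset.sum_le_sum fun j _ => ?_
  rw [h.2]
  refine (jlog _ _ _ (fun i _ => sq_nonneg _) (fun i _ => h.1 i) ?_).trans (le_of_eq ?_)
  · rw [onb_sq u]; simp
  · congr 2; exact Finset.sum_congr rfl fun i _ => mul_comm _ _

theorem ld_mono {Q Q' : EuclideanSpace ℝ ι → ℝ} {u l u' l'} (h : Dg Q u l) (h' : Dg Q' u' l')
    (hle : ∀ x, Q x ≤ Q' x) : ∑ i, log (1 + l i) ≤ ∑ i, log (1 + l' i) := by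
  refine (had h u').trans (Finset.sum_le_sum fun i _ => log_le_log ?_ ?_)
  · have : 0 ≤ Q (u' i) := by
      rw [h.2]; exact Finset.sum_nonneg fun j _ => mul_nonneg (h.1 j) (sq_nonneg _)
    linarith
  · linarith [hle (u' i), h'.apply i]

theorem ld_hasSum {Q : EuclideanSpace ℝ ι → ℝ} {w c} (h : Dg Q w c) {κ : Type*}
    (g : κ → EuclideanSpace ℝ ι) (hg : ∀ x, HasSum (fun k => (inner ℝ x (g k) : ℝ) ^ 2) (Q x))
    (hs : Summable fun k => log (1 + ‖g k‖ ^ 2)) :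
    ∑ i, log (1 + c i) ≤ ∑' k, log (1 + ‖g k‖ ^ 2) := by
  set v : ι → κ → ℝ := fun i k => (inner ℝ (w i) (g k) : ℝ) ^ 2 / c i with hv
  have hc : ∀ i k, c i = 0 → (inner ℝ (w i) (g k) : ℝ) = 0 := by
    intro i k hi
    have h1 := hg (w i)
    rw [h.apply i, hi] at h1
    have h2 := (hasSum_zero_iff_of_nonneg (fun k => sq_nonneg _)).1 h1
    have := congrFun h2 k
    simpa using this
  have hvc : ∀ i k, v i k * c i = (inner ℝ (w i) (g k) : ℝ) ^ 2 := by
    intro i k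
    by_cases hi : c i = 0
    · simp [hv, hi, hc i k hi]
    · simp [hv, hi]
  have h1 : ∀ i, HasSum (fun k => v i k * log (1 + c i)) (log (1 + c i)) := by
    intro i
    by_cases hi : c i = 0
    · simp [hi]
    · have := ((hg (w i)).div_const (c i)).mul_right (log (1 + c i))
      rwa [h.apply i, div_self hi, one_mul] at this
  have h2 := hasSum_sum (s := Finset.univ) fun i _ => h1 i
  refine hasSum_le (fun k => ?_) h2 hs.hasSum
  have hv0 : ∀ i, 0 ≤ v i k := fun i => div_nonneg (sq_nonneg _) (h.1 i)
  have hle : ∑ i, v i k ≤ 1 := by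
    set y : EuclideanSpace ℝ ι := ∑ i, ((inner ℝ (w i) (g k) : ℝ) / c i) • w i with hy
    have hin : ∀ j, (inner ℝ (w j) y : ℝ) = (inner ℝ (w j) (g k) : ℝ) / c j := by
      intro j
      classical
      rw [hy, inner_sum]
      simp [inner_smul_right, orthonormal_iff_ite.1 w.orthonormal]
    have hQ : Q y = ∑ i, v i k := by
      rw [h.2]
      refine Finset.sum_congr rfl fun i _ => ?_
      rw [hin]
      by_cases hi : c i = 0
      · simp [hv, hi]
      · simp only [hv]; field_simp
    have hyg : (inner ℝ y (g k) : ℝ) = ∑ i, v i k := by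
      rw [hy, sum_inner]
      refine Finset.sum_congr rfl fun i _ => ?_
      rw [inner_smul_left]
      simp only [hv, conj_trivial]; ring
    have h3 : (inner ℝ y (g k) : ℝ) ^ 2 ≤ Q y := le_hasSum (hg y) k fun _ _ => sq_nonneg _
    rw [hyg, hQ] at h3
    nlinarith [Finset.sum_nonneg fun i (_ : i ∈ Finset.univ) => hv0 i]
  refine (jlog _ _ _ (fun i _ => hv0 i) (fun i _ => h.1 i) hle).trans (le_of_eq ?_)
  rw [Finset.sum_congr rfl fun i _ => hvc i k, onb_sq w]

theorem exists_Dg [DecidableEq ι] (A : Matrix ι ι ℝ) (hA : A.IsHermitian)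
    (hpos : ∀ x : ι → ℝ, 0 ≤ ∑ i, ∑ j, A i j * x i * x j) :
    ∃ u l, Dg (fun x : EuclideanSpace ℝ ι => ∑ i, ∑ j, A i j * x i * x j) u l := by
  have key : ∀ x : EuclideanSpace ℝ ι, ∑ i, ∑ j, A i j * x i * x j =
      ∑ i, hA.eigenvalues i * (inner ℝ (hA.eigenvectorBasis i) x : ℝ) ^ 2 := by
    intro x
    have h1 : ∑ i, ∑ j, A i j * x i * x j = (inner ℝ x (WithLp.toLp 2 (A.mulVec x.ofLp)) : ℝ) := by
      rw [PiLp.inner_apply]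
      refine Finset.sum_congr rfl fun i _ => ?_
      simp only [Matrix.mulVec, dotProduct, RCLike.inner_apply, conj_trivial, Finset.sum_mul]
      exact Finset.sum_congr rfl fun j _ => by ring
    rw [h1, ← hA.eigenvectorBasis.sum_inner_mul_inner]
    refine Finset.sum_congr rfl fun i _ => ?_
    have h2 : (inner ℝ (hA.eigenvectorBasis i) (WithLp.toLp 2 (A.mulVec x.ofLp)) : ℝ) =
        hA.eigenvalues i * inner ℝ (hA.eigenvectorBasis i) x := by
      have h3 := hA.mulVec_eigenvectorBasis i
      have h4 : (inner ℝ (hA.eigenvectorBasis i) (WithLp.toLp 2 (A.mulVec x.ofLp)) : ℝ)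
          = dotProduct (A.mulVec x.ofLp) (hA.eigenvectorBasis i).ofLp := by
        simp [PiLp.inner_apply, dotProduct]
      have hAt : A.transpose = A := by
        have := hA.eq
        rwa [Matrix.conjTranspose_eq_transpose_of_trivial] at this
      have h5 : dotProduct (A.mulVec x.ofLp) (hA.eigenvectorBasis i).ofLp
          = dotProduct x.ofLp (A.mulVec (hA.eigenvectorBasis i).ofLp) := by
        rw [dotProduct_comm, Matrix.dotProduct_mulVec, ← Matrix.mulVec_transpose, hAt,
          dotProduct_comm]
      rw [h4, h5, h3, dotProduct_smul]
      simp [PiLp.inner_apply, dotProduct]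
    rw [h2, real_inner_comm x]
    ring
  refine ⟨hA.eigenvectorBasis, hA.eigenvalues, fun i => ?_, key⟩
  have h := key (hA.eigenvectorBasis i)
  have h6 := hpos (hA.eigenvectorBasis i).ofLp
  rw [h] at h6
  simpa [orthonormal_iff_ite.1 hA.eigenvectorBasis.orthonormal] using h6

theorem ld_upper {A B : EuclideanSpace ℝ ι → ℝ} {C : EuclideanSpace ℝ ι → ℝ} {u l b m w c} {κ : Type*}
    (hA : Dg A u l) (hB : Dg B b m) (hC : Dg C w c) (hle : ∀ x, A x ≤ C x)
    (g : κ → EuclideanSpace ℝ ι)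
    (hg : ∀ x, HasSum (fun k => (inner ℝ x (g k) : ℝ) ^ 2) (C x - B x))
    (hs : Summable fun k => log (1 + ‖g k‖ ^ 2))
    (e : OrthonormalBasis ι ℝ (EuclideanSpace ℝ ι)) :
    ∑ i, log (1 + l i) ≤ ∑ i, log (1 + B (e i)) + ∑' k, log (1 + ‖g k‖ ^ 2) := by
  refine (ld_mono hA hC hle).trans ?_
  let G : ι ⊕ κ → EuclideanSpace ℝ ι := Sum.elim (fun i => sqrt (m i) • b i) g
  have hn : ∀ i, ‖sqrt (m i) • b i‖ ^ 2 = m i := fun i => by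
    rw [norm_smul, b.norm_eq_one, mul_one, norm_eq_abs, sq_abs, sq_sqrt (hB.1 i)]
  have hG : ∀ x, HasSum (fun k => (inner ℝ x (G k) : ℝ) ^ 2) (C x) := by
    intro x
    have h1 : HasSum (fun i => (inner ℝ x (G (Sum.inl i)) : ℝ) ^ 2) (B x) := by
      rw [hB.2 x]
      convert hasSum_fintype _ using 2
      rename_i i _
      simp only [G, Sum.elim_inl]
      rw [inner_smul_right, mul_pow, sq_sqrt (hB.1 i), real_inner_comm]
    have h2 : HasSum (fun k => (inner ℝ x (G (Sum.inr k)) : ℝ) ^ 2) (C x - B x) := hg x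
    have := HasSum.sum (f := fun k => (inner ℝ x (G k) : ℝ) ^ 2) h1 h2
    simpa using this
  have hs1 : HasSum (fun k => log (1 + ‖G k‖ ^ 2))
      (∑ i, log (1 + m i) + ∑' k, log (1 + ‖g k‖ ^ 2)) := by
    refine HasSum.sum ?_ hs.hasSum
    have h5 : ((fun k => log (1 + ‖G k‖ ^ 2)) ∘ Sum.inl) = fun i => log (1 + m i) := by
      funext i
      simp only [G, Function.comp, Sum.elim_inl, hn]
    rw [h5]
    exact hasSum_fintype _
  refine (ld_hasSum hC G hG hs1.summable).trans ?_
  rw [hs1.tsum_eq]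
  linarith [had hB e]

theorem ld_lower {A : EuclideanSpace ℝ ι → ℝ} {C : EuclideanSpace ℝ ι → ℝ} {u l w c}
    (hA : Dg A u l) (hC : Dg C w c) {κ κ' : Type*} [Fintype κ'] (r : κ' → EuclideanSpace ℝ ι)
    (hr : ∀ x, C x = A x + ∑ m, (inner ℝ x (r m) : ℝ) ^ 2)
    (s : Finset κ) (f : κ → ℝ) (hf : ∀ k ∈ s, 0 ≤ f k) (a : κ → EuclideanSpace ℝ ι)
    (h1 : ∀ x, ∑ k ∈ s, f k * (inner ℝ x (a k) : ℝ) ^ 2 ≤ C x)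
    (h2 : ∀ x, ∑ k ∈ s, (inner ℝ x (a k) : ℝ) ^ 2 ≤ ‖x‖ ^ 2) :
    ∑ k ∈ s, log (1 + f k) * ‖a k‖ ^ 2 - ∑ m, log (1 + ‖r m‖ ^ 2)
      ≤ ∑ i, log (1 + l i) := by
  have h3 : ∑ k ∈ s, log (1 + f k) * ‖a k‖ ^ 2 ≤ ∑ i, log (1 + c i) := by
    have h4 : ∀ k, log (1 + f k) * ‖a k‖ ^ 2 =
        ∑ i, (inner ℝ (w i) (a k) : ℝ) ^ 2 * log (1 + f k) := fun k => by
      rw [← Finset.sum_mul, onb_sq w, mul_comm]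
    rw [Finset.sum_congr rfl fun k _ => h4 k, Finset.sum_comm]
    refine Finset.sum_le_sum fun i _ => ?_
    refine (jlog _ _ _ (fun i _ => sq_nonneg _) hf ?_).trans ?_
    · simpa using h2 (w i)
    · refine log_le_log ?_ ?_
      · have := Finset.sum_nonneg fun k hk => mul_nonneg (sq_nonneg (inner ℝ (w i) (a k) : ℝ)) (hf k hk)
        linarith
      · have := h1 (w i)
        rw [hC.apply i] at this
        have h5 := Finset.sum_congr rfl fun k (_ : k ∈ s) =>
          mul_comm ((inner ℝ (w i) (a k) : ℝ) ^ 2) (f k)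
        linarith
  have h6 : ∑ i, log (1 + c i) ≤ ∑ i, log (1 + l i) + ∑ m, log (1 + ‖r m‖ ^ 2) := by
    let G : ι ⊕ κ' → EuclideanSpace ℝ ι := Sum.elim (fun i => sqrt (l i) • u i) r
    have hn : ∀ i, ‖sqrt (l i) • u i‖ ^ 2 = l i := fun i => by
      rw [norm_smul, u.norm_eq_one, mul_one, norm_eq_abs, sq_abs, sq_sqrt (hA.1 i)]
    have hG : ∀ x, HasSum (fun k => (inner ℝ x (G k) : ℝ) ^ 2) (C x) := by
      intro x
      have hx : C x = ∑ k, (inner ℝ x (G k) : ℝ) ^ 2 := by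
        rw [hr, hA.2, Fintype.sum_sum_type]
        congr 1
        refine Finset.sum_congr rfl fun i _ => ?_
        simp only [G, Sum.elim_inl]
        rw [inner_smul_right, mul_pow, sq_sqrt (hA.1 i), real_inner_comm]
      rw [hx]; exact hasSum_fintype _
    refine (ld_hasSum hC G hG (hasSum_fintype _).summable).trans ?_
    rw [tsum_fintype, Fintype.sum_sum_type]
    simp only [G, Sum.elim_inl, Sum.elim_inr, hn]
    exact le_rfl
  linarith
end

section
open ProbabilityTheory

theorem gaussReal_exp (v : ℝ≥0) (s : ℝ) (hs : 0 ≤ s) :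
    ∫ x, exp (-(s/2) * x^2) ∂(gaussianReal 0 v) = exp (-(1/2) * log (1 + s * v)) := by
  by_cases hv : v = 0
  · subst hv; simp
  have hv' : 0 < (v:ℝ) := by positivity
  rw [integral_gaussianReal_eq_integral_smul hv]
  have h1 : ∀ x : ℝ, gaussianPDFReal 0 v x • exp (-(s/2) * x^2) =
      (√(2 * π * v))⁻¹ * exp (-((1 + s * v) / (2 * v)) * x ^ 2) := by
    intro x
    simp only [gaussianPDFReal, smul_eq_mul, sub_zero]
    rw [mul_assoc, ← exp_add]
    congr 2
    field_simp
    ring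
  simp_rw [h1]
  rw [integral_const_mul, integral_gaussian]
  have h2 : 0 < 1 + s * v := by positivity
  rw [show -(1/2) * log (1 + s * v) = log (1 + s*v) * (-(1/2)) by ring, exp_mul, exp_log h2,
    rpow_neg h2.le, ← sqrt_eq_rpow, ← sqrt_inv, ← sqrt_inv,
    ← sqrt_mul 𝔓]
  congr 1
  field_simp

variable {E : Type*} [NormedAddCommGroup E] [InnerProductSpace ℝ E] [CompleteSpace E]
  [MeasurableSpace E] [BorelSpace E]

theorem gauss_ld (μ : Measure E) [IsProbabilityMeasure μ]
    (hG : ∀ L : E →L[ℝ] ℝ, ∃ v : ℝ≥0, μ.map L = gaussianReal 0 v)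
    {ι : Type*} [Fintype ι] (e : ι → E) (s : ℝ) (hs : 0 < s) :
    ∃ u l, Dg (fun x : EuclideanSpace ℝ ι => s * ∫ f, (inner ℝ (∑ i, x i • e i) f : ℝ) ^ 2 ∂μ) u l ∧
      ∫ f, exp (-(s/2) * ∑ i, (inner ℝ (e i) f : ℝ)^2) ∂μ =
        exp (-(1/2) * ∑ i, log (1 + l i)) := by
  classical
  have : IsGaussian μ := isGaussian_of_map_eq_gaussianReal fun L => ⟨0, hG L⟩
  have hL2 : ∀ a : E, MemLp (fun f => (inner ℝ a f : ℝ)) 2 μ := fun a => by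
    obtain ⟨v, hv⟩ := hG (innerSL ℝ a)
    have := (memLp_id_gaussianReal (μ := 0) (v := v) 2)
    rw [← hv] at this
    exact (memLp_map_measure_iff (f := ⇑(innerSL ℝ a)) 𝔉 𝔉).1 this
  have hint : ∀ a b : E, Integrable (fun f => (inner ℝ a f : ℝ) * (inner ℝ b f : ℝ)) μ := fun a b =>
    (hL2 a).integrable_mul (hL2 b)
  have hmean : ∀ a : E, ∫ f, (inner ℝ a f : ℝ) ∂μ = 0 := fun a => by
    obtain ⟨v, hv⟩ := hG (innerSL ℝ a)
    have h1 : ∫ x, x ∂(μ.map (innerSL ℝ a)) = ∫ f, (inner ℝ a f : ℝ) ∂μ :=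
      integral_map 𝔉 𝔉
    rw [← h1, hv, integral_id_gaussianReal]
  let A : Matrix ι ι ℝ := fun i j => s * ∫ f, (inner ℝ (e i) f : ℝ) * (inner ℝ (e j) f : ℝ) ∂μ
  have hA : A.IsHermitian := by
    ext i j
    rw [Matrix.conjTranspose_apply, star_trivial]
    show s * _ = s * _
    congr 1
    exact integral_congr_ae (.of_forall fun f => mul_comm _ _)
  have hform2 : ∀ x y : ι → ℝ, s * ∫ f, (inner ℝ (∑ i, x i • e i) f : ℝ) * (inner ℝ (∑ i, y i • e i) f : ℝ) ∂μ
      = ∑ i, ∑ j, A i j * x i * y j := by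
    intro x y
    have h1 : ∀ f : E, (inner ℝ (∑ i, x i • e i) f : ℝ) * (inner ℝ (∑ i, y i • e i) f : ℝ) =
        ∑ i, ∑ j, ((inner ℝ (e i) f : ℝ) * (inner ℝ (e j) f : ℝ)) * (x i * y j) := by
      intro f
      simp only [sum_inner, inner_smul_left, conj_trivial, Finset.sum_mul_sum]
      refine Finset.sum_congr rfl fun i _ => Finset.sum_congr rfl fun j _ => by ring
    simp_rw [h1]
    rw [integral_finsetSum _ fun i _ => integrable_finsetSum _ fun j _ => (hint _ _).mul_const _,
      Finset.mul_sum]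
    refine Finset.sum_congr rfl fun i _ => ?_
    rw [integral_finsetSum _ fun j _ => (hint _ _).mul_const _, Finset.mul_sum]
    refine Finset.sum_congr rfl fun j _ => ?_
    rw [integral_mul_const]
    simp only [A]; ring
  have hform : ∀ x : ι → ℝ, s * ∫ f, (inner ℝ (∑ i, x i • e i) f : ℝ) ^ 2 ∂μ = ∑ i, ∑ j, A i j * x i * x j := by
    intro x
    simp_rw [sq]; exact hform2 x x
  obtain ⟨u, l, hD⟩ := exists_Dg A hA (fun x => by
    rw [← hform]; exact mul_nonneg hs.le (integral_nonneg fun f => sq_nonneg _))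
  have hD' : Dg (fun x : EuclideanSpace ℝ ι => s * ∫ f, (inner ℝ (∑ i, x i • e i) f : ℝ) ^ 2 ∂μ) u l :=
    ⟨hD.1, fun x => (hform _).trans (hD.2 x)⟩
  refine ⟨u, l, hD', ?_⟩
  let v : ι → E := fun i => ∑ j, (u i) j • e j
  have hsum : ∀ f : E, ∑ i, (inner ℝ (e i) f : ℝ)^2 = ∑ i, (inner ℝ (v i) f : ℝ)^2 := by
    intro f
    have := onb_sq u (WithLp.toLp 2 fun i => (inner ℝ (e i) f : ℝ))
    rw [EuclideanSpace.real_norm_sq_eq] at this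
    simp only at this
    rw [← this]
    refine Finset.sum_congr rfl fun i _ => ?_
    congr 1
    simp only [v, sum_inner, inner_smul_left, PiLp.inner_apply, conj_trivial, RCLike.inner_apply]
    exact Finset.sum_congr rfl fun j _ => by ring
  have hpol : ∀ x y : EuclideanSpace ℝ ι, s * ∫ f, (inner ℝ (∑ i, x i • e i) f : ℝ) * (inner ℝ (∑ i, y i • e i) f : ℝ) ∂μ
      = ∑ i, l i * ((inner ℝ (u i) x : ℝ) * (inner ℝ (u i) y : ℝ)) := by
    intro x y
    have h1 := hD.2 (x + y)
    have h2 := hD.2 x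
    have h3 := hD.2 y
    rw [hform2]
    have hsym : ∑ i, ∑ j, A i j * x i * y j = ∑ i, ∑ j, A i j * y i * x j := by
      rw [Finset.sum_comm]
      refine Finset.sum_congr rfl fun i _ => Finset.sum_congr rfl fun j _ => ?_
      have : A j i = A i j := by
        have := hA.apply i j; simpa using this
      rw [this]; ring
    have h4 : ∑ i, ∑ j, A i j * (x + y) i * (x + y) j = ∑ i, ∑ j, A i j * x i * x j
        + ∑ i, ∑ j, A i j * y i * y j + ∑ i, ∑ j, A i j * x i * y j + ∑ i, ∑ j, A i j * y i * x j := by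
      simp only [← Finset.sum_add_distrib]
      refine Finset.sum_congr rfl fun i _ => Finset.sum_congr rfl fun j _ => ?_
      simp only [PiLp.add_apply]; ring
    have h5 : ∑ i, l i * (inner ℝ (u i) (x + y) : ℝ) ^ 2 = ∑ i, l i * (inner ℝ (u i) x : ℝ) ^ 2
        + ∑ i, l i * (inner ℝ (u i) y : ℝ) ^ 2 + 2 * ∑ i, l i * ((inner ℝ (u i) x : ℝ) * (inner ℝ (u i) y : ℝ)) := by
      simp only [Finset.mul_sum, ← Finset.sum_add_distrib]
      refine Finset.sum_congr rfl fun i _ => ?_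
      rw [inner_add_right]; ring
    simp only at h1 h2 h3
    linarith
  have hcov : ∀ i j, s * ∫ f, (inner ℝ (v i) f : ℝ) * (inner ℝ (v j) f : ℝ) ∂μ = if i = j then l i else 0 := by
    intro i j
    have := hpol (u i) (u j)
    simp only [orthonormal_iff_ite.1 u.orthonormal] at this
    rw [this]
    by_cases hij : i = j
    · subst hij; simp
    · simp [hij, Ne.symm hij]
  let L : E →L[ℝ] (ι → ℝ) := ContinuousLinearMap.pi fun i => innerSL ℝ (v i)
  have hlaw : HasGaussianLaw (fun f (i : ι) => (inner ℝ (v i) f : ℝ)) μ := by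
    have : IsGaussian (μ.map L) := inferInstance
    exact ⟨this⟩
  have hind : iIndepFun (fun (i : ι) (f : E) => (inner ℝ (v i) f : ℝ)) μ := by
    refine hlaw.iIndepFun_of_covariance_eq_zero fun i j hij => ?_
    rw [covariance_eq_sub (hL2 _) (hL2 _), hmean, zero_mul, sub_zero]
    have := hcov i j
    rw [if_neg hij] at this
    simpa [hs.ne'] using this
  have hind2 := hind.comp (fun _ x => exp (-(s/2) * x^2)) (fun _ => by fun_prop)
  simp_rw [hsum, Finset.mul_sum, exp_sum]
  have h7 := hind2.integral_fun_prod_eq_prod_integral (fun i => by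
    refine Measurable.aestronglyMeasurable ?_
    simp only [Function.comp_def]; fun_prop)
  simp only [Function.comp_def] at h7
  rw [h7]
  refine Finset.prod_congr rfl fun i _ => ?_
  obtain ⟨w, hw⟩ := hG (innerSL ℝ (v i))
  have h8 : ∫ f, exp (-(s/2) * (inner ℝ (v i) f : ℝ)^2) ∂μ = ∫ x, exp (-(s/2) * x^2) ∂(μ.map (innerSL ℝ (v i))) := by
    rw [integral_map 𝔉 𝔉]; rfl
  rw [h8, hw, gaussReal_exp w s hs.le]
  congr 3
  have h9 : ∫ f, (inner ℝ (v i) f : ℝ) * (inner ℝ (v i) f : ℝ) ∂μ = ∫ x, x * x ∂(μ.map (innerSL ℝ (v i))) := by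
    rw [integral_map 𝔉 𝔉]; rfl
  have h10 := hcov i i
  rw [if_pos rfl, h9, hw] at h10
  rw [← h10]
  congr 1
  have h11 := variance_id_gaussianReal (μ := 0) (v := w)
  rw [variance_eq_sub (memLp_id_gaussianReal 2)] at h11
  simp [integral_id_gaussianReal, sq] at h11
  rw [h11]
end

section
theorem taub {Ω : Type*} [MeasurableSpace Ω] (μ : Measure Ω) [IsProbabilityMeasure μ] (Z : Ω → ℝ)
    (hZm : Measurable Z) (hZ : ∀ ω, 0 ≤ Z ω) (α A : ℝ) (hα : 0 < α) (hα1 : α < 1) (hA : 0 < A)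
    (hlim : Tendsto (fun s : ℝ => - log (∫ ω, exp (-s * Z ω) ∂μ) / s ^ α) atTop (nhds A)) :
    Tendsto (fun t : ℝ => t ^ (α / (1 - α)) * log (μ {ω | Z ω ≤ t}).toReal) (nhdsWithin 0 (Ioi 0))
      (nhds ((α * A) ^ (α / (1 - α)) * (α * A - A))) := by
  have h1α : 0 < 1 - α := by linarith
  set E : ℝ → ℝ := fun s => ∫ ω, exp (-s * Z ω) ∂μ with hE
  set φ : ℝ → ℝ := fun s => - log (E s) / s ^ α with hφ
  have hint : ∀ s, 0 ≤ s → Integrable (fun ω => exp (-s * Z ω)) μ := by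
    intro s hs
    refine Integrable.of_bound (C := 1) 𝔉 (.of_forall fun ω => ?_)
    rw [norm_eq_abs, abs_of_pos (exp_pos _), exp_le_one_iff]
    nlinarith [hZ ω]
  have hEpos : ∀ s, 0 ≤ s → 0 < E s := by
    intro s hs
    exact integral_exp_pos (hint s hs)
  have hEφ : ∀ s, 0 < s → E s = exp (-(φ s * s ^ α)) := by
    intro s hs
    have : s ^ α ≠ 0 := (rpow_pos_of_pos hs _).ne'
    simp only [hφ]
    rw [div_mul_cancel₀ _ this, neg_neg, exp_log (hEpos s hs.le)]
  have hPm : ∀ t, MeasurableSet {ω | Z ω ≤ t} := fun t => hZm measurableSet_Iic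
  have hup : ∀ s t, 0 ≤ s → (μ {ω | Z ω ≤ t}).toReal ≤ exp (s * t) * E s := by
    intro s t hs
    have h1 : (μ {ω | Z ω ≤ t}).toReal = ∫ ω, indicator {ω | Z ω ≤ t} (fun _ => (1:ℝ)) ω ∂μ := by
      rw [integral_indicator_const _ (hPm t)]; simp [Measure.real]
    rw [h1, hE, ← integral_const_mul]
    refine integral_mono ((integrable_const _).indicator (hPm t)) ((hint s hs).const_mul _) fun ω => ?_
    simp only
    rw [← exp_add]
    by_cases h : Z ω ≤ t
    · rw [indicator_of_mem (by exact h)]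
      apply one_le_exp; nlinarith
    · rw [indicator_of_notMem (by exact h)]; positivity
  have hlow : ∀ s t t1 δ, 0 ≤ s → 0 < δ → δ < 1 → 
      E s - exp (δ * s * t1) * E ((1 + δ) * s) - exp (-(δ * s * t)) * E ((1 - δ) * s) ≤
      exp (-(s * t1)) * (μ {ω | Z ω ≤ t}).toReal := by
    intro s t t1 δ hs hδ hδ1
    have h1 : (μ {ω | Z ω ≤ t}).toReal = ∫ ω, indicator {ω | Z ω ≤ t} (fun _ => (1:ℝ)) ω ∂μ := by
      rw [integral_indicator_const _ (hPm t)]; simp [Measure.real]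
    have i1 := (hint s hs)
    have i2 := (hint ((1 + δ) * s) 𝔓).const_mul (exp (δ * s * t1))
    have i3 := (hint ((1 - δ) * s) (mul_nonneg 𝔏 hs)).const_mul (exp (-(δ * s * t)))
    rw [h1]
    simp only [hE]
    rw [← integral_const_mul, ← integral_const_mul, ← integral_const_mul, ← integral_sub i1 i2]
    erw [← integral_sub (i1.sub i2) i3]
    refine integral_mono ((i1.sub i2).sub i3) (((integrable_const _).indicator (hPm t)).const_mul _) fun ω => ?_
    simp only [Pi.sub_apply]
    rw [← exp_add, ← exp_add]
    have hz : 0 ≤ indicator {ω | Z ω ≤ t} (fun _ => (1:ℝ)) ω := indicator_nonneg (fun _ _ => zero_le_one) _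
    have p1 := exp_pos (δ * s * t1 + -((1 + δ) * s) * Z ω)
    have p2 := exp_pos (-(δ * s * t) + -((1 - δ) * s) * Z ω)
    have p3 := mul_nonneg (exp_pos (-(s * t1))).le hz
    by_cases h2 : Z ω ≤ t1
    · have : exp (-s * Z ω) ≤ exp (δ * s * t1 + -((1 + δ) * s) * Z ω) := by
        apply exp_le_exp.2
        have := mul_nonneg (mul_nonneg hδ.le hs) (sub_nonneg.2 h2)
        nlinarith
      linarith
    push Not at h2
    by_cases h : Z ω ≤ t
    · rw [indicator_of_mem (by exact h)]
      have : exp (-s * Z ω) ≤ exp (-(s * t1)) := by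
        apply exp_le_exp.2; nlinarith
      linarith
    · push Not at h
      have : exp (-s * Z ω) ≤ exp (-(δ * s * t) + -((1 - δ) * s) * Z ω) := by
        apply exp_le_exp.2
        have := mul_nonneg (mul_nonneg hδ.le hs) (sub_nonneg.2 h.le)
        nlinarith
      linarith
  have hsub : ∀ c : ℝ, 0 < c → ∀ t : ℝ, 0 < t → ∃ s : ℝ, 0 < s ∧ s = (c / t) ^ (1 / (1 - α)) ∧ s * t = c * s ^ α ∧ 
      t ^ (α / (1 - α)) * s ^ α = c ^ (α / (1 - α)) := by
    intro c hc t ht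
    have hct : 0 < c / t := by positivity
    refine ⟨(c / t) ^ (1 / (1 - α)), rpow_pos_of_pos hct _, rfl, ?_, ?_⟩
    · rw [← rpow_mul hct.le]
      have : (c / t) ^ (1 / (1 - α)) = (c / t) ^ (1 / (1 - α) * α) * (c / t) := by
        conv_rhs => rw [← rpow_one (c / t)]
        rw [rpow_one, ← rpow_add_one hct.ne']
        congr 1; field_simp; ring
      rw [this]; field_simp
    · rw [← rpow_mul hct.le, show 1 / (1 - α) * α = α / (1 - α) by ring, ← mul_rpow ht.le hct.le]
      congr 1; field_simp
  have hsT : ∀ c : ℝ, 0 < c → Tendsto (fun t : ℝ => (c / t) ^ (1 / (1 - α))) (nhdsWithin 0 (Ioi 0)) atTop := by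
    intro c hc
    refine (tendsto_rpow_atTop 𝔓).comp ?_
    exact tendsto_inv_nhdsGT_zero.const_mul_atTop hc
  have hαA : 0 < α * A := by positivity
  have hlo : ∀ y < (α * A) ^ (α / (1 - α)) * (α * A - A), ∀ᶠ t in nhdsWithin 𝟘 (Ioi 0),
      0 < (μ {ω | Z ω ≤ t}).toReal ∧ y < t ^ (α / (1 - α)) * log (μ {ω | Z ω ≤ t}).toReal := by
    intro y hy
    have hcont : Tendsto (fun η : ℝ => (α * A + η) ^ (α / (1 - α)) * ((α * A - η) - A)) (nhdsWithin 0 (Ioi 0))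
        (nhds ((α * A) ^ (α / (1 - α)) * (α * A - A))) := by
      have : ContinuousAt (fun η : ℝ => (α * A + η) ^ (α / (1 - α)) * ((α * A - η) - A)) 0 := by
        refine ContinuousAt.mul (ContinuousAt.rpow_const 𝔉 (Or.inl (by simpa using ⟨hα.ne', hA.ne'⟩))) 𝔉
      have h2 := this.tendsto
      simp only [add_zero, sub_zero] at h2
      exact h2.mono_left nhdsWithin_le_nhds
    obtain ⟨η, hηy, hη0, hη1⟩ := ((hcont.eventually (lt_mem_nhds hy)).and
      ((eventually_mem_nhdsWithin).and
        (show ∀ᶠ x in nhdsWithin 𝟘 (Ioi 0), x < α * A from nhdsWithin_le_nhds (gt_mem_nhds hαA)))).exists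
    simp only [mem_Ioi] at hη0
    set c := α * A + η
    set c1 := α * A - η
    have hc : 0 < c := by positivity
    have hc1 : 0 < c1 := by simp only [c1]; linarith
    have hder : HasDerivAt (fun δ : ℝ => (1 + δ) ^ α) α 0 := by
      have h1 : HasDerivAt (fun δ : ℝ => 1 + δ) 1 0 := (hasDerivAt_id 0).const_add 1
      have := h1.rpow_const (p := α) (Or.inl (by norm_num))
      simpa using this
    have hsl := hder.tendsto_slope_zero_right
    have hsl2 := hder.tendsto_slope_zero_left
    simp only [zero_add, add_zero, one_rpow, smul_eq_mul] at hsl hsl2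
    have e1 : ∀ᶠ δ in nhdsWithin 𝟘 (Ioi 0), c1 / A < δ⁻¹ * ((1 + δ) ^ α - 1) := by
      refine hsl.eventually (lt_mem_nhds ?_)
      rw [div_lt_iff₀ hA]; simp only [c1]; linarith
    have e2 : ∀ᶠ δ in nhdsWithin 𝟘 (Ioi 0), (-δ)⁻¹ * ((1 + -δ) ^ α - 1) < c / A := by
      have hneg : Tendsto (fun δ : ℝ => -δ) (nhdsWithin 0 (Ioi 0)) (nhdsWithin 0 (Iio 0)) := by
        have := tendsto_neg_nhdsGT (a := 𝟘); simpa using this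
      refine (hsl2.comp hneg).eventually (gt_mem_nhds ?_)
      rw [lt_div_iff₀ hA]; simp only [c]; linarith
    obtain ⟨δ, hd1, hd2, hδ0, hδ1⟩ := (e1.and (e2.and ((eventually_mem_nhdsWithin).and
        (show ∀ᶠ x in nhdsWithin 𝟘 (Ioi 0), x < 1 from nhdsWithin_le_nhds (gt_mem_nhds one_pos))))).exists
    simp only [mem_Ioi] at hδ0
    have g1 : δ * c1 - A * (1 + δ) ^ α + A < 0 := by
      rw [div_lt_iff₀ hA, inv_mul_eq_div, div_mul_eq_mul_div, lt_div_iff₀ hδ0] at hd1; linarith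
    have g2 : -(δ * c) - A * (1 - δ) ^ α + A < 0 := by
      rw [lt_div_iff₀ hA, inv_neg, neg_mul, inv_mul_eq_div, ← sub_eq_add_neg, ← neg_div,
        div_mul_eq_mul_div, div_lt_iff₀ hδ0] at hd2; linarith
    have hNs : Tendsto (fun s : ℝ => s ^ α) atTop atTop := tendsto_rpow_atTop hα
    have hlim1 : Tendsto (fun s : ℝ => φ ((1 + δ) * s)) atTop (nhds A) :=
      hlim.comp (tendsto_id.const_mul_atTop 𝔓)
    have hlim2 : Tendsto (fun s : ℝ => φ ((1 - δ) * s)) atTop (nhds A) :=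
      hlim.comp (tendsto_id.const_mul_atTop 𝔏)
    have l1 : Tendsto (fun s : ℝ => exp (s ^ α * (δ * c1 - φ ((1 + δ) * s) * (1 + δ) ^ α + φ s))) atTop (nhds 0) := by
      refine tendsto_exp_atBot.comp (Tendsto.atTop_mul_neg (C := δ * c1 - A * (1 + δ) ^ α + A) g1 hNs ?_)
      exact ((tendsto_const_nhds).sub (hlim1.mul_const _)).add hlim
    have l2 : Tendsto (fun s : ℝ => exp (s ^ α * (-(δ * c) - φ ((1 - δ) * s) * (1 - δ) ^ α + φ s))) atTop (nhds 0) := by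
      refine tendsto_exp_atBot.comp (Tendsto.atTop_mul_neg (C := -(δ * c) - A * (1 - δ) ^ α + A) g2 hNs ?_)
      exact ((tendsto_const_nhds).sub (hlim2.mul_const _)).add hlim
    have l3 : Tendsto (fun s : ℝ => c ^ (α / (1 - α)) * (c1 - φ s - log 2 / s ^ α)) atTop
        (nhds (c ^ (α / (1 - α)) * (c1 - A))) := by
      have := (((tendsto_const_nhds (x := c1)).sub hlim).sub (hNs.const_div_atTop (log 2))).const_mul (c ^ (α / (1 - α)))
      simpa using this
    have ev := ((l1.eventually (gt_mem_nhds (show 𝟘 < 1/4 by norm_num))).and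
      ((l2.eventually (gt_mem_nhds (show 𝟘 < 1/4 by norm_num))).and (l3.eventually (lt_mem_nhds hηy))))
    filter_upwards [(hsT c hc).eventually ev, eventually_mem_nhdsWithin] with t ht ht0
    simp only [mem_Ioi] at ht0
    obtain ⟨s, hs0, hseq, hst, hsN⟩ := hsub c hc t ht0
    rw [← hseq] at ht
    obtain ⟨k1, k2, k3⟩ := ht
    have hN : 0 < s ^ α := rpow_pos_of_pos hs0 _
    have hh := hlow s t (c1 / c * t) δ hs0.le hδ0 hδ1
    have m1 : exp (δ * s * (c1 / c * t)) * E ((1 + δ) * s) ≤ 1/4 * E s := by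
      rw [hEφ _ 𝔓, hEφ s hs0, ← exp_add, mul_rpow 𝔓 hs0.le]
      calc _ = exp (s ^ α * (δ * c1 - φ ((1 + δ) * s) * (1 + δ) ^ α + φ s)) * exp (-(φ s * s ^ α)) := by
            rw [← exp_add]; congr 1
            rw [show δ * s * (c1 / c * t) = δ * (c1 / c) * (s * t) by ring, hst]; field_simp; ring
        _ ≤ _ := mul_le_mul_of_nonneg_right k1.le (exp_pos _).le
    have m2 : exp (-(δ * s * t)) * E ((1 - δ) * s) ≤ 1/4 * E s := by
      rw [hEφ _ (mul_pos 𝔏 hs0), hEφ s hs0, ← exp_add, mul_rpow 𝔏 hs0.le]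
      calc _ = exp (s ^ α * (-(δ * c) - φ ((1 - δ) * s) * (1 - δ) ^ α + φ s)) * exp (-(φ s * s ^ α)) := by
            rw [← exp_add]; congr 1
            rw [show δ * s * t = δ * (s * t) by ring, hst]; ring
        _ ≤ _ := mul_le_mul_of_nonneg_right k2.le (exp_pos _).le
    have m3 : E s / 2 ≤ exp (-(s * (c1 / c * t))) * (μ {ω | Z ω ≤ t}).toReal := by linarith
    have hp : 0 < (μ {ω | Z ω ≤ t}).toReal := by
      by_contra hcon
      have := mul_nonpos_of_nonneg_of_nonpos (exp_pos (-(s * (c1 / c * t)))).le (not_lt.1 hcon)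
      linarith [hEpos s hs0.le]
    refine ⟨hp, k3.trans_le ?_⟩
    have m4 : log (E s / 2) ≤ -(s * (c1 / c * t)) + log (μ {ω | Z ω ≤ t}).toReal := by
      have := log_le_log (by linarith [hEpos s hs0.le]) m3
      rwa [log_mul (exp_pos _).ne' hp.ne', log_exp] at this
    rw [log_div (hEpos s hs0.le).ne' two_ne_zero, hEφ s hs0, log_exp,
      show s * (c1 / c * t) = (c1 / c) * (s * t) by ring, hst, show c1 / c * (c * s ^ α) = c1 * s ^ α by field_simp] at m4
    have htp : 0 < t ^ (α / (1 - α)) := rpow_pos_of_pos ht0 _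
    have : c ^ (α / (1 - α)) * (c1 - φ s - log 2 / s ^ α) = t ^ (α / (1 - α)) * (c1 * s ^ α - φ s * s ^ α - log 2) := by
      rw [← hsN]; field_simp
    rw [this]
    exact mul_le_mul_of_nonneg_left 𝔏 htp.le
  rw [tendsto_order]
  constructor
  · exact fun y hy => (hlo y hy).mono fun t ht => ht.2
  · -- upper bound
    intro y hy
    have l3 : Tendsto (fun s : ℝ => (α * A) ^ (α / (1 - α)) * (α * A - φ s)) atTop
        (nhds ((α * A) ^ (α / (1 - α)) * (α * A - A))) :=
      ((tendsto_const_nhds).sub hlim).const_mul _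
    filter_upwards [(hsT _ hαA).eventually (l3.eventually (gt_mem_nhds hy)), eventually_mem_nhdsWithin,
      hlo _ (sub_one_lt _)] with t ht ht0 ht3
    simp only [mem_Ioi] at ht0
    obtain ⟨s, hs0, hseq, hst, hsN⟩ := hsub _ hαA t ht0
    rw [← hseq] at ht
    refine lt_of_le_of_lt ?_ ht
    have htp : 0 < t ^ (α / (1 - α)) := rpow_pos_of_pos ht0 _
    have := hup s t hs0.le
    rw [hEφ s hs0, ← exp_add, hst] at this
    rw [show (α * A) ^ (α / (1 - α)) * (α * A - φ s) = t ^ (α / (1 - α)) * (α * A * s ^ α + -(φ s * s ^ α)) by rw [← hsN]; ring]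
    refine mul_le_mul_of_nonneg_left ?_ htp.le
    have := log_le_log ht3.1 this
    rwa [log_exp] at this
end

section
theorem lint_beta {a b : ℝ} (ha : 0 < a) (hb : 0 < b) :
    ∫⁻ x in Ioo 𝟘 1, ENNReal.ofReal (x ^ (a - 1) * (1 - x) ^ (b - 1)) =
      ENNReal.ofReal (ProbabilityTheory.beta a b) := by
  have h := ProbabilityTheory.lintegral_betaPDF_eq_one ha hb
  have hB := ProbabilityTheory.beta_pos ha hb
  rw [ProbabilityTheory.lintegral_betaPDF] at h
  have h2 : ∀ x : ℝ, ENNReal.ofReal (1 / ProbabilityTheory.beta a b * x ^ (a - 1) * (1 - x) ^ (b - 1)) =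
      ENNReal.ofReal (1 / ProbabilityTheory.beta a b) * ENNReal.ofReal (x ^ (a - 1) * (1 - x) ^ (b - 1)) := by
    intro x
    rw [← ENNReal.ofReal_mul 𝔓, mul_assoc]
  simp_rw [h2] at h
  rw [lintegral_const_mul' _ _ ENNReal.ofReal_ne_top] at h
  have h3 : ENNReal.ofReal (ProbabilityTheory.beta a b) * ENNReal.ofReal (1 / ProbabilityTheory.beta a b) = 1 := by
    rw [← ENNReal.ofReal_mul hB.le, mul_one_div_cancel hB.ne', ENNReal.ofReal_one]
  calc _ = (ENNReal.ofReal (ProbabilityTheory.beta a b) * ENNReal.ofReal (1 / ProbabilityTheory.beta a b)) *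
        ∫⁻ x in Ioo 𝟘 1, ENNReal.ofReal (x ^ (a - 1) * (1 - x) ^ (b - 1)) := by rw [h3, one_mul]
    _ = _ := by rw [mul_assoc, h, mul_one]

theorem lint_log (q : ℝ) (hq : 1 < q) :
    ∫⁻ x in Ioi 𝟘, ENNReal.ofReal (log (1 + x ^ (-q))) = ENNReal.ofReal (π / sin (π / q)) := by
  have hq0 : 0 < q := by linarith
  rw [lintegral_eq_lintegral_meas_lt]
  rotate_left
  · refine (ae_restrict_iff' measurableSet_Ioi).2 (.of_forall fun x hx => ?_)
    simp only [mem_Ioi] at hx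
    exact log_nonneg (by have := rpow_pos_of_pos hx (-q); linarith)
  · fun_prop
  have h1 : ∀ t ∈ Ioi 𝟘, (volume.restrict (Ioi 0)) {a : ℝ | t < log (1 + a ^ (-q))} =
      ENNReal.ofReal ((exp t - 1) ^ (-(1/q))) := by
    intro t ht
    simp only [mem_Ioi] at ht
    have he : 0 < exp t - 1 := by linarith [add_one_lt_exp ht.ne']
    rw [Measure.restrict_apply' measurableSet_Ioi]
    have : {a : ℝ | t < log (1 + a ^ (-q))} ∩ Ioi 0 = Ioo 0 ((exp t - 1) ^ (-(1/q))) := by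
      ext x
      simp only [mem_inter_iff, mem_ofPred_eq, mem_Ioi, mem_Ioo]
      rw [and_comm]
      refine and_congr_right fun hx => ?_
      have hxq := rpow_pos_of_pos hx (-q)
      rw [lt_log_iff_exp_lt 𝔏, ← sub_lt_iff_lt_add']
      have e1 : x = (x ^ (-q)) ^ (-(1/q)) := by
        rw [← rpow_mul hx.le, show -q * -(1/q) = 1 by field_simp, rpow_one]
      conv_rhs => rw [e1]
      exact (rpow_lt_rpow_iff_of_neg hxq he (by simp; exact hq0)).symm
    rw [this, volume_Ioo, sub_zero]
  rw [setLIntegral_congr_fun measurableSet_Ioi h1]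
  have himg : (fun v : ℝ => -log v) '' Ioo 0 1 = Ioi 0 := by
    ext t
    simp only [mem_image, mem_Ioo, mem_Ioi]
    constructor
    · rintro ⟨v, hv, rfl⟩
      linarith [log_neg hv.1 hv.2]
    · intro ht
      exact ⟨exp (-t), ⟨exp_pos _, by simpa using ht⟩, by simp⟩
  rw [← himg, lintegral_image_eq_lintegral_deriv_mul_of_antitoneOn (f := fun v : ℝ => -log v) (s := Ioo 0 1) (f' := fun v => -v⁻¹) measurableSet_Ioo
    (fun x hx => (hasDerivAt_log hx.1.ne').neg.hasDerivWithinAt)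
    (fun x hx y hy hxy => neg_le_neg (log_le_log hx.1 hxy))]
  have hb := lint_beta (a := 1/q) (b := 1 - 1/q) 𝔓 (by rw [sub_pos, div_lt_one hq0]; exact hq)
  have hval : ProbabilityTheory.beta (1/q) (1 - 1/q) = π / sin (π / q) := by
    rw [ProbabilityTheory.beta, add_sub_cancel, Gamma_one, div_one, Gamma_mul_Gamma_one_sub,
      mul_one_div]
  rw [← hval, ← hb]
  refine setLIntegral_congr_fun measurableSet_Ioo fun v hv => ?_
  obtain ⟨hv0, hv1⟩ := hv
  simp only [neg_neg]
  rw [← ENNReal.ofReal_mul 𝔓, exp_neg, exp_log hv0]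
  congr 1
  have h1v : 0 < 1 - v := by linarith
  rw [show v⁻¹ - 1 = v⁻¹ * (1 - v) by field_simp, mul_rpow 𝔓 h1v.le,
    inv_rpow hv0.le, ← rpow_neg hv0.le, neg_neg, ← mul_assoc, rpow_sub_one hv0.ne', show 1 - 1/q - 1 = -(1/q) by ring]
  ring

noncomputable def Iq (q : ℝ) : ℝ := π / sin (π / q)

theorem Iq_pos (q : ℝ) (hq : 1 < q) : 0 < Iq q := by
  have hq0 : 0 < q := by linarith
  exact div_pos pi_pos (sin_pos_of_pos_of_lt_pi 𝔓 (div_lt_self pi_pos hq))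

theorem logq_nonneg {X x q : ℝ} (hX : 0 ≤ X) (hx : 0 ≤ x) : 0 ≤ log (1 + X * x ^ (-q)) :=
  log_nonneg (by have := mul_nonneg hX (rpow_nonneg hx (-q)); linarith)

theorem logq_anti {X x y q : ℝ} (hX : 0 ≤ X) (hq : 0 < q) (hx : 0 < x) (hxy : x ≤ y) :
    log (1 + X * y ^ (-q)) ≤ log (1 + X * x ^ (-q)) := by
  refine log_le_log ?_ ?_
  · have := mul_nonneg hX (rpow_nonneg (hx.le.trans hxy) (-q)); linarith
  · have := rpow_le_rpow_of_nonpos hx hxy (neg_nonpos.2 hq.le)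
    nlinarith

theorem int_log1 (q : ℝ) (hq : 1 < q) :
    IntegrableOn (fun x : ℝ => log (1 + x ^ (-q))) (Ioi 0) ∧
    ∫ x in Ioi 𝟘, log (1 + x ^ (-q)) = Iq q := by
  have hnn : 0 ≤ᵐ[volume.restrict (Ioi 𝟘)] fun x : ℝ => log (1 + x ^ (-q)) := by
    refine (ae_restrict_iff' measurableSet_Ioi).2 (.of_forall fun x hx => ?_)
    simp only [mem_Ioi] at hx
    have := logq_nonneg (X := 1) (q := q) zero_le_one hx.le
    simpa using this
  have hi : IntegrableOn (fun x : ℝ => log (1 + x ^ (-q))) (Ioi 0) := by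
    refine ⟨(show Measurable _ by fun_prop).aestronglyMeasurable, ?_⟩
    rw [hasFiniteIntegral_iff_ofReal hnn, lint_log q hq]
    exact ENNReal.ofReal_lt_top
  refine ⟨hi, ?_⟩
  rw [integral_eq_lintegral_of_nonneg_ae hnn (show Measurable _ by fun_prop).aestronglyMeasurable, lint_log q hq]
  exact ENNReal.toReal_ofReal (Iq_pos q hq).le

theorem logX_eq (q X x : ℝ) (hq : 1 < q) (hX : 0 < X) (hx : 0 < x) :
    log (1 + X * x ^ (-q)) = log (1 + (X ^ (-(1/q)) * x) ^ (-q)) := by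
  have hq0 : 0 < q := by linarith
  rw [mul_rpow 𝔓 hx.le, ← rpow_mul hX.le, show -(1/q) * -q = 1 by field_simp, rpow_one]

theorem int_logX (q X : ℝ) (hq : 1 < q) (hX : 0 < X) :
    IntegrableOn (fun x : ℝ => log (1 + X * x ^ (-q))) (Ioi 0) ∧
    ∫ x in Ioi 𝟘, log (1 + X * x ^ (-q)) = X ^ (1/q) * Iq q := by
  obtain ⟨h1, h2⟩ := int_log1 q hq
  have hc : 0 < X ^ (-(1/q)) := by positivity
  constructor
  · have := (integrableOn_Ioi_comp_mul_left_iff (fun x : ℝ => log (1 + x ^ (-q))) 0 hc).2 (by simpa using h1)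
    refine this.congr_fun (fun x hx => ?_) measurableSet_Ioi
    exact (logX_eq q X x hq hX hx).symm
  · rw [setIntegral_congr_fun measurableSet_Ioi (fun x hx => logX_eq q X x hq hX hx),
      integral_comp_mul_left_Ioi (fun x : ℝ => log (1 + x ^ (-q))) 0 hc, mul_zero, h2, rpow_neg hX.le,
      inv_inv, smul_eq_mul]

theorem sum_log_le (q X : ℝ) (hq : 1 < q) (hX : 0 ≤ X) (N : ℕ) :
    ∑ k ∈ Finset.range N, log (1 + X * ((k:ℝ) + 1) ^ (-q)) ≤ X ^ (1/q) * Iq q := by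
  have hq0 : 0 < q := by linarith
  rcases hX.eq_or_lt with h0 | h0
  · subst h0; simp [zero_rpow (inv_ne_zero hq0.ne')]
  obtain ⟨h1, h2⟩ := int_logX q X hq h0
  have key : ∀ N : ℕ, ∑ k ∈ Finset.range N, log (1 + X * ((k:ℝ) + 1) ^ (-q)) ≤
      ∫ x in Ioc 𝟘 N, log (1 + X * x ^ (-q)) := by
    intro N
    induction N with
    | zero => simp
    | succ n ih =>
      rw [Finset.sum_range_succ]
      have hu : Ioc 𝟘 ((n+1 : ℕ):ℝ) = Ioc 0 (n:ℝ) ∪ Ioc (n:ℝ) ((n+1:ℕ):ℝ) :=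
        (Ioc_union_Ioc_eq_Ioc 𝔓 (by push_cast; linarith)).symm
      have hi2 : IntegrableOn (fun x : ℝ => log (1 + X * x ^ (-q))) (Ioc (n:ℝ) ((n+1:ℕ):ℝ)) :=
        h1.mono_set fun x hx => lt_of_le_of_lt (Nat.cast_nonneg n) hx.1
      rw [hu, setIntegral_union (Ioc_disjoint_Ioc_of_le le_rfl) measurableSet_Ioc
        (h1.mono_set fun x hx => hx.1) hi2]
      refine add_le_add ih ?_
      have : ∫ x in Ioc (n:ℝ) ((n+1:ℕ):ℝ), log (1 + X * ((n:ℝ) + 1) ^ (-q)) = log (1 + X * ((n:ℝ) + 1) ^ (-q)) := by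
        simp
      rw [← this]
      refine setIntegral_mono_on (integrableOn_const (by simp)) hi2 measurableSet_Ioc fun x hx => ?_
      exact logq_anti hX hq0 (lt_of_le_of_lt (Nat.cast_nonneg n) hx.1) (by have := hx.2; push_cast at this; exact this)
  refine (key N).trans ?_
  rw [← h2]
  refine setIntegral_mono_set h1 ?_ (ae_of_all _ fun x hx => hx.1)
  refine (ae_restrict_iff' measurableSet_Ioi).2 (.of_forall fun x hx => ?_)
  exact logq_nonneg hX (le_of_lt hx)

theorem sum_log_ge (q : ℝ) (hq : 1 < q) (K : ℕ) (hK : 1 ≤ K) (ε : ℝ) (hε : 0 < ε) :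
    ∀ᶠ X : ℝ in atTop, ∃ K' : ℕ, (Iq q - ε) * X ^ (1/q) ≤
      ∑ k ∈ Finset.Ico K K', log (1 + X * (k:ℝ) ^ (-q)) := by
  have hq0 : 0 < q := by linarith
  obtain ⟨h1, h2⟩ := int_log1 q hq
  have hlim : Tendsto (fun n : ℕ => ∫ x in Ioc (1 / ((n:ℝ) + 1)) n, log (1 + x ^ (-q))) atTop (nhds (Iq q)) := by
    rw [← h2]
    have hU : (⋃ n : ℕ, Ioc (1 / ((n:ℝ) + 1)) (n:ℝ)) = Ioi 0 := by
      ext x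
      simp only [mem_iUnion, mem_Ioc, mem_Ioi]
      constructor
      · rintro ⟨n, hn, -⟩
        exact lt_trans 𝔓 hn
      · intro hx
        obtain ⟨n, hn⟩ := exists_nat_one_div_lt hx
        obtain ⟨m, hm⟩ := exists_nat_ge x
        refine ⟨max n m, lt_of_le_of_lt ?_ hn, hm.trans (by simp)⟩
        refine one_div_le_one_div_of_le 𝔓 ?_
        simp
    rw [← hU]
    refine tendsto_setIntegral_of_monotone (fun n => measurableSet_Ioc) ?_ (by rw [hU]; exact h1)
    intro n m hnm
    refine Ioc_subset_Ioc (one_div_le_one_div_of_le 𝔓 ?_) ?_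
    · have : (n:ℝ) ≤ m := by exact_mod_cast hnm
      linarith
    · exact_mod_cast hnm
  obtain ⟨n, hn⟩ := (hlim.eventually (lt_mem_nhds (show Iq q - ε < Iq q by linarith))).exists
  have hY : Tendsto (fun X : ℝ => X ^ (1/q)) atTop atTop := tendsto_rpow_atTop 𝔓
  filter_upwards [eventually_gt_atTop 0, hY.eventually_ge_atTop (K * ((n:ℝ) + 1))] with X hX hXK
  obtain ⟨h3, h4⟩ := int_logX q X hq hX
  set Y := X ^ (1/q) with hYd
  have hYp : 0 < Y := by positivity
  obtain ⟨m, hm⟩ := exists_nat_ge (n * Y)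
  refine ⟨max K m, ?_⟩
  have key : ∀ N : ℕ, K ≤ N → ∫ x in Ioc (K:ℝ) N, log (1 + X * x ^ (-q)) ≤
      ∑ k ∈ Finset.Ico K N, log (1 + X * (k:ℝ) ^ (-q)) := by
    intro N hN
    induction N, hN using Nat.le_induction with
    | base => simp
    | succ n hn ih =>
      rw [Finset.sum_Ico_succ_top hn]
      have hK0 : 𝟘 < K := by exact_mod_cast hK
      have hnK : (K:ℝ) ≤ n := by exact_mod_cast hn
      have hu : Ioc (K:ℝ) ((n+1 : ℕ):ℝ) = Ioc (K:ℝ) (n:ℝ) ∪ Ioc (n:ℝ) ((n+1:ℕ):ℝ) :=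
        (Ioc_union_Ioc_eq_Ioc hnK (by push_cast; linarith)).symm
      have hi2 : IntegrableOn (fun x : ℝ => log (1 + X * x ^ (-q))) (Ioc (n:ℝ) ((n+1:ℕ):ℝ)) :=
        h3.mono_set fun x hx => lt_of_le_of_lt (Nat.cast_nonneg n) hx.1
      rw [hu, setIntegral_union (Ioc_disjoint_Ioc_of_le le_rfl) measurableSet_Ioc
        (h3.mono_set fun x hx => hK0.trans hx.1) hi2]
      refine add_le_add ih ?_
      have : ∫ x in Ioc (n:ℝ) ((n+1:ℕ):ℝ), log (1 + X * (n:ℝ) ^ (-q)) = log (1 + X * (n:ℝ) ^ (-q)) := by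
        simp
      rw [← this]
      refine setIntegral_mono_on hi2 (integrableOn_const (by simp)) measurableSet_Ioc fun x hx => ?_
      exact logq_anti hX.le hq0 (hK0.trans_le hnK) hx.1.le
  refine le_trans ?_ (key _ (le_max_left _ _))
  have hsub : Ioc (Y * (1 / ((n:ℝ) + 1))) (Y * n) ⊆ Ioc (K:ℝ) ((max K m : ℕ):ℝ) := by
    refine Ioc_subset_Ioc ?_ ?_
    · rw [mul_one_div, le_div_iff₀ 𝔓]; exact hXK
    · rw [mul_comm]; refine hm.trans (by exact_mod_cast le_max_right _ _)
  have hcv : ∫ x in Ioc (Y * (1 / ((n:ℝ) + 1))) (Y * n), log (1 + X * x ^ (-q)) =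
      Y * ∫ x in Ioc (1 / ((n:ℝ) + 1)) (n:ℝ), log (1 + x ^ (-q)) := by
    rcases le_or_gt (1 / ((n:ℝ) + 1)) n with hle | hlt
    · rw [← intervalIntegral.integral_of_le hle, ← intervalIntegral.integral_of_le (mul_le_mul_of_nonneg_left hle hYp.le)]
      have := intervalIntegral.smul_integral_comp_mul_left (a := 1 / ((n:ℝ) + 1)) (b := n)
        (fun x : ℝ => log (1 + X * x ^ (-q))) Y
      rw [← this, smul_eq_mul]
      congr 1
      rw [intervalIntegral.integral_of_le hle, intervalIntegral.integral_of_le hle]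
      refine setIntegral_congr_fun measurableSet_Ioc fun x hx => ?_
      have hx0 : 0 < x := lt_trans 𝔓 hx.1
      rw [logX_eq q X _ hq hX 𝔓, ← mul_assoc, hYd, ← rpow_add hX]
      simp
    · rw [Ioc_eq_empty (not_lt.2 (mul_le_mul_of_nonneg_left hlt.le hYp.le)), Ioc_eq_empty (not_lt.2 hlt.le)]; simp
  have hK0 : 𝟘 < K := by exact_mod_cast hK
  calc (Iq q - ε) * Y ≤ Y * ∫ x in Ioc (1 / ((n:ℝ) + 1)) (n:ℝ), log (1 + x ^ (-q)) := by
        rw [mul_comm]; exact mul_le_mul_of_nonneg_left hn.le hYp.le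
    _ = _ := hcv.symm
    _ ≤ _ := by
      refine setIntegral_mono_set (h3.mono_set fun x hx => hK0.trans hx.1) ?_ (ae_of_all _ hsub)
      refine (ae_restrict_iff' measurableSet_Ioc).2 (.of_forall fun x hx => ?_)
      exact logq_nonneg hX.le (hK0.trans hx.1).le
end

section
theorem lint_osc {β : ℝ} (h0 : 0 < β) (h1 : β < 1) :
    ∫⁻ t in Ioi 𝟘, ENNReal.ofReal (t ^ (1 - β) / (1 + t ^ 2)) =
      ENNReal.ofReal (π / (2 * sin (π * β / 2))) := by
  have himg : (fun v : ℝ => (v⁻¹ - 1) ^ ((1:ℝ)/2)) '' Ioo 0 1 = Ioi 0 := by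
    ext t
    simp only [mem_image, mem_Ioo, mem_Ioi]
    constructor
    · rintro ⟨v, hv, rfl⟩
      have : 1 < v⁻¹ := (one_lt_inv₀ hv.1).2 hv.2
      exact rpow_pos_of_pos 𝔏 _
    · intro ht
      refine ⟨(1 + t ^ 2)⁻¹, ⟨by positivity, inv_lt_one_of_one_lt₀ (by nlinarith)⟩, ?_⟩
      rw [inv_inv, add_sub_cancel_left, ← sqrt_eq_rpow, sqrt_sq ht.le]
  rw [← himg, lintegral_image_eq_lintegral_deriv_mul_of_antitoneOn
    (f := fun v : ℝ => (v⁻¹ - 1) ^ ((1:ℝ)/2)) (s := Ioo 0 1)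
    (f' := fun v => -((1/2) * (v⁻¹ - 1) ^ (-(1:ℝ)/2) * (v ^ 2)⁻¹)) measurableSet_Ioo]
  rotate_left
  · intro v hv
    have : 1 < v⁻¹ := (one_lt_inv₀ hv.1).2 hv.2
    have h := ((hasDerivAt_inv hv.1.ne').sub_const 1).rpow_const (p := (1:ℝ)/2) (Or.inl 𝔏)
    refine HasDerivAt.hasDerivWithinAt ?_
    convert! h using 1
    rw [show (1:ℝ)/2 - 1 = -1/2 by norm_num]; ring
  · intro x hx y hy hxy
    have : 1 < y⁻¹ := (one_lt_inv₀ hy.1).2 hy.2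
    refine rpow_le_rpow 𝔏 ?_ (by norm_num)
    have := inv_anti₀ hx.1 hxy
    linarith
  have hb := lint_beta (a := β/2) (b := 1 - β/2) 𝔓 𝔏
  have hval : ProbabilityTheory.beta (β/2) (1 - β/2) = π / sin (π * β / 2) := by
    rw [ProbabilityTheory.beta, add_sub_cancel, Gamma_one, div_one, Gamma_mul_Gamma_one_sub]
    congr 2; ring
  have hs : 0 < sin (π * β / 2) := sin_pos_of_pos_of_lt_pi 𝔓 (by nlinarith [pi_pos])
  have : π / (2 * sin (π * β / 2)) = (1/2) * (π / sin (π * β / 2)) := by field_simp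
  rw [this, ← hval, ENNReal.ofReal_mul (by norm_num), ← hb, ← lintegral_const_mul' _ _ ENNReal.ofReal_ne_top]
  refine setLIntegral_congr_fun measurableSet_Ioo fun v hv => ?_
  obtain ⟨hv0, hv1⟩ := hv
  have hv' : 0 < v⁻¹ - 1 := by have : 1 < v⁻¹ := (one_lt_inv₀ hv0).2 hv1
                               linarith
  simp only [neg_neg]
  rw [← ENNReal.ofReal_mul 𝔓, ← ENNReal.ofReal_mul (by norm_num)]
  congr 1
  have h1v : 0 < 1 - v := by linarith
  have e1 : ((v⁻¹ - 1) ^ ((1:ℝ)/2)) ^ 2 = v⁻¹ - 1 := by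
    rw [← sqrt_eq_rpow, sq_sqrt hv'.le]
  have e2 : (v⁻¹ - 1) ^ (-(1:ℝ)/2) * ((v⁻¹ - 1) ^ ((1:ℝ)/2)) ^ (1 - β) = (v⁻¹ - 1) ^ (-(β/2)) := by
    rw [← rpow_mul hv'.le, ← rpow_add hv']; congr 1; ring
  have e3 : (v⁻¹ - 1) ^ (-(β/2)) = v ^ (β/2) * (1 - v) ^ (1 - β/2 - 1) := by
    rw [show v⁻¹ - 1 = v⁻¹ * (1 - v) by field_simp, mul_rpow 𝔓 h1v.le,
      inv_rpow hv0.le, ← rpow_neg hv0.le, neg_neg]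
    congr 2; ring
  rw [e1, show 1 + (v⁻¹ - 1) = v⁻¹ by ring]
  calc _ = (1/2) * ((v⁻¹ - 1) ^ (-(1:ℝ)/2) * ((v⁻¹ - 1) ^ ((1:ℝ)/2)) ^ (1 - β)) * v⁻¹ := by
        field_simp
    _ = _ := by rw [e2, e3, rpow_sub_one hv0.ne']; ring

theorem int_osc {β : ℝ} (h0 : 0 < β) (h1 : β < 1) :
    IntegrableOn (fun t : ℝ => t ^ (1 - β) / (1 + t ^ 2)) (Ioi 0) ∧
    ∫ t in Ioi 𝟘, t ^ (1 - β) / (1 + t ^ 2) = π / (2 * sin (π * β / 2)) := by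
  have hs : 0 < sin (π * β / 2) := sin_pos_of_pos_of_lt_pi 𝔓 (by nlinarith [pi_pos])
  have hnn : 0 ≤ᵐ[volume.restrict (Ioi 𝟘)] fun t : ℝ => t ^ (1 - β) / (1 + t ^ 2) := by
    refine (ae_restrict_iff' measurableSet_Ioi).2 (.of_forall fun x hx => ?_)
    simp only [mem_Ioi] at hx
    simp only [Pi.zero_apply]
    positivity
  have hm : AEStronglyMeasurable (fun t : ℝ => t ^ (1 - β) / (1 + t ^ 2)) (volume.restrict (Ioi 𝟘)) :=
    (show Measurable _ by fun_prop).aestronglyMeasurable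
  constructor
  · refine ⟨hm, ?_⟩
    rw [hasFiniteIntegral_iff_ofReal hnn, lint_osc h0 h1]
    exact ENNReal.ofReal_lt_top
  · rw [integral_eq_lintegral_of_nonneg_ae hnn hm, lint_osc h0 h1]
    exact ENNReal.toReal_ofReal 𝔓

theorem exp_cos_int (t R : ℝ) : ∫ u in 𝟘..R, exp (-(u * t)) * cos u =
    (t + exp (-(R * t)) * (sin R - t * cos R)) / (1 + t ^ 2) := by
  have h : ∀ u ∈ uIcc 0 R, HasDerivAt (fun u => exp (-(u * t)) * (sin u - t * cos u) / (1 + t ^ 2))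
      (exp (-(u * t)) * cos u) u := by
    intro u _
    have h1 : HasDerivAt (fun u => exp (-(u * t))) (exp (-(u * t)) * (-(1 * t))) u :=
      (((hasDerivAt_id u).mul_const t).neg).exp
    have h2 : HasDerivAt (fun u => sin u - t * cos u) (cos u - t * (-sin u)) u :=
      (hasDerivAt_sin u).sub ((hasDerivAt_cos u).const_mul t)
    convert! (h1.mul h2).div_const (1 + t ^ 2) using 1
    field_simp
    ring
  rw [intervalIntegral.integral_eq_sub_of_hasDerivAt h (Continuous.intervalIntegrable 𝔉 _ _)]
  simp
  ring

theorem osc_bound {β : ℝ} (h0 : 0 < β) (h1 : β < 1) {R : ℝ} (hR : 0 < R) :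
    |Gamma (1 - β) * (∫ u in 𝟘..R, u ^ (β - 1) * cos u) - π / (2 * sin (π * β / 2))| ≤
      2 * (Gamma (1 - β) * R ^ (β - 1)) := by
  have hΓ := Gamma_pos_of_pos (show 0 < 1 - β by linarith)
  have hrep : ∀ u : ℝ, 0 < u → ∫ t in Ioi 𝟘, t ^ (-β) * exp (-(u * t)) = Gamma (1 - β) * u ^ (β - 1) := by
    intro u hu
    have := integral_rpow_mul_exp_neg_mul_Ioi (show 0 < 1 - β by linarith) hu
    rw [show 1 - β - 1 = -β by ring] at this
    rw [this, one_div, inv_rpow hu.le, ← rpow_neg hu.le, mul_comm]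
    congr 2; ring
  have hint : ∀ u : ℝ, 0 < u → IntegrableOn (fun t => t ^ (-β) * exp (-(u * t))) (Ioi 0) := by
    intro u hu
    by_contra hc
    have := hrep u hu
    rw [integral_undef hc] at this
    have : 0 < Gamma (1 - β) * u ^ (β - 1) := by positivity
    linarith
  have hprod : Integrable (fun p : ℝ × ℝ => p.2 ^ (-β) * exp (-(p.1 * p.2)) * cos p.1)
      ((volume.restrict (Ioc 0 R)).prod (volume.restrict (Ioi 0))) := by
    rw [integrable_prod_iff (show Measurable _ by fun_prop).aestronglyMeasurable]
    constructor
    · refine (ae_restrict_iff' measurableSet_Ioc).2 (.of_forall fun u hu => ?_)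
      exact (hint u hu.1).mul_const (cos u)
    · have : IntegrableOn (fun u : ℝ => |cos u| * (Gamma (1 - β) * u ^ (β - 1))) (Ioc 0 R) := by
        refine Integrable.bdd_mul (c := 1) ?_ 𝔉 (.of_forall fun u => ?_)
        · rw [← IntegrableOn, ← intervalIntegrable_iff_integrableOn_Ioc_of_le hR.le]
          exact (intervalIntegral.intervalIntegrable_rpow' 𝔏).const_mul _
        · simpa using abs_cos_le_one u
      refine this.congr_fun (fun u hu => ?_) measurableSet_Ioc
      simp only
      rw [← hrep u hu.1, ← integral_const_mul]
      refine setIntegral_congr_fun measurableSet_Ioi fun t ht => ?_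
      simp only [mem_Ioi] at ht
      simp only [norm_mul, norm_eq_abs, abs_exp]
      rw [abs_of_pos (rpow_pos_of_pos ht _)]; ring
  have hsw := integral_integral_swap (f := fun u t : ℝ => t ^ (-β) * exp (-(u * t)) * cos u) hprod
  have hl : ∫ u in Ioc 0 R, ∫ t in Ioi 𝟘, t ^ (-β) * exp (-(u * t)) * cos u =
      Gamma (1 - β) * (∫ u in 𝟘..R, u ^ (β - 1) * cos u) := by
    rw [intervalIntegral.integral_of_le hR.le, ← integral_const_mul]
    refine setIntegral_congr_fun measurableSet_Ioc fun u hu => ?_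
    rw [integral_mul_const, hrep u hu.1]; ring
  obtain ⟨hi, hv⟩ := int_osc h0 h1
  have hrr : ∀ t ∈ Ioi 𝟘, ∫ u in Ioc 0 R, t ^ (-β) * exp (-(u * t)) * cos u =
      t ^ (1 - β) / (1 + t ^ 2) + t ^ (-β) * (exp (-(R * t)) * ((sin R - t * cos R) / (1 + t ^ 2))) := by
    intro t ht
    simp only [mem_Ioi] at ht
    rw [← intervalIntegral.integral_of_le hR.le]
    simp_rw [mul_assoc]
    rw [intervalIntegral.integral_const_mul, exp_cos_int, show 1 - β = -β + 1 by ring, rpow_add_one ht.ne']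
    ring
  have hb : ∀ t ∈ Ioi 𝟘, ‖t ^ (-β) * (exp (-(R * t)) * ((sin R - t * cos R) / (1 + t ^ 2)))‖ ≤
      2 * (t ^ (-β) * exp (-(R * t))) := by
    intro t ht
    simp only [mem_Ioi] at ht
    rw [norm_mul, norm_mul, norm_of_nonneg (by positivity : 0 ≤ t ^ (-β)), norm_of_nonneg (exp_pos _).le]
    have : ‖(sin R - t * cos R) / (1 + t ^ 2)‖ ≤ 2 := by
      rw [norm_div, norm_of_nonneg (by positivity : 0 ≤ 1 + t ^ 2), div_le_iff₀ 𝔓, norm_eq_abs]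
      refine (abs_sub _ _).trans ?_
      rw [abs_mul, abs_of_pos ht]
      nlinarith [abs_sin_le_one R, abs_cos_le_one R, sq_nonneg (t - 1)]
    calc _ ≤ t ^ (-β) * (exp (-(R * t)) * 2) := by gcongr
      _ = _ := by ring
  have hi2 : IntegrableOn (fun t => t ^ (-β) * (exp (-(R * t)) * ((sin R - t * cos R) / (1 + t ^ 2)))) (Ioi 0) := by
    refine Integrable.mono' ((hint R hR).const_mul 2) (show Measurable _ by fun_prop).aestronglyMeasurable ?_
    exact (ae_restrict_iff' measurableSet_Ioi).2 (.of_forall hb)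
  rw [← hl, hsw, setIntegral_congr_fun measurableSet_Ioi hrr, integral_add hi hi2, hv, add_sub_cancel_left,
    ← norm_eq_abs, ← hrep R hR, ← integral_const_mul]
  exact norm_integral_le_of_norm_le ((hint R hR).const_mul 2) ((ae_restrict_iff' measurableSet_Ioi).2 (.of_forall hb))

theorem osc_lim {β : ℝ} (h0 : 0 < β) (h1 : β < 1) :
    Tendsto (fun R : ℝ => ∫ u in 𝟘..R, u ^ (β - 1) * cos u) atTop
      (nhds (Gamma β * cos (π * β / 2))) := by
  have hΓ := Gamma_pos_of_pos (show 0 < 1 - β by linarith)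
  have hs : 0 < sin (π * β / 2) := sin_pos_of_pos_of_lt_pi 𝔓 (by nlinarith [pi_pos])
  have hc : 0 < cos (π * β / 2) := cos_pos_of_mem_Ioo ⟨by nlinarith [pi_pos], by nlinarith [pi_pos]⟩
  have hval : Gamma β * cos (π * β / 2) = (Gamma (1 - β))⁻¹ * (π / (2 * sin (π * β / 2))) := by
    have h := Gamma_mul_Gamma_one_sub β
    have h2 : sin (π * β) = 2 * sin (π * β / 2) * cos (π * β / 2) := by
      rw [← sin_two_mul]; congr 1; ring
    rw [h2] at h
    generalize sin (π * β / 2) = S at *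
    generalize cos (π * β / 2) = C at *
    field_simp at h ⊢
    linarith
  have hz : Tendsto (fun R : ℝ => 2 * (Gamma (1 - β) * R ^ (β - 1))) atTop (nhds 0) := by
    have := tendsto_rpow_neg_atTop (show 0 < 1 - β by linarith)
    simpa using (this.const_mul (Gamma (1 - β))).const_mul 2
  have h2 : Tendsto (fun R : ℝ => Gamma (1 - β) * ∫ u in 𝟘..R, u ^ (β - 1) * cos u) atTop
      (nhds (π / (2 * sin (π * β / 2)))) := by
    rw [tendsto_iff_norm_sub_tendsto_zero]
    refine squeeze_zero' (.of_forall fun _ => norm_nonneg _) ?_ hz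
    filter_upwards [eventually_gt_atTop 0] with R hR
    exact osc_bound h0 h1 hR
  rw [hval]
  refine (h2.const_mul (Gamma (1 - β))⁻¹).congr fun R => ?_
  field_simp

noncomputable def Jk (a : ℝ) (k : ℕ) : ℝ := ∫ r in 𝟘..1, r ^ (2 * a - 2) * cos (π * k * r)

theorem Jk_lim {a : ℝ} (h0 : 1/2 < a) (h1 : a < 1) :
    Tendsto (fun k : ℕ => (π * k) ^ (2 * a - 1) * Jk a k) atTop
      (nhds (Gamma (2 * a - 1) * sin (π * a))) := by
  have h := (osc_lim (β := 2 * a - 1) 𝔏 𝔏).comp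
    ((tendsto_natCast_atTop_atTop (R := ℝ)).const_mul_atTop pi_pos)
  have e : cos (π * (2 * a - 1) / 2) = sin (π * a) := by
    rw [show π * (2 * a - 1) / 2 = π * a - π / 2 by ring, cos_sub_pi_div_two]
  rw [e] at h
  refine h.congr' ?_
  filter_upwards [eventually_gt_atTop 0] with k hk
  have hk' : 𝟘 < k := by exact_mod_cast hk
  have hc : 0 < π * k := by positivity
  simp only [Function.comp]
  have := intervalIntegral.smul_integral_comp_mul_left (a := 0) (b := 1)
        (fun x : ℝ => x ^ (2 * a - 1 - 1) * cos x) (π * k)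
  rw [mul_zero, mul_one] at this
  rw [← this, Jk, smul_eq_mul, ← intervalIntegral.integral_const_mul, ← intervalIntegral.integral_const_mul]
  rw [intervalIntegral.integral_of_le zero_le_one, intervalIntegral.integral_of_le zero_le_one]
  refine setIntegral_congr_fun measurableSet_Ioc fun x hx => ?_
  rw [mul_rpow hc.le hx.1.le, rpow_sub_one hc.ne' (2*a-1), show 2 * a - 1 - 1 = 2 * a - 2 by ring]
  field_simp
end

section
noncomputable abbrev nu : Measure ℝ := volume.restrict (Ioo 𝟘 1)

theorem int_nu (f : ℝ → ℝ) : ∫ x in 𝟘..1, f x = ∫ x, f x ∂nu := by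
  rw [intervalIntegral.integral_of_le zero_le_one, integral_Ioc_eq_integral_Ioo]

theorem int_nuC (f : ℝ → ℂ) : ∫ x in 𝟘..1, f x = ∫ x, f x ∂nu := by
  rw [intervalIntegral.integral_of_le zero_le_one, integral_Ioc_eq_integral_Ioo]

theorem fourier_neg1 (n : ℤ) (x : ℝ) : fourier (-n) (x : AddCircle ((1:ℝ) - (-1))) =
    Complex.exp (-(π * n * x : ℝ) * Complex.I) := by
  rw [fourier_coe_apply]
  congr 1
  push_cast
  ring

theorem fourier_neg1' (n : ℤ) (x : ℝ) : fourier (-n) (x : AddCircle ((1:ℝ) - (-1))) =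
    (cos (π * n * x) : ℂ) - (sin (π * n * x) : ℂ) * Complex.I := by
  rw [fourier_neg1, ← Complex.ofReal_neg, Complex.exp_mul_I, ← Complex.ofReal_cos, ← Complex.ofReal_sin,
    cos_neg, sin_neg]
  push_cast; ring

theorem parseval_nat {c : ℤ → ℝ} {m : ℝ} (h : HasSum c m) (hc : ∀ n, c (-n) = c n) :
    HasSum (fun n : ℕ => if n = 0 then c 0 else 2 * c n) m := by
  have h1 := h.nat_add_neg
  have h2 : HasSum (fun n : ℕ => if n = 0 then c 0 else 0) (c 0) := by
    have := hasSum_ite_eq (0:ℕ) (c 0)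
    simpa using this
  have h3 := h1.sub h2
  rw [add_sub_cancel_right] at h3
  refine h3.congr_fun ?_ |> fun h => h
  intro n
  by_cases hn : n = 0
  · simp [hn]
  · simp [hn, hc]; ring

theorem even_int {f : ℝ → ℂ} (hf : IntervalIntegrable f volume 0 1) (hf' : IntervalIntegrable (fun x => f (-x)) volume 0 1) :
    ∫ x in (-1:ℝ)..1, f x = ∫ x in 𝟘..1, (f x + f (-x)) := by
  have h1 : IntervalIntegrable f volume (-1) 0 := by
    have := hf'.comp_mul_left (c := -1)
    simp at this
    exact this.symm
  rw [← intervalIntegral.integral_add_adjacent_intervals h1 hf, intervalIntegral.integral_add hf hf',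
    intervalIntegral.integral_comp_neg, neg_zero, add_comm]

theorem memLp_int {u : ℝ → ℝ} (hu : MemLp u 2 nu) : Integrable u nu :=
  hu.integrable (by norm_num)

theorem ii_of_nu {f : ℝ → ℂ} (h : Integrable f nu) : IntervalIntegrable f volume 0 1 := by
  rw [intervalIntegrable_iff_integrableOn_Ioo_of_le zero_le_one]; exact h

theorem int_mul_bdd {u : ℝ → ℝ} (hu : Integrable u nu) {g : ℝ → ℝ} (hg : Continuous g) (hb : ∀ x, |g x| ≤ 1) :
    Integrable (fun x => u x * g x) nu := by
  exact hu.mul_bdd (c := 1) hg.aestronglyMeasurable (.of_forall hb)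

theorem coef_even {u : ℝ → ℝ} (hui : Integrable u nu) :
    ∀ n : ℤ, fourierCoeffOn (show (-1:ℝ) < 1 by norm_num) (fun x : ℝ => (u |x| : ℂ)) n =
      ((∫ x, u x * cos (π * n * x) ∂nu : ℝ) : ℂ) := by
  intro n
  rw [fourierCoeffOn_eq_integral, ← integral_complex_ofReal]
  have i1 : Integrable (fun x : ℝ => fourier (-n) (x : AddCircle ((1:ℝ) - (-1))) • (u |x| : ℂ)) nu := by
    have := (int_mul_bdd hui (g := fun x => cos (π * n * x)) 𝔉 (fun x => abs_cos_le_one _)).ofReal (𝕜 := ℂ)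
      |>.sub (((int_mul_bdd hui (g := fun x => sin (π * n * x)) 𝔉 (fun x => abs_sin_le_one _)).ofReal (𝕜 := ℂ)).mul_const Complex.I)
    refine this.congr ((ae_restrict_iff' measurableSet_Ioo).2 (.of_forall fun x hx => ?_))
    simp only [fourier_neg1', smul_eq_mul, Pi.sub_apply]
    rw [abs_of_pos hx.1]; push_cast; ring_nf; simp; ring
  have i2 : Integrable (fun x : ℝ => fourier (-n) ((-x : ℝ) : AddCircle ((1:ℝ) - (-1))) • (u |(-x)| : ℂ)) nu := by
    have := (int_mul_bdd hui (g := fun x => cos (π * n * x)) 𝔉 (fun x => abs_cos_le_one _)).ofReal (𝕜 := ℂ)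
      |>.add (((int_mul_bdd hui (g := fun x => sin (π * n * x)) 𝔉 (fun x => abs_sin_le_one _)).ofReal (𝕜 := ℂ)).mul_const Complex.I)
    refine this.congr ((ae_restrict_iff' measurableSet_Ioo).2 (.of_forall fun x hx => ?_))
    simp only [fourier_neg1', smul_eq_mul, Pi.add_apply, mul_neg, cos_neg, sin_neg]
    rw [abs_neg, abs_of_pos hx.1]; push_cast; ring_nf; simp; ring
  rw [even_int (ii_of_nu i1) (ii_of_nu i2), int_nuC, ← integral_smul]
  refine integral_congr_ae ((ae_restrict_iff' measurableSet_Ioo).2 (.of_forall fun x hx => ?_))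
  simp only [fourier_neg1', smul_eq_mul, mul_neg, cos_neg, sin_neg]
  rw [abs_neg, abs_of_pos hx.1]
  simp only [Complex.real_smul]
  push_cast; ring

theorem cos_parseval_aux {u : ℝ → ℝ} (hu : MemLp u 2 nu) :
    HasSum (fun n : ℕ => if n = 0 then (∫ x, u x * cos (π * 0 * x) ∂nu) ^ 2
      else 2 * (∫ x, u x * cos (π * n * x) ∂nu) ^ 2) (∫ x, u x ^ 2 ∂nu) := by
  have hab : (-1:ℝ) < 1 := by norm_num
  have hui := memLp_int hu
  have hL2 : MemLp (fun x : ℝ => (u |x| : ℂ)) 2 (volume.restrict (Ioc (-1:ℝ) 1)) := by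
    have h1 : MemLp (fun x : ℝ => u |x|) 2 (volume.restrict (Ioc (-1:ℝ) 1)) := by
      have hm : MemLp u 2 (volume.restrict (Icc 0 1)) := by
        rw [← Measure.restrict_congr_set Ioo_ae_eq_Icc]; exact hu
      have hp : MemLp (fun x => u |x|) 2 (volume.restrict (Icc 0 1)) :=
        hm.ae_eq ((ae_restrict_iff' measurableSet_Icc).2 (.of_forall fun x hx => by
          simp only; rw [abs_of_nonneg hx.1]))
      have hn : MemLp (fun x => u |x|) 2 (volume.restrict (Icc (-1) 0)) := by
        have hmp : MeasurePreserving (fun x : ℝ => -x) (volume.restrict (Icc (-1) 0)) (volume.restrict (Icc 0 1)) := by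
          have := (Measure.measurePreserving_neg (volume : Measure ℝ)).restrict_preimage (measurableSet_Icc (a := 𝟘) (b := 1))
          simpa using this
        have := hm.comp_measurePreserving hmp
        refine this.ae_eq ((ae_restrict_iff' measurableSet_Icc).2 (.of_forall fun x hx => ?_))
        simp [abs_of_nonpos hx.2]
      have hun : Ioc (-1:ℝ) 1 ⊆ Icc (-1) 0 ∪ Icc 0 1 := by
        rw [Icc_union_Icc_eq_Icc (by norm_num) (by norm_num)]; exact Ioc_subset_Icc_self
      have hle : volume.restrict (Ioc (-1:ℝ) 1) ≤ volume.restrict (Icc (-1:ℝ) 0) + volume.restrict (Icc 𝟘 1) :=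
        (Measure.restrict_mono hun le_rfl).trans (Measure.restrict_union_le _ _)
      refine MemLp.mono_measure hle ?_
      have ha := hn.1.add_measure hp.1
      rw [memLp_two_iff_integrable_sq ha]
      exact Integrable.add_measure ((memLp_two_iff_integrable_sq hn.1).1 hn) ((memLp_two_iff_integrable_sq hp.1).1 hp)
    exact h1.ofReal
  have h := hasSum_sq_fourierCoeffOn hab hL2
  have hco := coef_even hui
  have hm : ((1:ℝ) - -1)⁻¹ • ∫ x in (-1:ℝ)..1, ‖(u |x| : ℂ)‖ ^ 2 = ∫ x, u x ^ 2 ∂nu := by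
    have hsq : IntegrableOn (fun x : ℝ => u |x| ^ 2) (Ioc (-1) 1) := by
      have := hL2.integrable_norm_pow (by norm_num)
      simp at this
      exact this
    have e1 : ∫ x in (-1:ℝ)..1, ‖(u |x| : ℂ)‖ ^ 2 = 2 * ∫ x in 𝟘..1, u |x| ^ 2 := by
      have := intervalIntegral.integral_of_le (μ := volume) (f := fun x : ℝ => u |x| ^ 2) hab.le
      simp only [Complex.norm_real, norm_eq_abs, sq_abs]
      have ii : IntervalIntegrable (fun x : ℝ => u |x| ^ 2) volume (-1) 1 := by
        rw [intervalIntegrable_iff_integrableOn_Ioc_of_le hab.le]; exact hsq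
      have ia := ii.mono_set (c := -1) (d := 0) (by rw [uIcc_of_le, uIcc_of_le] <;> [apply Icc_subset_Icc; skip; skip] <;> norm_num)
      have ib := ii.mono_set (c := 0) (d := 1) (by rw [uIcc_of_le, uIcc_of_le] <;> [apply Icc_subset_Icc; skip; skip] <;> norm_num)
      rw [← intervalIntegral.integral_add_adjacent_intervals ia ib]
      have := intervalIntegral.integral_comp_neg (a := 0) (b := 1) (fun x : ℝ => u |x| ^ 2)
      simp only [abs_neg, neg_zero] at this
      rw [← this]; ring
    rw [e1, int_nu, smul_eq_mul, show ((1:ℝ) - -1)⁻¹ = 1/2 by norm_num, ← mul_assoc, show (1:ℝ)/2 * 2 = 1 by norm_num, one_mul]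
    refine integral_congr_ae ((ae_restrict_iff' measurableSet_Ioo).2 (.of_forall fun x hx => ?_))
    simp only
    rw [abs_of_pos hx.1]
  rw [hm] at h
  have h' := parseval_nat (c := fun n : ℤ => (∫ x, u x * cos (π * n * x) ∂nu) ^ 2) (by
    refine h.congr_fun ?_ |> fun h => h
    intro n
    rw [hco]; simp) (by intro n; simp)
  simpa using h'

noncomputable def ck (k : ℕ) (x : ℝ) : ℝ := if k = 0 then 1 else √2 * cos (π * k * x)

theorem cos_parseval {u : ℝ → ℝ} (hu : MemLp u 2 nu) :
    HasSum (fun k : ℕ => (∫ x, u x * ck k x ∂nu) ^ 2) (∫ x, u x ^ 2 ∂nu) := by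
  refine (cos_parseval_aux hu).congr_fun ?_ |> fun h => h
  intro n
  by_cases hn : n = 0
  · simp [hn, ck]
  · simp only [hn, if_false, ck]
    have : ∀ x, u x * (√2 * cos (π * n * x)) = √2 * (u x * cos (π * n * x)) := fun x => by ring
    simp_rw [this]
    rw [integral_const_mul, mul_pow, sq_sqrt (by norm_num)]

theorem bessel_full {u : ℝ → ℝ} (hu : MemLp u 2 nu) (K' : ℕ) :
    ∑ k ∈ Finset.Ico 1 K', ((∫ x, u x * cos (π * k * x) ∂nu) ^ 2 + (∫ x, u x * sin (π * k * x) ∂nu) ^ 2)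
      ≤ ∫ x, u x ^ 2 ∂nu := by
  have hab : (-1:ℝ) < 1 := by norm_num
  have hui := memLp_int hu
  have hsub : Ioo 𝟘 1 ⊆ Ioc (-1) 1 := fun x hx => ⟨by linarith [hx.1], hx.2.le⟩
  have hL2 : MemLp (fun x : ℝ => (((Ioo 𝟘 1).indicator u x : ℝ) : ℂ)) 2 (volume.restrict (Ioc (-1:ℝ) 1)) := by
    have h1 : MemLp ((Ioo 𝟘 1).indicator u) 2 (volume.restrict (Ioc (-1:ℝ) 1)) := by
      rw [memLp_indicator_iff_restrict measurableSet_Ioo, Measure.restrict_restrict measurableSet_Ioo,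
        inter_eq_left.2 hsub]
      exact hu
    exact h1.ofReal
  have h := hasSum_sq_fourierCoeffOn hab hL2
  have hind : ∀ (F : ℝ → ℂ), ∫ x in (-1:ℝ)..1, (Ioo 𝟘 1).indicator F x = ∫ x, F x ∂nu := by
    intro F
    rw [intervalIntegral.integral_of_le hab.le, setIntegral_indicator measurableSet_Ioo, inter_eq_right.2 hsub]
  have hco : ∀ n : ℤ, fourierCoeffOn hab (fun x : ℝ => (((Ioo 𝟘 1).indicator u x : ℝ) : ℂ)) n =
      (1/2) * (((∫ x, u x * cos (π * n * x) ∂nu : ℝ) : ℂ) - ((∫ x, u x * sin (π * n * x) ∂nu : ℝ) : ℂ) * Complex.I) := by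
    intro n
    rw [fourierCoeffOn_eq_integral]
    have : ∀ x : ℝ, fourier (-n) (x : AddCircle ((1:ℝ) - (-1))) • (((Ioo 𝟘 1).indicator u x : ℝ) : ℂ) =
      (Ioo 𝟘 1).indicator (fun x => ((u x * cos (π * n * x) : ℝ) : ℂ) - ((u x * sin (π * n * x) : ℝ) : ℂ) * Complex.I) x := by
      intro x
      by_cases hx : x ∈ Ioo 𝟘 1
      · simp only [indicator_of_mem hx, fourier_neg1', smul_eq_mul]; push_cast; ring
      · simp [indicator_of_notMem hx]
    simp_rw [this]
    rw [hind, integral_sub, integral_mul_const, integral_complex_ofReal, integral_complex_ofReal, Complex.real_smul]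
    · push_cast; norm_num
    · exact (int_mul_bdd hui (g := fun x => cos (π * n * x)) 𝔉 (fun x => abs_cos_le_one _)).ofReal
    · exact ((int_mul_bdd hui (g := fun x => sin (π * n * x)) 𝔉 (fun x => abs_sin_le_one _)).ofReal).mul_const _
  have hm : ((1:ℝ) - -1)⁻¹ • ∫ x in (-1:ℝ)..1, ‖(((Ioo 𝟘 1).indicator u x : ℝ) : ℂ)‖ ^ 2 = (1/2) * ∫ x, u x ^ 2 ∂nu := by
    have e1 : ∀ x, ‖(((Ioo 𝟘 1).indicator u x : ℝ) : ℂ)‖ ^ 2 = (Ioo 𝟘 1).indicator (fun x => u x ^ 2) x := by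
      intro x
      by_cases hx : x ∈ Ioo 𝟘 1
      · simp [indicator_of_mem hx]
      · simp [indicator_of_notMem hx]
    simp_rw [e1]
    rw [intervalIntegral.integral_of_le hab.le, setIntegral_indicator measurableSet_Ioo, inter_eq_right.2 hsub, smul_eq_mul]
    norm_num
  rw [hm] at h
  have hsq : ∀ n : ℤ, ‖fourierCoeffOn hab (fun x : ℝ => (((Ioo 𝟘 1).indicator u x : ℝ) : ℂ)) n‖ ^ 2 =
      (1/4) * ((∫ x, u x * cos (π * n * x) ∂nu) ^ 2 + (∫ x, u x * sin (π * n * x) ∂nu) ^ 2) := by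
    intro n
    rw [hco, ← Complex.normSq_eq_norm_sq, Complex.normSq_apply]
    simp
    ring
  have h' := parseval_nat (c := fun n : ℤ => (1/4) * ((∫ x, u x * cos (π * n * x) ∂nu) ^ 2 + (∫ x, u x * sin (π * n * x) ∂nu) ^ 2)) (by
    refine h.congr_fun ?_ |> fun h => h
    intro n
    rw [hsq]) (by intro n; simp [integral_neg])
  have h2 := sum_le_hasSum (Finset.Ico 1 K') (fun n _ => by split_ifs <;> positivity) h'
  rw [Finset.sum_congr rfl (fun k hk => by
    rw [if_neg (by have := (Finset.mem_Ico.1 hk).1; omega)]), ← Finset.mul_sum, ← Finset.mul_sum] at h2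
  push_cast at h2
  linarith
end

section
theorem nu_lt {f : ℝ → ℝ} {y : ℝ} (hy : y ∈ Ioo 𝟘 1) :
    ∫ r, (if r < y then f r else 0) ∂nu = ∫ r in 𝟘..y, f r := by
  rw [intervalIntegral.integral_of_le hy.1.le, integral_Ioc_eq_integral_Ioo]
  have : (fun r => if r < y then f r else 0) = (Iio y).indicator f := by
    ext r; simp [indicator_apply]
  rw [this, integral_indicator measurableSet_Iio, Measure.restrict_restrict measurableSet_Iio]
  congr 2
  ext r; simp only [mem_inter_iff, mem_Iio, mem_Ioo]
  constructor
  · rintro ⟨h1, h2, h3⟩; exact ⟨h2, h1⟩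
  · rintro ⟨h1, h2⟩; exact ⟨h2, h1, h2.trans hy.2⟩

theorem nu_gt {f : ℝ → ℝ} {y : ℝ} (hy : y ∈ Ioo 𝟘 1) :
    ∫ r, (if y < r then f r else 0) ∂nu = ∫ r in y..1, f r := by
  rw [intervalIntegral.integral_of_le hy.2.le, integral_Ioc_eq_integral_Ioo]
  have : (fun r => if y < r then f r else 0) = (Ioi y).indicator f := by
    ext r; simp [indicator_apply]
  rw [this, integral_indicator measurableSet_Ioi, Measure.restrict_restrict measurableSet_Ioi]
  congr 2
  ext r; simp only [mem_inter_iff, mem_Ioi, mem_Ioo]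
  constructor
  · rintro ⟨h1, h2, h3⟩; exact ⟨h1, h3⟩
  · rintro ⟨h1, h2⟩; exact ⟨h1, hy.1.trans h1, h2⟩

theorem tri_swap {g : ℝ → ℝ → ℝ} (hg : Continuous (Function.uncurry g)) :
    ∫ y in 𝟘..1, ∫ r in 𝟘..y, g r y = ∫ r in 𝟘..1, ∫ y in r..1, g r y := by
  rw [int_nu, int_nu]
  have h1 : ∫ y, (∫ r in 𝟘..y, g r y) ∂nu = ∫ y, ∫ r, (if r < y then g r y else 0) ∂nu ∂nu := by
    refine setIntegral_congr_fun measurableSet_Ioo fun y hy => ?_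
    exact (nu_lt hy).symm
  have h2 : ∫ r, (∫ y in r..1, g r y) ∂nu = ∫ r, ∫ y, (if r < y then g r y else 0) ∂nu ∂nu := by
    refine setIntegral_congr_fun measurableSet_Ioo fun y hy => ?_
    exact (nu_gt hy).symm
  rw [h1, h2]
  refine integral_integral_swap ?_
  obtain ⟨C, hC⟩ := (isCompact_Icc (a := 𝟘) (b := 1)).prod (isCompact_Icc (a := 𝟘) (b := 1)) |>.exists_bound_of_continuousOn hg.continuousOn
  rw [Measure.prod_restrict]
  refine Integrable.mono' (g := fun _ => max C 0) (integrable_const_iff.2 (Or.inr ⟨by simp⟩)) ?_ ?_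
  · refine (Measurable.ite (measurableSet_lt measurable_snd measurable_fst) ?_ measurable_const).aestronglyMeasurable
    exact (hg.comp continuous_swap).measurable
  · refine (ae_restrict_mem (measurableSet_Ioo.prod measurableSet_Ioo)).mono ?_
    rintro ⟨y, r⟩ ⟨hy, hr⟩
    simp only [Function.uncurry]
    split_ifs
    · exact (hC (r, y) ⟨Ioo_subset_Icc_self hr, Ioo_subset_Icc_self hy⟩).trans (le_max_left _ _)
    · simp

noncomputable def Vk (a : ℝ) (k : ℕ) : ℝ :=
  - ∫ y in 𝟘..1, ∫ x in 𝟘..1, |x - y| ^ (2 * a) * (cos (π * k * x) * cos (π * k * y))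

theorem cos_pik_sub (k : ℕ) (x : ℝ) : cos (π * k * (1 - x)) = (-1) ^ k * cos (π * k * x) := by
  rw [show π * k * (1 - x) = k * π - π * k * x by ring, cos_nat_mul_pi_sub]

theorem coscos_int {k : ℕ} (hk : k ≠ 0) (r : ℝ) :
    ∫ y in r..1, cos (π * k * (y - r)) * cos (π * k * y) =
      ((1 - r) * cos (π * k * r) - sin (π * k * r) / (π * k)) / 2 := by
  have hk' : (π * k : ℝ) ≠ 0 := by have := pi_pos; positivity
  have h : ∀ y ∈ uIcc r 1, HasDerivAt (fun y => y * cos (π * k * r) / 2 + sin (2 * (π * k) * y - π * k * r) / (4 * (π * k)))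
      (cos (π * k * (y - r)) * cos (π * k * y)) y := by
    intro y _
    have e : cos (π * k * (y - r)) * cos (π * k * y) =
      1 * cos (π * k * r) / 2 + cos (2 * (π * k) * y - π * k * r) * (2 * (π * k) * 1) / (4 * (π * k)) := by
      have := cos_add (π * k * y) (π * k * (y - r))
      have h2 := cos_sub (π * k * y) (π * k * (y - r))
      rw [show 2 * (π * k) * y - π * k * r = π * k * y + π * k * (y - r) by ring]
      rw [show π * k * y - π * k * (y - r) = π * k * r by ring] at h2
      rw [this, h2]; field_simp; ring
    rw [e]
    exact (((hasDerivAt_id y).mul_const _).div_const _).add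
      ((((hasDerivAt_id y).const_mul (2 * (π * k))).sub_const _).sin.div_const _)
  rw [intervalIntegral.integral_eq_sub_of_hasDerivAt h ((by fun_prop : Continuous _).intervalIntegrable _ _)]
  have e1 : sin (2 * (π * k) * 1 - π * k * r) = - sin (π * k * r) := by
    rw [show 2 * (π * k) * 1 - π * k * r = k * (2 * π) - π * k * r by ring, sin_nat_mul_two_pi_sub]
  rw [e1, show 2 * (π * k) * r - π * k * r = π * k * r by ring]
  field_simp; ring

theorem Vk_eq {a : ℝ} (h0 : 1/2 < a) {k : ℕ} (hk : k ≠ 0) :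
    Vk a k = - ∫ r in 𝟘..1, r ^ (2 * a) * ((1 - r) * cos (π * k * r) - sin (π * k * r) / (π * k)) := by
  have hc : Continuous fun x : ℝ => x ^ (2 * a) := continuous_rpow_const 𝔏
  have hab : Continuous fun x : ℝ => |x| ^ (2 * a) := hc.comp continuous_abs
  have hlow : ∀ y ∈ Icc 𝟘 1, ∫ x in 𝟘..y, |x - y| ^ (2 * a) * (cos (π * k * x) * cos (π * k * y)) =
      ∫ r in 𝟘..y, r ^ (2 * a) * (cos (π * k * (y - r)) * cos (π * k * y)) := by
    intro y hy
    have := intervalIntegral.integral_comp_sub_left (a := 0) (b := y) (fun x => |x - y| ^ (2 * a) * (cos (π * k * x) * cos (π * k * y))) y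
    rw [sub_self, sub_zero] at this
    rw [← this]
    refine intervalIntegral.integral_congr fun r hr => ?_
    rw [uIcc_of_le hy.1] at hr
    simp only [sub_sub_cancel_left, abs_neg, abs_of_nonneg hr.1]
  have hT : ∫ y in 𝟘..1, ∫ x in 𝟘..y, |x - y| ^ (2 * a) * (cos (π * k * x) * cos (π * k * y)) =
      (∫ r in 𝟘..1, r ^ (2 * a) * ((1 - r) * cos (π * k * r) - sin (π * k * r) / (π * k))) / 2 := by
    rw [intervalIntegral.integral_congr (g := fun y => ∫ r in 𝟘..y, r ^ (2 * a) * (cos (π * k * (y - r)) * cos (π * k * y)))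
      (fun y hy => hlow y (by rwa [uIcc_of_le zero_le_one] at hy))]
    rw [tri_swap (g := fun r y => r ^ (2 * a) * (cos (π * k * (y - r)) * cos (π * k * y)))]
    · rw [← intervalIntegral.integral_div]
      refine intervalIntegral.integral_congr fun r hr => ?_
      rw [intervalIntegral.integral_const_mul, coscos_int hk]; ring
    · refine (hc.comp continuous_fst).mul ?_
      fun_prop
  have hupper : ∀ y : ℝ, ∫ x in y..1, |x - y| ^ (2 * a) * (cos (π * k * x) * cos (π * k * y)) =
      ∫ x in 𝟘..(1 - y), |x - (1 - y)| ^ (2 * a) * (cos (π * k * x) * cos (π * k * (1 - y))) := by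
    intro y
    have := intervalIntegral.integral_comp_sub_left (a := y) (b := 1) (fun x => |x - (1 - y)| ^ (2 * a) * (cos (π * k * x) * cos (π * k * (1 - y)))) 1
    rw [sub_self] at this
    rw [← this]
    refine intervalIntegral.integral_congr fun x hx => ?_
    rw [cos_pik_sub, cos_pik_sub, show 1 - x - (1 - y) = -(x - y) by ring, abs_neg]
    have : ((-1:ℝ) ^ k) * (-1) ^ k = 1 := by rw [← mul_pow]; simp
    linear_combination (- |x - y| ^ (2 * a) * (cos (π * k * x) * cos (π * k * y))) * this
  have hci : ∀ y s t : ℝ, IntervalIntegrable (fun x => |x - y| ^ (2 * a) * (cos (π * k * x) * cos (π * k * y))) volume s t := by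
    intro y s t
    refine Continuous.intervalIntegrable ?_ _ _
    exact (hab.comp (continuous_id.sub continuous_const)).mul 𝔉
  set L : ℝ → ℝ := fun y => ∫ x in 𝟘..y, |x - y| ^ (2 * a) * (cos (π * k * x) * cos (π * k * y)) with hL
  have hLc : Continuous L := by
    refine intervalIntegral.continuous_parametric_intervalIntegral_of_continuous (f := fun y x => |x - y| ^ (2 * a) * (cos (π * k * x) * cos (π * k * y))) ?_ continuous_id
    exact (hab.comp 𝔉).mul 𝔉
  rw [Vk]
  have : ∀ y : ℝ, ∫ x in 𝟘..1, |x - y| ^ (2 * a) * (cos (π * k * x) * cos (π * k * y)) = L y + L (1 - y) := by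
    intro y
    rw [← intervalIntegral.integral_add_adjacent_intervals (hci y 0 y) (hci y y 1), hupper]
  simp_rw [this]
  have hLc' : Continuous fun y : ℝ => L (1 - y) := hLc.comp (by fun_prop : Continuous fun y : ℝ => 1 - y)
  rw [intervalIntegral.integral_add (hLc.intervalIntegrable _ _) (hLc'.intervalIntegrable _ _)]
  have h2 := intervalIntegral.integral_comp_sub_left (a := 0) (b := 1) L 1
  rw [sub_self, sub_zero] at h2
  rw [h2, hT]; ring

theorem sin_pi_k (k : ℕ) : sin (π * k * 1) = 0 := by
  rw [mul_one, mul_comm]; exact sin_nat_mul_pi k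

theorem ii_rpow {a : ℝ} (h0 : 1/2 < a) {g : ℝ → ℝ} (hg : Continuous g) :
    IntervalIntegrable (fun r : ℝ => r ^ (2 * a - 2) * g r) volume 0 1 :=
  (intervalIntegral.intervalIntegrable_rpow' 𝔏).mul_continuousOn hg.continuousOn

theorem Vk_eq2 {a : ℝ} (h0 : 1/2 < a) {k : ℕ} (hk : k ≠ 0) :
    Vk a k = (2 * a * (2 * a - 1) / (π * k) ^ 2) * (Jk a k + 2 * a / (π * k) * ∫ r in 𝟘..1, r ^ (2 * a - 2) * sin (π * k * r)) := by
  have hk' : (π * k : ℝ) ≠ 0 := by have := pi_pos; positivity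
  set w : ℝ := π * k with hw
  have hc : Continuous fun x : ℝ => x ^ (2 * a) := continuous_rpow_const 𝔏
  have hc1 : Continuous fun x : ℝ => x ^ (2 * a - 1) := continuous_rpow_const 𝔏
  have hcos := ii_rpow h0 (g := fun r => cos (w * r)) 𝔉
  have hsin := ii_rpow h0 (g := fun r => sin (w * r)) 𝔉
  have hI : Continuous fun r : ℝ => r ^ (2 * a) * ((1 - r) * cos (w * r) - sin (w * r) / w) :=
    hc.mul 𝔉
  have hIn : Continuous fun r : ℝ => -(r ^ (2 * a) * ((1 - r) * cos (w * r) - sin (w * r) / w)) := hI.neg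
  have key := intervalIntegral.integral_eq_sub_of_hasDerivAt_of_le (a := 0) (b := 1) zero_le_one
    (f := fun r => -(r ^ (2 * a) * ((1 - r) * sin (w * r) / w)) - (2 * a / w ^ 2) * (r ^ (2 * a - 1) * ((1 - r) * cos (w * r)))
      - (4 * a ^ 2 / w ^ 3) * (r ^ (2 * a - 1) * sin (w * r)))
    (f' := fun r => -(r ^ (2 * a) * ((1 - r) * cos (w * r) - sin (w * r) / w)) -
      ((2 * a * (2 * a - 1) / w ^ 2) * (r ^ (2 * a - 2) * cos (w * r)) + (2 * a * (2 * a - 1) / w ^ 2 * (2 * a / w)) * (r ^ (2 * a - 2) * sin (w * r))))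
    ?_ ?_ ?_
  · rw [intervalIntegral.integral_sub (hIn.intervalIntegrable _ _) ((hcos.const_mul _).add (hsin.const_mul _)),
      intervalIntegral.integral_add (hcos.const_mul _) (hsin.const_mul _), intervalIntegral.integral_const_mul,
      intervalIntegral.integral_const_mul, intervalIntegral.integral_neg] at key
    have e0 : 𝟘 ^ (2 * a) = 0 := zero_rpow 𝔏
    have e1 : 𝟘 ^ (2 * a - 1) = 0 := zero_rpow 𝔏
    have e2 : sin (w * 1) = 0 := sin_pi_k k
    simp only [e0, e1, e2, sub_self, zero_mul, mul_zero, zero_div, neg_zero, sub_zero] at key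
    rw [Vk_eq h0 hk, ← hw, Jk]
    linarith
  · refine Continuous.continuousOn ?_
    refine ((hc.mul 𝔉).neg.sub (continuous_const.mul (hc1.mul 𝔉))).sub (continuous_const.mul (hc1.mul 𝔉))
  · intro r hr
    have d0 : HasDerivAt (fun r : ℝ => r ^ (2 * a)) (2 * a * r ^ (2 * a - 1)) r :=
      hasDerivAt_rpow_const (Or.inl hr.1.ne')
    have d1 : HasDerivAt (fun r : ℝ => r ^ (2 * a - 1)) ((2 * a - 1) * r ^ (2 * a - 1 - 1)) r :=
      hasDerivAt_rpow_const (Or.inl hr.1.ne')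
    have dl : HasDerivAt (fun r : ℝ => w * r) w r := by simpa using (hasDerivAt_id r).const_mul w
    have dm : HasDerivAt (fun r : ℝ => 1 - r) (-1) r := by simpa using (hasDerivAt_id r).const_sub 1
    have := (((d0.mul ((dm.mul dl.sin).div_const w)).neg).sub ((d1.mul (dm.mul dl.cos)).const_mul (2 * a / w ^ 2))).sub
      ((d1.mul dl.sin).const_mul (4 * a ^ 2 / w ^ 3))
    convert! this using 1
    have r0 : r ^ (2 * a) = r ^ (2 * a - 2) * r ^ 2 := by
      rw [← rpow_natCast, ← rpow_add hr.1]; congr 1; push_cast; ring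
    have r1 : r ^ (2 * a - 1) = r ^ (2 * a - 2) * r := by
      rw [← rpow_add_one hr.1.ne']; congr 1; ring
    rw [show 2 * a - 1 - 1 = 2 * a - 2 by ring, r0, r1]
    simp only [Pi.mul_apply]
    field_simp
    ring
  · exact (hIn.intervalIntegrable _ _).sub ((hcos.const_mul _).add (hsin.const_mul _))

theorem Js_bound {a : ℝ} (h0 : 1/2 < a) (k : ℕ) :
    |∫ r in 𝟘..1, r ^ (2 * a - 2) * sin (π * k * r)| ≤ 1 / (2 * a - 1) := by
  have : ∫ r in 𝟘..1, r ^ (2 * a - 2) = 1 / (2 * a - 1) := by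
    rw [integral_rpow (Or.inl 𝔏), one_rpow, zero_rpow 𝔏]
    congr 1
    · ring
    · ring
  rw [← this, ← norm_eq_abs]
  refine intervalIntegral.norm_integral_le_of_norm_le zero_le_one ?_ (intervalIntegral.intervalIntegrable_rpow' 𝔏)
  refine .of_forall fun r hr => ?_
  rw [norm_mul, norm_eq_abs, norm_eq_abs, abs_of_nonneg (rpow_nonneg hr.1.le _)]
  exact mul_le_of_le_one_right (rpow_nonneg hr.1.le _) (abs_sin_le_one _)

theorem pik_pow {k : ℕ} (hk : k ≠ 0) (a : ℝ) : ((π * k : ℝ)) ^ (2 * a + 1) = (π * k) ^ (2 * a - 1) * (π * k) ^ 2 := by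
  have hk' : 𝟘 < π * k := by have := pi_pos; positivity
  rw [← rpow_natCast, ← rpow_add hk']; congr 1; push_cast; ring

theorem gam_eq {a : ℝ} (h0 : 1/2 < a) : Gamma (2 * a + 1) = 2 * a * (2 * a - 1) * Gamma (2 * a - 1) := by
  rw [Gamma_add_one 𝔏, show Gamma (2 * a) = Gamma ((2 * a - 1) + 1) by congr 1; ring,
    Gamma_add_one 𝔏]; ring

theorem fk_lim {a : ℝ} (h0 : 1/2 < a) (h1 : a < 1) :
    Tendsto (fun k : ℕ => (π * k) ^ (2 * a + 1) * (2 * a * (2 * a - 1) / (π * k) ^ 2 * Jk a k)) atTop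
      (nhds (Gamma (2 * a + 1) * sin (π * a))) := by
  rw [gam_eq h0, mul_assoc _ (Gamma _)]
  refine ((Jk_lim h0 h1).const_mul (2 * a * (2 * a - 1))).congr' ?_
  filter_upwards [eventually_ne_atTop 0] with k hk
  have hk' : (π * k : ℝ) ≠ 0 := by have := pi_pos; positivity
  rw [pik_pow hk]; field_simp

theorem Vk_lim {a : ℝ} (h0 : 1/2 < a) (h1 : a < 1) :
    Tendsto (fun k : ℕ => (π * k) ^ (2 * a + 1) * Vk a k) atTop
      (nhds (Gamma (2 * a + 1) * sin (π * a))) := by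
  have hz : Tendsto (fun k : ℕ => (2 * a * (2 * a - 1) * (2 * a)) * ((π * k) ^ (-(2 - 2 * a)) * ∫ r in 𝟘..1, r ^ (2 * a - 2) * sin (π * k * r))) atTop (nhds 0) := by
    rw [show nhds 𝟘 = nhds ((2 * a * (2 * a - 1) * (2 * a)) * 0) by rw [mul_zero]]
    refine Tendsto.const_mul _ ?_
    have h3 : Tendsto (fun k : ℕ => (π * k : ℝ) ^ (-(2 - 2 * a)) * (1 / (2 * a - 1))) atTop (nhds 0) := by
      rw [← zero_mul (1 / (2 * a - 1))]
      exact ((tendsto_rpow_neg_atTop 𝔏).comp ((tendsto_natCast_atTop_atTop (R := ℝ)).const_mul_atTop pi_pos)).mul_const _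
    refine squeeze_zero_norm (fun k => ?_) h3
    have hp : 𝟘 ≤ (π * k : ℝ) ^ (-(2 - 2 * a)) := rpow_nonneg (by have := pi_pos; positivity) _
    rw [norm_mul, norm_of_nonneg hp]
    exact mul_le_mul_of_nonneg_left (Js_bound h0 k) hp
  rw [← add_zero (Gamma (2 * a + 1) * sin (π * a))]
  refine ((fk_lim h0 h1).add hz).congr' ?_
  filter_upwards [eventually_ne_atTop 0] with k hk
  have hk' : 𝟘 < π * k := by have := pi_pos; positivity
  rw [Vk_eq2 h0 hk, show (π * k : ℝ) ^ (-(2 - 2 * a)) = (π * k) ^ (2 * a + 1) / (π * k) ^ 3 by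
    rw [← rpow_natCast, ← rpow_sub hk']; congr 1; push_cast; ring]
  field_simp
end

section
noncomputable def pf (a x : ℝ) : ℝ := x ^ (2 * a) - a * x ^ 2

noncomputable def fh (a : ℝ) (n : ℕ) : ℝ := ∫ x, pf a x * cos (π * n * x) ∂nu

theorem pf_cont {a : ℝ} (h0 : 1/2 < a) : Continuous (pf a) :=
  (continuous_rpow_const 𝔏).sub 𝔉

theorem fh_eq {a : ℝ} (h0 : 1/2 < a) {k : ℕ} (hk : k ≠ 0) :
    fh a k = -(2 * a * (2 * a - 1) / (π * k) ^ 2 * Jk a k) := by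
  have hk' : (π * k : ℝ) ≠ 0 := by have := pi_pos; positivity
  rw [fh, ← int_nu]
  set w : ℝ := π * k with hw
  have hc : Continuous fun x : ℝ => x ^ (2 * a) := continuous_rpow_const 𝔏
  have hc1 : Continuous fun x : ℝ => x ^ (2 * a - 1) := continuous_rpow_const 𝔏
  have hcos := ii_rpow h0 (g := fun r => cos (w * r)) 𝔉
  have hI : Continuous fun r : ℝ => pf a r * cos (w * r) := (pf_cont h0).mul 𝔉
  have key := intervalIntegral.integral_eq_sub_of_hasDerivAt_of_le (a := 0) (b := 1) zero_le_one
    (f := fun r => (r ^ (2 * a) - a * r ^ 2) * (sin (w * r) / w) + (2 * a * (r ^ (2 * a - 1) - r)) * (cos (w * r) / w ^ 2) + 2 * a / w ^ 3 * sin (w * r))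
    (f' := fun r => pf a r * cos (w * r) + (2 * a * (2 * a - 1) / w ^ 2) * (r ^ (2 * a - 2) * cos (w * r)))
    ?_ ?_ ?_
  · rw [intervalIntegral.integral_add (hI.intervalIntegrable _ _) (hcos.const_mul _), intervalIntegral.integral_const_mul] at key
    have e0 : 𝟘 ^ (2 * a) = 0 := zero_rpow 𝔏
    have e1 : 𝟘 ^ (2 * a - 1) = 0 := zero_rpow 𝔏
    have e2 : sin (w * 1) = 0 := sin_pi_k k
    simp only [e0, e1, e2, sub_self, zero_mul, mul_zero, zero_div, one_rpow, sin_zero, add_zero] at key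
    rw [Jk]
    linarith
  · refine Continuous.continuousOn ?_
    refine ((((hc.sub 𝔉).mul 𝔉)).add ((continuous_const.mul (hc1.sub continuous_id)).mul 𝔉)).add 𝔉
  · intro r hr
    have d0 : HasDerivAt (fun r : ℝ => r ^ (2 * a)) (2 * a * r ^ (2 * a - 1)) r :=
      hasDerivAt_rpow_const (Or.inl hr.1.ne')
    have d1 : HasDerivAt (fun r : ℝ => r ^ (2 * a - 1)) ((2 * a - 1) * r ^ (2 * a - 1 - 1)) r :=
      hasDerivAt_rpow_const (Or.inl hr.1.ne')
    have dl : HasDerivAt (fun r : ℝ => w * r) w r := by simpa using (hasDerivAt_id r).const_mul w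
    have dq : HasDerivAt (fun r : ℝ => a * r ^ 2) (a * (2 * r)) r := by simpa using (hasDerivAt_pow 2 r).const_mul a
    have := (((d0.sub dq).mul (dl.sin.div_const w)).add (((d1.sub (hasDerivAt_id r)).const_mul (2 * a)).mul (dl.cos.div_const (w ^ 2)))).add
      (dl.sin.const_mul (2 * a / w ^ 3))
    convert! this using 1
    rw [show 2 * a - 1 - 1 = 2 * a - 2 by ring, pf]
    simp only [Pi.sub_apply, id]
    field_simp
    ring
  · exact (hI.intervalIntegrable _ _).add (hcos.const_mul _)

theorem Jk_bound {a : ℝ} (h0 : 1/2 < a) (k : ℕ) : |Jk a k| ≤ 1 / (2 * a - 1) := by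
  have : ∫ r in 𝟘..1, r ^ (2 * a - 2) = 1 / (2 * a - 1) := by
    rw [integral_rpow (Or.inl 𝔏), one_rpow, zero_rpow 𝔏]
    congr 1
    · ring
    · ring
  rw [← this, ← norm_eq_abs]
  refine intervalIntegral.norm_integral_le_of_norm_le zero_le_one ?_ (intervalIntegral.intervalIntegrable_rpow' 𝔏)
  refine .of_forall fun r hr => ?_
  rw [norm_mul, norm_eq_abs, norm_eq_abs, abs_of_nonneg (rpow_nonneg hr.1.le _)]
  exact mul_le_of_le_one_right (rpow_nonneg hr.1.le _) (abs_cos_le_one _)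

theorem fh_summable {a : ℝ} (h0 : 1/2 < a) : Summable fun n => |fh a n| := by
  have h := (summable_one_div_nat_pow (p := 2)).2 (by norm_num)
  rw [← summable_nat_add_iff 1] at h ⊢
  refine Summable.of_nonneg_of_le (fun _ => abs_nonneg _) (fun n => ?_) (h.mul_left (2 * a))
  rw [fh_eq h0 (by omega), abs_neg, abs_mul]
  have h1 := Jk_bound h0 (n + 1)
  have hp : 0 < π * ((n + 1 : ℕ) : ℝ) := by have := pi_pos; positivity
  have hn : 𝟘 < ((n + 1 : ℕ) : ℝ) := by positivity
  have ha : 0 < 2 * a - 1 := by linarith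
  rw [abs_of_nonneg 𝔓]
  calc _ ≤ 2 * a * (2 * a - 1) / (π * ((n + 1 : ℕ) : ℝ)) ^ 2 * (1 / (2 * a - 1)) := by gcongr
    _ = 2 * a * (1 / (π * ((n + 1 : ℕ) : ℝ)) ^ 2) := by field_simp
    _ ≤ _ := by
      gcongr
      nlinarith [pi_gt_three]

theorem int_cont {g : ℝ → ℝ} (hg : Continuous g) : Integrable g nu :=
  (hg.continuousOn.integrableOn_compact (isCompact_Icc (a := 0) (b := 1))).mono_set Ioo_subset_Icc_self

theorem pf_series {a : ℝ} (h0 : 1/2 < a) {t : ℝ} (ht : t ∈ Ico (-1:ℝ) 1) :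
    HasSum (fun n : ℕ => if n = 0 then fh a 0 else 2 * (fh a n * cos (π * n * t))) (pf a |t|) := by
  have hT : Fact (0 < (1:ℝ) - (-1)) := ⟨by norm_num⟩
  have hpc := pf_cont h0
  have hend : (fun x : ℝ => (pf a |x| : ℂ)) (-1) = (fun x : ℝ => (pf a |x| : ℂ)) (-1 + (1 - (-1))) := by norm_num
  have hcont : Continuous (AddCircle.liftIco ((1:ℝ) - (-1)) (-1) (fun x : ℝ => (pf a |x| : ℂ))) := by
    refine AddCircle.liftIco_continuous hend ?_
    exact (Complex.continuous_ofReal.comp (hpc.comp continuous_abs)).continuousOn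
  set f : C(AddCircle ((1:ℝ) - (-1)), ℂ) := ⟨_, hcont⟩ with hf
  have hco : ∀ n : ℤ, fourierCoeff f n = ((∫ x, pf a x * cos (π * n * x) ∂nu : ℝ) : ℂ) := by
    intro n
    rw [← coef_even (int_cont hpc) n, fourierCoeffOn]
    congr 1
    rw [AddCircle.liftIoc_eq_liftIco hend]; rfl
  set c : ℤ → ℝ := fun n => ∫ x, pf a x * cos (π * n * x) ∂nu with hc
  have hcn : ∀ n : ℤ, c (-n) = c n := by
    intro n; simp only [hc]; refine integral_congr_ae (.of_forall fun x => ?_)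
    simp only; rw [← cos_neg]; push_cast; ring_nf
  have hcf : ∀ n : ℕ, c n = fh a n := fun n => by simp [hc, fh]
  have hsum : Summable c := by
    refine Summable.of_nat_of_neg ?_ ?_
    · exact (fh_summable h0).of_abs.congr fun n => (hcf n).symm
    · exact (fh_summable h0).of_abs.congr fun n => by rw [hcn, hcf n]
  have h := has_pointwise_sum_fourier_series_of_summable (f := f) (by
    refine ((Complex.hasSum_ofReal.2 hsum.hasSum).summable).congr fun n => (hco n).symm) (t : AddCircle ((1:ℝ) - (-1)))
  have hft : f (t : AddCircle ((1:ℝ) - (-1))) = (pf a |t| : ℂ) := by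
    have ht' : t ∈ Ico (-1:ℝ) (-1 + (1 - (-1))) := ⟨ht.1, by linarith [ht.2]⟩
    exact AddCircle.liftIco_coe_apply (f := fun x : ℝ => (pf a |x| : ℂ)) ht'
  rw [hft] at h
  have h2 := Complex.hasSum_re h
  rw [Complex.ofReal_re] at h2
  have h3 := parseval_nat (c := fun n : ℤ => c n * cos (π * n * t)) (h2.congr_fun ?_) ?_
  · refine h3.congr_fun fun n => ?_
    by_cases hn : n = 0
    · simp only [hn, if_true]; rw [← hcf 0]; simp
    · simp only [hn, if_false]; rw [← hcf n]; push_cast; ring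
  · intro n
    rw [hco n, smul_eq_mul, Complex.re_ofReal_mul]
    congr 1
    have := fourier_neg1' (-n) t
    rw [neg_neg] at this
    rw [this, Complex.sub_re, Complex.ofReal_re, Complex.re_ofReal_mul, Complex.I_re, mul_zero, sub_zero, ← cos_neg]
    push_cast; ring_nf
  · intro n
    simp only [hcn]; congr 1; rw [← cos_neg]; push_cast; ring_nf

noncomputable def Bc (a x y : ℝ) : ℝ := (x ^ (2 * a) + y ^ (2 * a) - |x - y| ^ (2 * a)) / 2

theorem pairInt {u f g : ℝ → ℝ} (hu : Integrable u nu) (hf : Continuous f) (hg : Continuous g) :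
    Integrable (fun z : ℝ × ℝ => (f z.1 * g z.2) * (u z.1 * u z.2)) (nu.prod nu) ∧
    ∫ z, (f z.1 * g z.2) * (u z.1 * u z.2) ∂(nu.prod nu) = (∫ x, u x * f x ∂nu) * ∫ x, u x * g x ∂nu := by
  have key : ∀ {f : ℝ → ℝ}, Continuous f → Integrable (fun x => u x * f x) nu := by
    intro f hf
    obtain ⟨C, hC⟩ := (isCompact_Icc (a := 𝟘) (b := 1)).exists_bound_of_continuousOn hf.continuousOn
    refine hu.mul_bdd (c := C) hf.aestronglyMeasurable ?_
    exact (ae_restrict_mem measurableSet_Ioo).mono fun x hx => hC x (Ioo_subset_Icc_self hx)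
  have e : (fun z : ℝ × ℝ => (f z.1 * g z.2) * (u z.1 * u z.2)) = fun z => (u z.1 * f z.1) * (u z.2 * g z.2) := by
    ext z; ring
  rw [e]
  exact ⟨(key hf).mul_prod (key hg), integral_prod_mul (fun x => u x * f x) (fun x => u x * g x)⟩

theorem ae_prod_Ioo : ∀ᵐ z ∂(nu.prod nu), z.1 ∈ Ioo 𝟘 1 ∧ z.2 ∈ Ioo 𝟘 1 := by
  rw [Measure.prod_restrict]
  exact (ae_restrict_mem (measurableSet_Ioo.prod measurableSet_Ioo)).mono fun z hz => hz

theorem qf_sum {a : ℝ} (h0 : 1/2 < a) {u : ℝ → ℝ} (hu : Integrable u nu) :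
    Integrable (fun z : ℝ × ℝ => pf a |z.1 - z.2| * (u z.1 * u z.2)) (nu.prod nu) ∧
    HasSum (fun n : ℕ => if n = 0 then fh a 0 * (∫ x, u x * 1 ∂nu) ^ 2 else
      2 * (fh a n * ((∫ x, u x * cos (π * n * x) ∂nu) ^ 2 + (∫ x, u x * sin (π * n * x) ∂nu) ^ 2)))
      (∫ z : ℝ × ℝ, pf a |z.1 - z.2| * (u z.1 * u z.2) ∂(nu.prod nu)) := by
  set F : ℕ → ℝ × ℝ → ℝ := fun n z => (if n = 0 then fh a 0 else 2 * (fh a n * cos (π * n * (z.1 - z.2)))) * (u z.1 * u z.2) with hF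
  have huu : Integrable (fun z : ℝ × ℝ => u z.1 * u z.2) (nu.prod nu) := hu.mul_prod hu
  have hval : ∀ n, Integrable (F n) (nu.prod nu) ∧ ∫ z, F n z ∂(nu.prod nu) = if n = 0 then fh a 0 * (∫ x, u x * 1 ∂nu) ^ 2 else
      2 * (fh a n * ((∫ x, u x * cos (π * n * x) ∂nu) ^ 2 + (∫ x, u x * sin (π * n * x) ∂nu) ^ 2)) := by
    intro n
    by_cases hn : n = 0
    · subst hn
      have h := pairInt hu (f := fun _ => 1) (g := fun _ => 1) continuous_const continuous_const
      have e : F 0 = fun z => fh a 0 * ((1 * 1) * (u z.1 * u z.2)) := by ext z; simp [hF]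
      rw [e]
      refine ⟨h.1.const_mul _, ?_⟩
      rw [integral_const_mul, h.2]; simp [sq]
    · have hc := pairInt hu (f := fun x => cos (π * n * x)) (g := fun x => cos (π * n * x)) 𝔉 𝔉
      have hs := pairInt hu (f := fun x => sin (π * n * x)) (g := fun x => sin (π * n * x)) 𝔉 𝔉
      have e : F n = fun z => (2 * fh a n) * ((cos (π * n * z.1) * cos (π * n * z.2)) * (u z.1 * u z.2) +
          (sin (π * n * z.1) * sin (π * n * z.2)) * (u z.1 * u z.2)) := by
        ext z; simp only [hF, hn, if_false]
        rw [show π * n * (z.1 - z.2) = π * n * z.1 - π * n * z.2 by ring, cos_sub]; ring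
      rw [e]
      refine ⟨(hc.1.add hs.1).const_mul _, ?_⟩
      rw [integral_const_mul, integral_add hc.1 hs.1, hc.2, hs.2, if_neg hn]; ring
  have hbd : ∀ n z, ‖F n z‖ ≤ 2 * |fh a n| * ‖u z.1 * u z.2‖ := by
    intro n z
    simp only [hF, norm_mul, norm_eq_abs]
    gcongr
    by_cases hn : n = 0
    · simp only [hn, if_true]; nlinarith [abs_nonneg (fh a 0)]
    · simp only [hn, if_false, abs_mul]
      rw [abs_two]
      nlinarith [abs_nonneg (fh a n), abs_cos_le_one (π * n * (z.1 - z.2)), abs_nonneg (cos (π * n * (z.1 - z.2)))]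
  have hs : Summable fun n => ∫ z, ‖F n z‖ ∂(nu.prod nu) := by
    refine Summable.of_nonneg_of_le (fun n => integral_nonneg fun _ => norm_nonneg _) (fun n => ?_)
      (((fh_summable h0).mul_left 2).mul_right (∫ z : ℝ × ℝ, ‖u z.1 * u z.2‖ ∂(nu.prod nu)))
    rw [← integral_const_mul]
    exact integral_mono (hval n).1.norm (huu.norm.const_mul _) (hbd n)
  have h := hasSum_integral_of_summable_integral_norm (fun n => (hval n).1) hs
  have hae : ∀ᵐ z ∂(nu.prod nu), ∑' n, F n z = pf a |z.1 - z.2| * (u z.1 * u z.2) := by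
    filter_upwards [ae_prod_Ioo] with z hz
    exact ((pf_series h0 (t := z.1 - z.2) ⟨by linarith [hz.1.1, hz.2.2], by linarith [hz.1.2, hz.2.1]⟩).mul_right _).tsum_eq
  rw [integral_congr_ae hae] at h
  refine ⟨?_, h.congr_fun fun n => (hval n).2.symm⟩
  refine Integrable.congr (f := fun z => pf a |z.1 - z.2| * (u z.1 * u z.2)) ?_ (.of_forall fun _ => rfl)
  obtain ⟨C, hC⟩ := (isCompact_Icc (a := 𝟘) (b := 1)).exists_bound_of_continuousOn (pf_cont h0).continuousOn
  refine huu.bdd_mul (c := C) ((pf_cont h0).comp (by fun_prop : Continuous fun z : ℝ × ℝ => |z.1 - z.2|)).aestronglyMeasurable ?_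
  filter_upwards [ae_prod_Ioo] with z hz
  exact hC _ ⟨abs_nonneg _, abs_le.2 ⟨by linarith [hz.1.1, hz.2.2], by linarith [hz.1.2, hz.2.1]⟩⟩

theorem Bc_int {a : ℝ} (h0 : 1/2 < a) {u : ℝ → ℝ} (hu : Integrable u nu) :
    Integrable (fun z : ℝ × ℝ => Bc a z.1 z.2 * (u z.1 * u z.2)) (nu.prod nu) ∧
    ∫ z : ℝ × ℝ, Bc a z.1 z.2 * (u z.1 * u z.2) ∂(nu.prod nu) = (∫ x, u x * pf a x ∂nu) * (∫ x, u x * 1 ∂nu) +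
      a * (∫ x, u x * x ∂nu) ^ 2 - (∫ z : ℝ × ℝ, pf a |z.1 - z.2| * (u z.1 * u z.2) ∂(nu.prod nu)) / 2 := by
  have hq := (qf_sum h0 hu).1
  have h1 := pairInt hu (pf_cont h0) (continuous_const (y := (1:ℝ)))
  have h2 := pairInt hu (continuous_const (y := (1:ℝ))) (pf_cont h0)
  have h3 := pairInt hu continuous_id continuous_id
  have e : (fun z : ℝ × ℝ => Bc a z.1 z.2 * (u z.1 * u z.2)) = fun z =>
      ((1/2) * ((pf a z.1 * 1) * (u z.1 * u z.2)) + (1/2) * ((1 * pf a z.2) * (u z.1 * u z.2)) + a * ((id z.1 * id z.2) * (u z.1 * u z.2)))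
        - (1/2) * (pf a |z.1 - z.2| * (u z.1 * u z.2)) := by
    ext z; simp only [Bc, pf, sq_abs, id]; ring
  rw [e]
  have i12 : Integrable (fun z : ℝ × ℝ => (1/2) * ((pf a z.1 * 1) * (u z.1 * u z.2)) + (1/2) * ((1 * pf a z.2) * (u z.1 * u z.2))) (nu.prod nu) :=
    (h1.1.const_mul (1/2)).add (h2.1.const_mul (1/2))
  have i123 : Integrable (fun z : ℝ × ℝ => (1/2) * ((pf a z.1 * 1) * (u z.1 * u z.2)) + (1/2) * ((1 * pf a z.2) * (u z.1 * u z.2)) + a * ((id z.1 * id z.2) * (u z.1 * u z.2))) (nu.prod nu) :=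
    i12.add (h3.1.const_mul a)
  refine ⟨i123.sub (hq.const_mul (1/2)), ?_⟩
  rw [integral_sub i123 (hq.const_mul (1/2)), integral_add i12 (h3.1.const_mul a),
    integral_add (h1.1.const_mul (1/2)) (h2.1.const_mul (1/2)), integral_const_mul, integral_const_mul, integral_const_mul, integral_const_mul,
    h1.2, h2.2, h3.2]
  simp only [id]; ring

theorem qf_lower {a : ℝ} (h0 : 1/2 < a) {u : ℝ → ℝ} (hu : Integrable u nu) {K : ℕ} (hK : 1 ≤ K)
    (hpos : ∀ n, K ≤ n → 0 ≤ -fh a n) (K' : ℕ) :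
    ∑ n ∈ Finset.Ico K K', (-fh a n) * ((∫ x, u x * cos (π * n * x) ∂nu) ^ 2 + (∫ x, u x * sin (π * n * x) ∂nu) ^ 2) ≤
      ∫ z : ℝ × ℝ, Bc a z.1 z.2 * (u z.1 * u z.2) ∂(nu.prod nu) + (∫ x, u x * pf a x ∂nu) ^ 2 + (1 + |fh a 0|) * (∫ x, u x * 1 ∂nu) ^ 2
      + ∑ n ∈ Finset.Ico 1 K, |fh a n| * ((∫ x, u x * cos (π * n * x) ∂nu) ^ 2 + (∫ x, u x * sin (π * n * x) ∂nu) ^ 2) := by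
  have hs := (qf_sum h0 hu).2
  have hB := (Bc_int h0 hu).2
  set CS : ℕ → ℝ := fun n => (∫ x, u x * cos (π * n * x) ∂nu) ^ 2 + (∫ x, u x * sin (π * n * x) ∂nu) ^ 2 with hCS
  have hCS0 : ∀ n, 0 ≤ CS n := fun n => by positivity
  set Z := ∫ z : ℝ × ℝ, pf a |z.1 - z.2| * (u z.1 * u z.2) ∂(nu.prod nu)
  set P := ∫ x, u x * pf a x ∂nu
  set I := ∫ x, u x * 1 ∂nu
  set X := ∫ x, u x * x ∂nu
  have hneg := hs.neg
  have hle := sum_le_hasSum (Finset.range K ∪ Finset.Ico K K') (fun n hn => by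
    have h1 : ¬ n < K := fun h => hn (Finset.mem_union_left _ (Finset.mem_range.2 h))
    have h2 : n ≠ 0 := by omega
    simp only [h2, if_false]
    have := mul_nonneg (hpos n (by omega)) (hCS0 n)
    show 𝟘 ≤ -(2 * (fh a n * CS n))
    linarith) hneg
  rw [Finset.sum_union (Finset.disjoint_left.2 fun n h1 h2 => by
    rw [Finset.mem_range] at h1; rw [Finset.mem_Ico] at h2; omega), Finset.range_eq_Ico,
    Finset.sum_eq_sum_Ico_succ_bot (by omega : 0 < K)] at hle
  have e1 : ∑ n ∈ Finset.Ico K K', -(if n = 0 then fh a 0 * I ^ 2 else 2 * (fh a n * CS n)) = 2 * ∑ n ∈ Finset.Ico K K', (-fh a n) * CS n := by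
    rw [Finset.mul_sum]; refine Finset.sum_congr rfl fun n hn => ?_
    rw [Finset.mem_Ico] at hn
    rw [if_neg (by omega)]; ring
  have e2 : -(2 * ∑ n ∈ Finset.Ico 1 K, |fh a n| * CS n) ≤ ∑ n ∈ Finset.Ico (0+1) K, -(if n = 0 then fh a 0 * I ^ 2 else 2 * (fh a n * CS n)) := by
    rw [Finset.mul_sum, ← Finset.sum_neg_distrib]; refine Finset.sum_le_sum fun n hn => ?_
    rw [Finset.mem_Ico] at hn
    rw [if_neg (by omega)]
    nlinarith [mul_le_mul_of_nonneg_right (le_abs_self (fh a n)) (hCS0 n)]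
  have hle' : -(fh a 0 * I ^ 2) + (∑ n ∈ Finset.Ico (0+1) K, -(if n = 0 then fh a 0 * I ^ 2 else 2 * (fh a n * CS n))) + ∑ n ∈ Finset.Ico K K', -(if n = 0 then fh a 0 * I ^ 2 else 2 * (fh a n * CS n)) ≤ -Z := by
    simpa [hCS] using hle
  rw [e1] at hle'
  have hX : 0 ≤ a * X ^ 2 := by positivity
  have hf0 : fh a 0 * I ^ 2 ≤ |fh a 0| * I ^ 2 := mul_le_mul_of_nonneg_right (le_abs_self _) (sq_nonneg _)
  have hf1 : 0 ≤ |fh a 0| * I ^ 2 := by positivity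
  rw [hB]
  nlinarith [sq_nonneg (P + I), sq_nonneg P, sq_nonneg I]
end

section
theorem ms_between {α : Type*} [MeasurableSpace α] {f g h : α → ℝ} (hf : Measurable f) (hg : Measurable g) (hh : Measurable h) :
    MeasurableSet {p | f p < g p ∧ g p < h p} :=
  (measurableSet_lt hf hg).inter (measurableSet_lt hg hh)

theorem cstar_nonneg (v : ℝ) : 0 ≤ cstar v := sqrt_nonneg _

noncomputable def Ku (x y v : ℝ) : ℝ :=
  if 0 < y ∧ y < x then
    y ^ ((1:ℝ)/2 - v) * ∫ z in Ioo y x, (z - y) ^ (v - 3/2) * z ^ (v - 1/2)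
  else 0

theorem Kker_eq (x y v : ℝ) : Kker x y v = cstar v * Ku x y v := by
  rw [Kker, Ku]; split_ifs
  · ring
  · ring

theorem Ku_nonneg (x y v : ℝ) : 0 ≤ Ku x y v := by
  rw [Ku]; split_ifs with h
  · refine mul_nonneg (rpow_nonneg h.1.le _) (setIntegral_nonneg measurableSet_Ioo fun z hz => ?_)
    exact mul_nonneg (rpow_nonneg (by linarith [hz.1]) _) (rpow_nonneg (by linarith [hz.1]) _)
  · exact le_rfl

theorem Kker_nonneg (x y v : ℝ) : 0 ≤ Kker x y v := by
  rw [Kker_eq]; exact mul_nonneg (cstar_nonneg _) (Ku_nonneg _ _ _)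

theorem Ku_meas : Measurable (fun p : ℝ × ℝ × ℝ => Ku p.1 p.2.1 p.2.2) := by
  unfold Ku
  refine Measurable.ite ?_ ?_ measurable_const
  · refine ms_between ?_ ?_ ?_ <;> fun_prop
  · refine Measurable.mul 𝔉 ?_
    have e : (fun p : ℝ × ℝ × ℝ => ∫ z in Ioo p.2.1 p.1, (z - p.2.1) ^ (p.2.2 - 3/2) * z ^ (p.2.2 - 1/2)) =
        fun p => ∫ z, (if p.2.1 < z ∧ z < p.1 then (z - p.2.1) ^ (p.2.2 - 3/2) * z ^ (p.2.2 - 1/2) else 0) := by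
      ext p
      rw [← integral_indicator measurableSet_Ioo]
      congr 1; ext z; simp [indicator_apply]
    rw [e]
    refine StronglyMeasurable.measurable ?_
    refine StronglyMeasurable.integral_prod_right' (f := fun q : (ℝ × ℝ × ℝ) × ℝ => if q.1.2.1 < q.2 ∧ q.2 < q.1.1 then (q.2 - q.1.2.1) ^ (q.1.2.2 - 3/2) * q.2 ^ (q.1.2.2 - 1/2) else 0) ?_
    refine Measurable.stronglyMeasurable ?_
    refine Measurable.ite ?_ 𝔉 measurable_const
    refine ms_between ?_ ?_ ?_ <;> fun_prop

noncomputable def Wk (b z s : ℝ) : ℝ≥0∞ :=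
  if 0 < z ∧ z < s then ENNReal.ofReal (z ^ (-b) * (s - z) ^ (b - 1)) else 0

theorem Wk_meas (b : ℝ) : Measurable (fun p : ℝ × ℝ => Wk b p.1 p.2) := by
  unfold Wk
  refine Measurable.ite ?_ 𝔉 measurable_const
  refine ms_between ?_ ?_ ?_ <;> fun_prop

theorem Ku_lint {a : ℝ} (h0 : 1/2 < a) (x z : ℝ) : ENNReal.ofReal (Ku x z a) =
    ∫⁻ s in Ioo 0 x, Wk (a - 1/2) z s * ENNReal.ofReal (s ^ (a - 1/2)) := by
  rw [Ku]
  split_ifs with h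
  · have hint : IntegrableOn (fun s : ℝ => z ^ ((1:ℝ)/2 - a) * ((s - z) ^ (a - 3/2) * s ^ (a - 1/2))) (Ioo z x) := by
      refine Integrable.const_mul ?_ _
      have h1 : IntervalIntegrable (fun s : ℝ => (s - z) ^ (a - 3/2)) volume z x := by
        have := (intervalIntegral.intervalIntegrable_rpow' (a := 0) (b := x - z) (r := a - 3/2) 𝔏).comp_sub_right z
        simpa using this
      have h2 := h1.mul_continuousOn (g := fun s : ℝ => s ^ (a - 1/2)) (continuous_rpow_const 𝔏).continuousOn
      exact (intervalIntegrable_iff_integrableOn_Ioo_of_le h.2.le).1 h2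
    rw [← integral_const_mul, ofReal_integral_eq_lintegral_ofReal hint]
    · have hsub : Ioo z x ⊆ Ioo 0 x := Ioo_subset_Ioo_left h.1.le
      rw [← lintegral_indicator measurableSet_Ioo, ← lintegral_indicator measurableSet_Ioo]
      congr 1; ext s
      simp only [indicator_apply]
      by_cases hs : s ∈ Ioo z x
      · rw [if_pos hs, if_pos (hsub hs), Wk, if_pos ⟨h.1, hs.1⟩, ← ENNReal.ofReal_mul]
        · congr 1
          rw [show (1:ℝ)/2 - a = -(a - 1/2) by ring, show a - 3/2 = a - 1/2 - 1 by ring]; ring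
        · exact mul_nonneg (rpow_nonneg h.1.le _) (rpow_nonneg (by linarith [hs.1]) _)
      · rw [if_neg hs]
        by_cases hs2 : s ∈ Ioo 0 x
        · have : ¬ z < s := fun hh => hs ⟨hh, hs2.2⟩
          rw [if_pos hs2, Wk, if_neg (fun hh => this hh.2), zero_mul]
        · rw [if_neg hs2]
    · refine (ae_restrict_mem measurableSet_Ioo).mono fun s hs => ?_
      exact mul_nonneg (rpow_nonneg h.1.le _) (mul_nonneg (rpow_nonneg (by linarith [hs.1]) _) (rpow_nonneg (by linarith [hs.1, h.1]) _))
  · rw [ENNReal.ofReal_zero]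
    symm
    rw [setLIntegral_congr_fun (g := fun _ => 0) measurableSet_Ioo, lintegral_zero]
    intro s hs
    simp only
    rw [Wk, if_neg, zero_mul]
    exact fun hh => h ⟨hh.1, hh.2.trans hs.2⟩

theorem inner_lt {b s t : ℝ} (h0 : 0 < b) (h1 : b < 1/2) (hs : 0 < s) (hst : s < t) :
    ∫⁻ z in Ioo 0 s, ENNReal.ofReal (z ^ (-b) * (s - z) ^ (b - 1)) * ENNReal.ofReal (z ^ (-b) * (t - z) ^ (b - 1)) =
      ENNReal.ofReal (ProbabilityTheory.beta (1 - 2 * b) b) * ENNReal.ofReal ((s * t) ^ (-b) * (t - s) ^ (2 * b - 1)) := by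
  have ht : 0 < t := hs.trans hst
  have hd : 0 < t - s := by linarith
  have hden : ∀ τ : ℝ, 0 ≤ τ → 0 < t - s + s * τ := fun τ h => by positivity
  have himg : (fun τ : ℝ => s * t * τ / (t - s + s * τ)) '' Ioo 0 1 = Ioo 0 s := by
    ext z
    simp only [mem_image, mem_Ioo]
    constructor
    · rintro ⟨τ, hτ, rfl⟩
      have := hden τ hτ.1.le
      refine ⟨by have := hτ.1; positivity, ?_⟩
      rw [div_lt_iff₀ this]
      nlinarith [mul_pos (mul_pos hs hd) (sub_pos.2 hτ.2)]
    · rintro ⟨hz0, hzs⟩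
      have htz : 0 < t - z := by linarith
      refine ⟨z * (t - s) / (s * (t - z)), ⟨by positivity, ?_⟩, ?_⟩
      · rw [div_lt_one 𝔓]; nlinarith
      · have : t - s + s * (z * (t - s) / (s * (t - z))) = t * (t - s) / (t - z) := by field_simp; ring
        rw [this]; field_simp
  rw [← himg, lintegral_image_eq_lintegral_deriv_mul_of_monotoneOn
    (f := fun τ : ℝ => s * t * τ / (t - s + s * τ)) (s := Ioo 0 1)
    (f' := fun τ => s * t * (t - s) / (t - s + s * τ) ^ 2) measurableSet_Ioo]
  rotate_left
  · intro τ hτ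
    have hh := hden τ hτ.1.le
    have d1 : HasDerivAt (fun τ : ℝ => s * t * τ) (s * t) τ := by simpa using (hasDerivAt_id τ).const_mul (s * t)
    have d2 : HasDerivAt (fun τ : ℝ => t - s + s * τ) s τ := by simpa using ((hasDerivAt_id τ).const_mul s).const_add (t - s)
    refine HasDerivAt.hasDerivWithinAt ?_
    convert! d1.div d2 hh.ne' using 1
    field_simp; ring
  · intro τ hτ τ' hτ' hle
    have e1 := hden τ hτ.1.le
    have e2 := hden τ' hτ'.1.le
    simp only
    rw [div_le_div_iff₀ e1 e2]
    have := mul_nonneg (mul_nonneg (mul_nonneg hs.le ht.le) hd.le) (sub_nonneg.2 hle)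
    nlinarith
  rw [← lint_beta 𝔏 h0, mul_comm (∫⁻ _ in _, _), ← lintegral_const_mul' _ _ ENNReal.ofReal_ne_top]
  refine setLIntegral_congr_fun measurableSet_Ioo fun τ hτ => ?_
  have hh := hden τ hτ.1.le
  have hτ1 : 0 < 1 - τ := by linarith [hτ.2]
  have hτ0 := hτ.1
  set d := t - s + s * τ with hdd
  have e1 : s - s * t * τ / d = s * (t - s) * (1 - τ) / d := by
    rw [hdd] at hh ⊢; field_simp; ring
  have e2 : t - s * t * τ / d = t * (t - s) / d := by
    rw [hdd] at hh ⊢; field_simp; ring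
  rw [e1, e2, ← ENNReal.ofReal_mul 𝔓, ← ENNReal.ofReal_mul 𝔓, ← ENNReal.ofReal_mul 𝔓]
  congr 1
  have L : ∀ {A B : ℝ}, 0 < A → 0 < B → log A = log B → A = B := fun hA hB h => log_injOn_pos hA hB h
  refine L 𝔓 𝔓 ?_
  have l1 : log (s * t * (t - s) / d ^ 2) = log s + log t + log (t - s) - 2 * log d := by
    rw [log_div 𝔓 𝔓, log_mul 𝔓 𝔓, log_mul 𝔓 𝔓, log_pow]; norm_num
  have l2 : log (s * t * τ / d) = log s + log t + log τ - log d := by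
    rw [log_div 𝔓 𝔓, log_mul 𝔓 𝔓, log_mul 𝔓 𝔓]
  have l3 : log (s * (t - s) * (1 - τ) / d) = log s + log (t - s) + log (1 - τ) - log d := by
    rw [log_div 𝔓 𝔓, log_mul 𝔓 𝔓, log_mul 𝔓 𝔓]
  have l4 : log (t * (t - s) / d) = log t + log (t - s) - log d := by
    rw [log_div 𝔓 𝔓, log_mul 𝔓 𝔓]
  rw [log_mul 𝔓 𝔓, log_mul 𝔓 𝔓, log_mul 𝔓 𝔓,
    log_mul 𝔓 𝔓, log_mul 𝔓 𝔓, log_mul 𝔓 𝔓,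
    log_mul 𝔓 𝔓,
    log_rpow 𝔓, log_rpow 𝔓, log_rpow 𝔓, log_rpow 𝔓, log_rpow 𝔓,
    log_rpow 𝔓, log_rpow 𝔓, l1, l2, l3, l4, log_mul 𝔓 𝔓]
  ring

theorem inner_all {b s t : ℝ} (h0 : 0 < b) (h1 : b < 1/2) (hs : 0 < s) (ht : 0 < t) (hst : s ≠ t) :
    ∫⁻ z, Wk b z s * Wk b z t =
      ENNReal.ofReal (ProbabilityTheory.beta (1 - 2 * b) b) * ENNReal.ofReal ((s * t) ^ (-b) * |t - s| ^ (2 * b - 1)) := by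
  wlog hlt : s < t generalizing s t
  · have h := this ht hs hst.symm (lt_of_le_of_ne (not_lt.1 hlt) hst.symm)
    rw [mul_comm s t, abs_sub_comm t s, ← h]
    simp_rw [mul_comm]
  rw [abs_of_pos (by linarith : 0 < t - s), ← inner_lt h0 h1 hs hlt, ← lintegral_indicator measurableSet_Ioo]
  congr 1; ext z
  simp only [indicator_apply, Wk, mem_Ioo]
  by_cases hz : 0 < z ∧ z < s
  · rw [if_pos hz, if_pos hz, if_pos ⟨hz.1, hz.2.trans hlt⟩]
  · rw [if_neg hz, if_neg hz, zero_mul]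

theorem lint_rpow {β x : ℝ} (hβ : -1 < β) (hx : 0 ≤ x) :
    ∫⁻ s in Ioo 0 x, ENNReal.ofReal (s ^ β) = ENNReal.ofReal (x ^ (β + 1) / (β + 1)) := by
  rw [← ofReal_integral_eq_lintegral_ofReal]
  · rw [← integral_Ioc_eq_integral_Ioo, ← intervalIntegral.integral_of_le hx, integral_rpow (Or.inl hβ), zero_rpow 𝔏, sub_zero]
  · exact (intervalIntegrable_iff_integrableOn_Ioo_of_le hx).1 (intervalIntegral.intervalIntegrable_rpow' hβ)
  · exact (ae_restrict_mem measurableSet_Ioo).mono fun s hs => rpow_nonneg hs.1.le _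

theorem lint_rpow_abs {β x t : ℝ} (hβ : -1 < β) (ht : 0 < t) (hx : t < x) :
    ∫⁻ s in Ioo 0 x, ENNReal.ofReal (|t - s| ^ β) = ENNReal.ofReal ((t ^ (β + 1) + (x - t) ^ (β + 1)) / (β + 1)) := by
  have hb : 0 < β + 1 := by linarith
  have e1 : ∫⁻ s in Ioo 0 t, ENNReal.ofReal (|t - s| ^ β) = ∫⁻ s in Ioo 0 t, ENNReal.ofReal (s ^ β) := by
    rw [← lintegral_indicator measurableSet_Ioo, ← lintegral_indicator measurableSet_Ioo,
      ← lintegral_sub_left_eq_self (fun s => (Ioo 0 t).indicator (fun s => ENNReal.ofReal (s ^ β)) s) t]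
    congr 1; ext s
    simp only [indicator_apply, mem_Ioo]
    by_cases hs : 0 < s ∧ s < t
    · rw [if_pos hs, if_pos ⟨by linarith, by linarith⟩, abs_of_pos 𝔏]
    · rw [if_neg hs, if_neg fun hh => hs ⟨by linarith [hh.2], by linarith [hh.1]⟩]
  have e2 : ∫⁻ s in Ioo t x, ENNReal.ofReal (|t - s| ^ β) = ∫⁻ s in Ioo 0 (x - t), ENNReal.ofReal (s ^ β) := by
    rw [← lintegral_indicator measurableSet_Ioo, ← lintegral_indicator measurableSet_Ioo,
      ← lintegral_sub_right_eq_self (fun s => (Ioo 0 (x - t)).indicator (fun s => ENNReal.ofReal (s ^ β)) s) t]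
    congr 1; ext s
    simp only [indicator_apply, mem_Ioo]
    by_cases hs : t < s ∧ s < x
    · rw [if_pos hs, if_pos ⟨by linarith, by linarith⟩, abs_sub_comm, abs_of_pos 𝔏]
    · rw [if_neg hs, if_neg fun hh => hs ⟨by linarith [hh.1], by linarith [hh.2]⟩]
  rw [← Ioo_union_Ico_eq_Ioo ht hx.le, lintegral_union measurableSet_Ico
    (Set.disjoint_left.2 fun s h1 h2 => absurd h1.2 (not_lt.2 h2.1)),
    setLIntegral_congr (Ioo_ae_eq_Ico (a := t) (b := x)).symm, e1, e2, lint_rpow hβ ht.le, lint_rpow hβ 𝔏,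
    ← ENNReal.ofReal_add (div_nonneg (rpow_nonneg ht.le _) hb.le) (div_nonneg (rpow_nonneg 𝔏 _) hb.le)]
  congr 1; ring

theorem lint_two {a x y : ℝ} (h0 : 1/2 < a) (hy : 0 < y) (hyx : y ≤ x) :
    ∫⁻ t in Ioo 0 y, ∫⁻ s in Ioo 0 x, ENNReal.ofReal (|t - s| ^ (2 * (a - 1/2) - 1)) =
      ENNReal.ofReal (Bc a x y / (a * (2 * a - 1))) := by
  have hb : 0 < 2 * a - 1 := by linarith
  have e : ∀ t ∈ Ioo 0 y, ∫⁻ s in Ioo 0 x, ENNReal.ofReal (|t - s| ^ (2 * (a - 1/2) - 1)) =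
      ENNReal.ofReal ((t ^ (2 * a - 1) + (x - t) ^ (2 * a - 1)) / (2 * a - 1)) := by
    intro t ht
    rw [lint_rpow_abs 𝔏 ht.1 (ht.2.trans_le hyx)]
    congr 2 <;> ring_nf
  rw [setLIntegral_congr_fun measurableSet_Ioo e]
  have hc1 : Continuous fun t : ℝ => t ^ (2 * a - 1) := continuous_rpow_const 𝔏
  have hc : Continuous fun t : ℝ => (t ^ (2 * a - 1) + (x - t) ^ (2 * a - 1)) / (2 * a - 1) :=
    (hc1.add (hc1.comp 𝔉)).div_const _
  rw [← ofReal_integral_eq_lintegral_ofReal]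
  · congr 1
    rw [← integral_Ioc_eq_integral_Ioo, ← intervalIntegral.integral_of_le hy.le, intervalIntegral.integral_div]
    have hc2 : Continuous fun t : ℝ => (x - t) ^ (2 * a - 1) := hc1.comp 𝔉
    rw [intervalIntegral.integral_add (hc1.intervalIntegrable _ _) (hc2.intervalIntegrable _ _),
      intervalIntegral.integral_comp_sub_left (fun t : ℝ => t ^ (2 * a - 1)) x, integral_rpow (Or.inl 𝔏),
      integral_rpow (Or.inl 𝔏), zero_rpow 𝔏, Bc, abs_of_nonneg (by linarith : 0 ≤ x - y),
      show 2 * a - 1 + 1 = 2 * a by ring, sub_zero, sub_zero]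
    have : a ≠ 0 := by linarith
    field_simp; ring
  · exact (intervalIntegrable_iff_integrableOn_Ioo_of_le hy.le).1 (hc.intervalIntegrable _ _)
  · refine (ae_restrict_mem measurableSet_Ioo).mono fun t ht => ?_
    exact div_nonneg (add_nonneg (rpow_nonneg ht.1.le _) (rpow_nonneg (by linarith [ht.2]) _)) hb.le

theorem KuKu {a x y : ℝ} (h0 : 1/2 < a) (h1 : a < 1) (hy : 0 < y) (hyx : y ≤ x) :
    ∫⁻ z, ENNReal.ofReal (Ku x z a) * ENNReal.ofReal (Ku y z a) =
      ENNReal.ofReal (ProbabilityTheory.beta (2 - 2 * a) (a - 1/2)) * ENNReal.ofReal (Bc a x y / (a * (2 * a - 1))) := by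
  set b := a - 1/2 with hb
  have hW := Wk_meas b
  have hWr : ∀ z, Measurable (Wk b z) := fun z => hW.comp (measurable_const.prodMk measurable_id)
  have hWl : ∀ s, Measurable (fun z => Wk b z s) := fun s => hW.comp (measurable_id.prodMk measurable_const)
  set g : ℝ → ℝ≥0∞ := fun s => ENNReal.ofReal (s ^ b) with hg
  have hgm : Measurable g := by fun_prop
  have hP : ∀ z x : ℝ, Measurable fun s => Wk b z s * g s := fun z x => (hWr z).mul hgm
  have e1 : ∀ z, ENNReal.ofReal (Ku x z a) * ENNReal.ofReal (Ku y z a) =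
      ∫⁻ t in Ioo 0 y, ∫⁻ s in Ioo 0 x, (Wk b z s * g s) * (Wk b z t * g t) := by
    intro z
    rw [Ku_lint h0, Ku_lint h0, ← lintegral_const_mul _ (hP z y)]
    congr 1; ext t
    rw [lintegral_mul_const _ (hP z x)]
  simp_rw [e1]
  have hW1 : Measurable fun p : ℝ × ℝ × ℝ => Wk b p.1 p.2.2 * g p.2.2 :=
    (hW.comp (f := fun p : ℝ × ℝ × ℝ => (p.1, p.2.2)) 𝔉).mul (hgm.comp 𝔉)
  have hW2 : Measurable fun p : ℝ × ℝ × ℝ => Wk b p.1 p.2.1 * g p.2.1 :=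
    (hW.comp (f := fun p : ℝ × ℝ × ℝ => (p.1, p.2.1)) 𝔉).mul (hgm.comp 𝔉)
  have hW3 := hW1.mul hW2
  rw [lintegral_lintegral_swap]
  · have e2 : ∀ t, ∫⁻ z, ∫⁻ s in Ioo 0 x, (Wk b z s * g s) * (Wk b z t * g t) =
        ∫⁻ s in Ioo 0 x, ∫⁻ z, (Wk b z s * g s) * (Wk b z t * g t) := by
      intro t
      refine lintegral_lintegral_swap (Measurable.aemeasurable ?_)
      exact hW3.comp (f := fun p : ℝ × ℝ => (p.1, t, p.2)) 𝔉
    simp_rw [e2]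
    rw [← lint_two h0 hy hyx, ← lintegral_const_mul' _ _ ENNReal.ofReal_ne_top]
    refine setLIntegral_congr_fun measurableSet_Ioo fun t ht => ?_
    rw [← lintegral_const_mul' _ _ ENNReal.ofReal_ne_top]
    refine lintegral_congr_ae ?_
    have hne : ∀ᵐ s ∂(volume.restrict (Ioo 0 x)), s ≠ t := ae_restrict_of_ae (by simp [ae_iff])
    filter_upwards [hne, ae_restrict_mem measurableSet_Ioo] with s hs hs'
    have : ∀ z, (Wk b z s * g s) * (Wk b z t * g t) = (g s * g t) * (Wk b z s * Wk b z t) := fun z => by ring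
    simp_rw [this]
    have hm2 : Measurable fun z => Wk b z s * Wk b z t := (hWl s).mul (hWl t)
    rw [lintegral_const_mul _ hm2, inner_all 𝔏 𝔏 hs'.1 ht.1 hs,
      show 1 - 2 * b = 2 - 2 * a by rw [hb]; ring, mul_left_comm]
    congr 1
    have hs0 := hs'.1
    have ht0 := ht.1
    have hp : 0 < |t - s| := abs_pos.2 (sub_ne_zero.2 hs.symm)
    rw [hg, ← ENNReal.ofReal_mul 𝔓, ← ENNReal.ofReal_mul 𝔓]
    congr 1
    rw [rpow_neg 𝔓, mul_rpow hs0.le ht0.le, ← hb]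
    field_simp
  · refine Measurable.aemeasurable ?_
    refine Measurable.lintegral_prod_right' (f := fun q : (ℝ × ℝ) × ℝ => (Wk b q.1.1 q.2 * g q.2) * (Wk b q.1.1 q.1.2 * g q.1.2)) ?_
    exact hW3.comp (f := fun q : (ℝ × ℝ) × ℝ => (q.1.1, q.1.2, q.2)) 𝔉

theorem cstar_sq {a : ℝ} (h0 : 1/2 < a) (h1 : a < 1) :
    cstar a ^ 2 * ProbabilityTheory.beta (2 - 2 * a) (a - 1/2) = a * (2 * a - 1) := by
  have g1 := Gamma_pos_of_pos (show 0 < 3/2 - a by linarith)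
  have g2 := Gamma_pos_of_pos (show 0 < 2 - 2 * a by linarith)
  have g3 := Gamma_pos_of_pos (show 0 < a - 1/2 by linarith)
  have h2 : 0 < 2 * a - 1 := by linarith
  rw [cstar, sq_sqrt 𝔓, ProbabilityTheory.beta, show 2 - 2 * a + (a - 1/2) = 3/2 - a by ring]
  generalize Gamma (3/2 - a) = G1 at *
  generalize Gamma (2 - 2 * a) = G2 at *
  generalize Gamma (a - 1/2) = G3 at *
  field_simp

theorem Ku_zero {x z v : ℝ} (h : ¬ (0 < z ∧ z < x)) : Ku x z v = 0 := by rw [Ku, if_neg h]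

theorem Kker_zero {x z v : ℝ} (h : ¬ (0 < z ∧ z < x)) : Kker x z v = 0 := by rw [Kker, if_neg h]

theorem Bc_nonneg {a x y : ℝ} (h0 : 1/2 < a) (hy : 0 < y) (hx : 0 < x) : 0 ≤ Bc a x y := by
  rw [Bc]
  have : |x - y| ^ (2 * a) ≤ (max x y) ^ (2 * a) :=
    rpow_le_rpow (abs_nonneg _) (abs_le.2 ⟨by linarith [le_max_right x y], by linarith [le_max_left x y]⟩) 𝔏
  have h1 := rpow_nonneg hx.le (2 * a)
  have h2 := rpow_nonneg hy.le (2 * a)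
  rcases max_choice x y with h | h <;> rw [h] at this <;> linarith

theorem Ku_meas_z (x v : ℝ) : Measurable fun z => Ku x z v :=
  Ku_meas.comp (f := fun z : ℝ => (x, z, v)) 𝔉

theorem lintKK {a x y : ℝ} (h0 : 1/2 < a) (h1 : a < 1) (hx : 0 < x) (hy : 0 < y) :
    ∫⁻ z, ENNReal.ofReal (Kker x z a * Kker y z a) = ENNReal.ofReal (Bc a x y) := by
  wlog hyx : y ≤ x generalizing x y
  · have := this hy hx (not_le.1 hyx).le
    rw [show Bc a x y = Bc a y x by rw [Bc, Bc, abs_sub_comm]; ring, ← this]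
    simp_rw [mul_comm]
  have e : ∀ z, ENNReal.ofReal (Kker x z a * Kker y z a) = ENNReal.ofReal (cstar a ^ 2) * (ENNReal.ofReal (Ku x z a) * ENNReal.ofReal (Ku y z a)) := by
    intro z
    rw [Kker_eq, Kker_eq, ← ENNReal.ofReal_mul (Ku_nonneg _ _ _), ← ENNReal.ofReal_mul (sq_nonneg _)]
    congr 1; ring
  simp_rw [e]
  have h2 : 0 < 2 * a - 1 := by linarith
  have ha : a ≠ 0 := by linarith
  have hB := ProbabilityTheory.beta_pos (show 0 < 2 - 2 * a by linarith) (show 0 < a - 1/2 by linarith)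
  rw [lintegral_const_mul' _ _ ENNReal.ofReal_ne_top, KuKu h0 h1 hy hyx, ← ENNReal.ofReal_mul hB.le, ← ENNReal.ofReal_mul (sq_nonneg _), ← mul_assoc, cstar_sq h0 h1]
  congr 1; exact mul_div_cancel₀ _ (mul_pos 𝔏 h2).ne'

theorem intKK {a x y : ℝ} (h0 : 1/2 < a) (h1 : a < 1) (hx : 0 < x) (hy : 0 < y) :
    ∫ z in Ioo 0 (min x y), Kker x z a * Kker y z a = Bc a x y := by
  rw [setIntegral_eq_integral_of_forall_compl_eq_zero, integral_eq_lintegral_of_nonneg_ae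
    (.of_forall fun z => mul_nonneg (Kker_nonneg _ _ _) (Kker_nonneg _ _ _)), lintKK h0 h1 hx hy, ENNReal.toReal_ofReal (Bc_nonneg h0 hy hx)]
  · simp_rw [Kker_eq]
    exact (((Ku_meas_z x a).const_mul _).mul ((Ku_meas_z y a).const_mul _)).aestronglyMeasurable
  · intro z hz
    by_cases h : 0 < z ∧ z < x
    · rw [Kker_zero (x := y) fun h' => hz ⟨h.1, lt_min h.2 h'.2⟩, mul_zero]
    · rw [Kker_zero h, zero_mul]
end

section
theorem Ku_ii {b z X Y : ℝ} (hb : 0 < b) (_ : 0 < z) (_ : 0 ≤ X) (_ : 0 ≤ Y) :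
    IntervalIntegrable (fun w : ℝ => w ^ (b - 1) * (1 + w / z) ^ b) volume X Y := by
  refine (intervalIntegral.intervalIntegrable_rpow' 𝔏).mul_continuousOn ?_
  refine ContinuousOn.rpow_const 𝔉 fun w _ => Or.inr hb.le

theorem Ku_rep {x z v : ℝ} (hz : 0 < z) :
    Ku x z v = ∫ w in 0..(max (x - z) 0), w ^ (v - 1/2 - 1) * (1 + w / z) ^ (v - 1/2) := by
  rw [Ku]
  split_ifs with h
  · have hxz : z ≤ x := h.2.le
    rw [max_eq_left 𝔏, ← integral_Ioc_eq_integral_Ioo, ← intervalIntegral.integral_of_le hxz,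
      ← intervalIntegral.integral_const_mul]
    have := intervalIntegral.integral_comp_sub_right (fun w : ℝ => w ^ (v - 1/2 - 1) * (1 + w / z) ^ (v - 1/2)) (a := z) (b := x) z
    rw [sub_self] at this
    rw [← this]
    refine intervalIntegral.integral_congr fun s hs => ?_
    rw [uIcc_of_le hxz] at hs
    have e : 1 + (s - z) / z = s / z := by field_simp; ring
    rw [e, div_rpow (by linarith [hs.1]) hz.le, show (1:ℝ)/2 - v = -(v - 1/2) by ring, rpow_neg hz.le,
      show v - 3/2 = v - 1/2 - 1 by ring]
    field_simp
  · rw [max_eq_right, intervalIntegral.integral_same]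
    by_contra hc
    exact h ⟨hz, by linarith⟩

theorem Ku_osc {x z z' v : ℝ} (h0 : 1/2 < v) (hz : 0 < z) (hzz : z ≤ z') (hx1 : x ≤ 1) :
    Ku x z' v ≤ Ku x z v ∧
    Ku x z v ≤ z ^ (-(v - 1/2)) * ((max (x - z) 0) ^ (v - 1/2) - (max (x - z') 0) ^ (v - 1/2)) / (v - 1/2)
      + (z' / z) ^ (v - 1/2) * Ku x z' v := by
  set b := v - 1/2 with hb
  have hb0 : 0 < b := by linarith
  have hz' : 0 < z' := by linarith
  rw [Ku_rep hz, Ku_rep hz', ← hb]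
  set X := max (x - z) 0
  set X' := max (x - z') 0
  have hX : 0 ≤ X := le_max_right _ _
  have hX' : 0 ≤ X' := le_max_right _ _
  have hXX : X' ≤ X := max_le_max 𝔏 le_rfl
  have hsplit := intervalIntegral.integral_add_adjacent_intervals (Ku_ii hb0 hz le_rfl hX') (Ku_ii hb0 hz hX' hX)
  have m1 : ∫ w in 0..X', w ^ (b - 1) * (1 + w / z') ^ b ≤ ∫ w in 0..X', w ^ (b - 1) * (1 + w / z) ^ b := by
    refine intervalIntegral.integral_mono_on hX' (Ku_ii hb0 hz' le_rfl hX') (Ku_ii hb0 hz le_rfl hX') fun w hw => ?_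
    have := hw.1
    gcongr
  have m2 : 0 ≤ ∫ w in X'..X, w ^ (b - 1) * (1 + w / z) ^ b := by
    refine intervalIntegral.integral_nonneg hXX fun w hw => ?_
    have : 0 ≤ w := hX'.trans hw.1
    positivity
  have m3 : ∫ w in 0..X', w ^ (b - 1) * (1 + w / z) ^ b ≤ (z' / z) ^ b * ∫ w in 0..X', w ^ (b - 1) * (1 + w / z') ^ b := by
    rw [← intervalIntegral.integral_const_mul]
    refine intervalIntegral.integral_mono_on hX' (Ku_ii hb0 hz le_rfl hX') ((Ku_ii hb0 hz' le_rfl hX').const_mul _) fun w hw => ?_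
    have hw0 := hw.1
    rw [mul_left_comm, ← mul_rpow 𝔓 𝔓]
    refine mul_le_mul_of_nonneg_left (rpow_le_rpow 𝔓 ?_ hb0.le) 𝔓
    have : z' / z * (1 + w / z') = z' / z + w / z := by field_simp
    rw [this]
    have : 1 ≤ z' / z := by rw [le_div_iff₀ hz]; linarith
    linarith
  have m4 : ∫ w in X'..X, w ^ (b - 1) * (1 + w / z) ^ b ≤ z ^ (-b) * (X ^ b - X' ^ b) / b := by
    have e : ∫ w in X'..X, z ^ (-b) * w ^ (b - 1) = z ^ (-b) * (X ^ b - X' ^ b) / b := by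
      rw [intervalIntegral.integral_const_mul, integral_rpow (Or.inl 𝔏), sub_add_cancel]; ring
    rw [← e]
    rcases hXX.eq_or_lt with h | h
    · rw [h, intervalIntegral.integral_same, intervalIntegral.integral_same]
    refine intervalIntegral.integral_mono_on hXX (Ku_ii hb0 hz hX' hX)
      ((intervalIntegral.intervalIntegrable_rpow' 𝔏).const_mul _) fun w hw => ?_
    have hw0 : 0 ≤ w := hX'.trans hw.1
    have hwx : w ≤ x - z := by
      rcases max_choice (x - z) 0 with h1 | h1
      · exact hw.2.trans h1.le
      · exact absurd (hX'.trans_lt h) (by rw [show X = 0 from h1]; exact lt_irrefl _)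
    rw [mul_comm]
    refine mul_le_mul_of_nonneg_right ?_ 𝔓
    rw [rpow_neg hz.le, ← inv_rpow hz.le]
    refine rpow_le_rpow 𝔓 ?_ hb0.le
    rw [← sub_nonneg, show z⁻¹ - (1 + w / z) = (1 - z - w) / z by field_simp; ring]
    exact div_nonneg 𝔏 hz.le
  constructor <;> linarith

theorem Ku_bd {x z v : ℝ} (h0 : 1/2 < v) (hz : 0 < z) (hx1 : x ≤ 1) :
    Ku x z v ≤ z ^ (-(v - 1/2)) / (v - 1/2) := by
  have hb : 0 < v - 1/2 := by linarith
  rcases le_total x z with h | h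
  · rw [Ku_zero (fun h' => by linarith [h'.2])]; positivity
  have := (Ku_osc h0 hz h hx1).2
  rw [Ku_zero (x := x) (z := x) (fun h' => lt_irrefl _ h'.2), sub_self, max_self, zero_rpow hb.ne', mul_zero, add_zero, sub_zero] at this
  refine this.trans ?_
  gcongr
  refine mul_le_of_le_one_right 𝔓 (rpow_le_one (le_max_right _ _) (max_le 𝔏 zero_le_one) hb.le)

theorem Ku_inc {x z z' v : ℝ} (h0 : 1/2 < v) (h1 : v < 1) (hz : 0 < z) (hzz : z ≤ z') (hx1 : x ≤ 1) :
    Ku x z v - Ku x z' v ≤ z ^ (-(v - 1/2)) / (v - 1/2) *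
      (((max (x - z) 0) ^ (v - 1/2) - (max (x - z') 0) ^ (v - 1/2)) + (z' - z) / z) := by
  have hb : 0 < v - 1/2 := by linarith
  have h := (Ku_osc h0 hz hzz hx1).2
  have hB := Ku_bd h0 (hz.trans_le hzz) hx1
  have hB' : Ku x z' v ≤ z ^ (-(v - 1/2)) / (v - 1/2) := by
    refine hB.trans ?_
    exact div_le_div_of_nonneg_right (rpow_le_rpow_of_nonpos hz hzz 𝔏) hb.le
  have h2 : (z' / z) ^ (v - 1/2) ≤ 1 + (z' - z) / z := by
    have : 1 ≤ z' / z := by rw [le_div_iff₀ hz]; linarith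
    calc (z' / z) ^ (v - 1/2) ≤ (z' / z) ^ (1:ℝ) := rpow_le_rpow_of_exponent_le this 𝔏
      _ = _ := by rw [rpow_one]; field_simp; ring
  have h3 : ((z' / z) ^ (v - 1/2) - 1) * Ku x z' v ≤ (z' - z) / z * (z ^ (-(v - 1/2)) / (v - 1/2)) :=
    mul_le_mul 𝔏 hB' (Ku_nonneg _ _ _) (div_nonneg 𝔏 hz.le)
  rw [mul_add, mul_comm _ ((z' - z) / z), div_mul_eq_mul_div]
  linarith

theorem pos_inc {b t : ℝ} (hb : 0 < b) (hb1 : b < 1) (ht : 0 ≤ t) : (t + 1) ^ b - t ^ b ≤ (t + 1) ^ (b - 1) := by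
  have e : (t + 1) ^ b = (t + 1) ^ (b - 1) * (t + 1) := by
    rw [← rpow_add_one 𝔏]; congr 1; ring
  rcases ht.eq_or_lt with h | h
  · rw [← h, zero_rpow hb.ne']; simp
  have e' : t ^ b = t ^ (b - 1) * t := by rw [← rpow_add_one h.ne']; congr 1; ring
  have : (t + 1) ^ (b - 1) ≤ t ^ (b - 1) := rpow_le_rpow_of_nonpos h 𝔏 𝔏
  rw [e, e']
  nlinarith

noncomputable def cz (p : ℝ) (j : ℤ) : ℝ := |(j:ℝ)| ^ (-p) + if j = 0 then 1 else 0

theorem cz_nonneg (p : ℝ) (j : ℤ) : 0 ≤ cz p j := by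
  rw [cz]; split_ifs <;> positivity

theorem cz_summable {p : ℝ} (hp : 1 < p) : Summable (cz p) := by
  refine (summable_abs_int_rpow hp).add (summable_of_ne_finset_zero (s := {0}) fun j hj => ?_)
  rw [if_neg (by simpa using hj)]

theorem inc_le {b b1 t : ℝ} (hb : 0 < b) (hb1 : b ≤ b1) (hb2 : b1 < 1/2) :
    ((max (t + 1) 0) ^ b - (max t 0) ^ b) ^ 2 ≤ cz (2 - 2 * b1) (⌊t⌋ + 1) := by
  have hm : (max t 0) ^ b ≤ (max (t + 1) 0) ^ b := rpow_le_rpow (le_max_right _ _) (max_le_max 𝔏 le_rfl) hb.le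
  rcases lt_or_ge t 0 with h | h
  · rw [max_eq_right h.le, zero_rpow hb.ne', sub_zero]
    rcases le_or_gt t (-1) with h' | h'
    · rw [max_eq_right 𝔏, zero_rpow hb.ne']; simpa using cz_nonneg _ _
    · have : ⌊t⌋ = -1 := by rw [Int.floor_eq_iff]; push_cast; constructor <;> linarith
      rw [this, cz]
      have h1 : (max (t + 1) 0) ^ b ≤ 1 := rpow_le_one (le_max_right _ _) (max_le 𝔏 zero_le_one) hb.le
      have h2 : 0 ≤ (max (t + 1) 0) ^ b := rpow_nonneg (le_max_right _ _) _
      simp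
      have := rpow_nonneg (le_refl 𝟘) (-(2 - 2 * b1))
      rw [show 2 * b1 - 2 = -(2 - 2 * b1) by ring]
      nlinarith
  · have hf : 0 ≤ ⌊t⌋ := Int.floor_nonneg.2 h
    have hf' : 𝟘 ≤ ⌊t⌋ := by exact_mod_cast hf
    rw [max_eq_left h, max_eq_left 𝔏] at *
    rw [cz, if_neg (by omega), add_zero]
    push_cast
    rw [abs_of_nonneg 𝔏]
    calc ((t + 1) ^ b - t ^ b) ^ 2 ≤ ((t + 1) ^ (b - 1)) ^ 2 :=
          pow_le_pow_left₀ 𝔏 (pos_inc hb 𝔏 h) 2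
      _ = (t + 1) ^ (2 * b - 2) := by
          rw [← rpow_natCast, ← rpow_mul 𝔏]; congr 1; push_cast; ring
      _ ≤ (⌊t⌋ + 1 : ℝ) ^ (2 * b - 2) :=
          rpow_le_rpow_of_nonpos 𝔏 (by linarith [Int.floor_le t]) 𝔏
      _ ≤ _ := rpow_le_rpow_of_exponent_le 𝔏 𝔏

theorem inc_sum {b b1 τ : ℝ} (hb : 0 < b) (hb1 : b ≤ b1) (hb2 : b1 < 1/2) (n : ℕ) :
    ∑ l ∈ Finset.range n, ((max (τ - l + 1) 0) ^ b - (max (τ - l) 0) ^ b) ^ 2 ≤ ∑' j, cz (2 - 2 * b1) j := by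
  have hinj : Function.Injective fun l : ℕ => ⌊τ⌋ - (l:ℤ) + 1 := by
    intro l l' h; simpa using h
  calc _ ≤ ∑ l ∈ Finset.range n, cz (2 - 2 * b1) (⌊τ⌋ - (l:ℤ) + 1) := by
        refine Finset.sum_le_sum fun l _ => ?_
        have := inc_le (t := τ - l) hb hb1 hb2
        rwa [show τ - (l:ℝ) = τ - ((l:ℤ):ℝ) by simp, Int.floor_sub_intCast] at *
    _ = ∑ j ∈ (Finset.range n).image (fun l : ℕ => ⌊τ⌋ - (l:ℤ) + 1), cz (2 - 2 * b1) j :=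
        (Finset.sum_image (hinj.injOn)).symm
    _ ≤ _ := (cz_summable 𝔏).sum_le_tsum _ fun j _ => cz_nonneg _ _

theorem Ku_grid {b0 b1 x v L : ℝ} (hb0 : 0 < b0) (hv0 : b0 ≤ v - 1/2) (hv1 : v - 1/2 ≤ b1) (hb2 : b1 < 1/2)
    (hL : 0 < L) (hL1 : L ≤ 1) (hx1 : x ≤ 1) {n : ℕ} (hn : 0 < n) :
    ∑ l ∈ Finset.range n, (Ku x (L + l * (L / n)) v - Ku x (L + (l + 1) * (L / n)) v) ^ 2 ≤
      2 * (∑' j, cz (2 - 2 * b1) j + 1) / b0 ^ 2 * (L ^ (-(2 * b1)) * (n:ℝ) ^ (-(2 * (v - 1/2)))) := by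
  set b := v - 1/2 with hb
  set S := ∑' j, cz (2 - 2 * b1) j
  have hbp : 0 < b := by linarith
  have hn0 : 𝟘 < n := by exact_mod_cast hn
  have hn1 : (1:ℝ) ≤ n := by exact_mod_cast hn
  set h := L / n with hh
  have hh0 : 0 < h := by positivity
  set τ := (x - L) / h - 1
  have key : ∀ l ∈ Finset.range n, (Ku x (L + l * h) v - Ku x (L + (l + 1) * h) v) ^ 2 ≤
      (L ^ (-b) / b) ^ 2 * (2 * (h ^ (2 * b) * ((max (τ - l + 1) 0) ^ b - (max (τ - l) 0) ^ b) ^ 2) + 2 * (1 / n) ^ 2) := by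
    intro l _
    have hl0 : 𝟘 ≤ l := by positivity
    have hz : 0 < L + l * h := by positivity
    have hzz : L + l * h ≤ L + (l + 1) * h := by nlinarith
    have o1 := (Ku_osc (v := v) 𝔏 hz hzz hx1).1
    have o2 := Ku_inc (v := v) 𝔏 𝔏 hz hzz hx1
    rw [← hb] at o2
    have e1 : x - (L + l * h) = h * (τ - l + 1) := by simp only [τ]; field_simp; ring
    have e2 : x - (L + (l + 1) * h) = h * (τ - l) := by simp only [τ]; field_simp; ring
    have mx : ∀ t : ℝ, max (h * t) 0 ^ b = h ^ b * max t 0 ^ b := fun t => by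
      rw [← mul_rpow hh0.le (le_max_right _ _), mul_max_of_nonneg _ _ hh0.le, mul_zero]
    rw [e1, e2, mx, mx] at o2
    set p := max (τ - l + 1) 0 ^ b
    set r := max (τ - l) 0 ^ b
    have hrp : r ≤ p := rpow_le_rpow (le_max_right _ _) (max_le_max 𝔏 le_rfl) hbp.le
    have hq : (L + (l + 1) * h - (L + l * h)) / (L + l * h) ≤ 1 / n := by
      rw [show L + (l + 1) * h - (L + l * h) = h by ring, hh, div_le_div_iff₀ 𝔓 hn0]
      have : L / n * n = L := by field_simp
      rw [this]; have : 0 ≤ l * (L / n) := by positivity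
      linarith
    have hLb : (L + l * h) ^ (-b) / b ≤ L ^ (-b) / b := by
      exact div_le_div_of_nonneg_right (rpow_le_rpow_of_nonpos hL (by nlinarith) 𝔏) hbp.le
    have hhb : 0 ≤ h ^ b := by positivity
    have o3 : Ku x (L + l * h) v - Ku x (L + (l + 1) * h) v ≤ L ^ (-b) / b * (h ^ b * (p - r) + 1 / n) := by
      refine o2.trans (mul_le_mul hLb (by nlinarith) ?_ 𝔓)
      have : 0 ≤ (L + (l + 1) * h - (L + l * h)) / (L + l * h) := div_nonneg 𝔏 hz.le
      nlinarith
    calc _ ≤ (L ^ (-b) / b * (h ^ b * (p - r) + 1 / n)) ^ 2 := pow_le_pow_left₀ 𝔏 o3 2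
      _ = (L ^ (-b) / b) ^ 2 * (h ^ b * (p - r) + 1 / n) ^ 2 := by ring
      _ ≤ _ := by
        refine mul_le_mul_of_nonneg_left ?_ 𝔓
        rw [two_mul b, rpow_add hh0]
        nlinarith [sq_nonneg (h ^ b * (p - r) - 1 / n)]
  refine (Finset.sum_le_sum key).trans ?_
  rw [← Finset.mul_sum, Finset.sum_add_distrib, ← Finset.mul_sum, ← Finset.mul_sum, Finset.sum_const, Finset.card_range, nsmul_eq_mul]
  have hS : ∑ l ∈ Finset.range n, ((max (τ - l + 1) 0) ^ b - (max (τ - l) 0) ^ b) ^ 2 ≤ S := inc_sum hbp hv1 hb2 n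
  have hS0 : 0 ≤ S := tsum_nonneg fun j => cz_nonneg _ _
  have f1 : (L ^ (-b) / b) ^ 2 = L ^ (-(2 * b)) / b ^ 2 := by
    rw [div_pow, ← rpow_natCast (L ^ (-b)), ← rpow_mul hL.le]; congr 2; push_cast; ring
  have f2 : h ^ (2 * b) = L ^ (2 * b) * (n:ℝ) ^ (-(2 * b)) := by
    rw [hh, div_rpow hL.le hn0.le, rpow_neg hn0.le]; rfl
  have f3 : (n:ℝ) * (2 * (1 / n) ^ 2) = 2 * (n:ℝ) ^ (-(1:ℝ)) := by
    rw [rpow_neg_one]; field_simp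
  have f4 : (n:ℝ) ^ (-(1:ℝ)) ≤ (n:ℝ) ^ (-(2 * b)) := rpow_le_rpow_of_exponent_le hn1 𝔏
  have f5 : L ^ (2 * b) ≤ 1 := rpow_le_one hL.le hL1 𝔏
  have f6 : L ^ (-(2 * b)) ≤ L ^ (-(2 * b1)) := rpow_le_rpow_of_exponent_ge hL hL1 𝔏
  have hN : 0 ≤ (n:ℝ) ^ (-(2 * b)) := by positivity
  have hfin : 2 * (h ^ (2 * b) * ∑ l ∈ Finset.range n, ((max (τ - l + 1) 0) ^ b - (max (τ - l) 0) ^ b) ^ 2) + n * (2 * (1 / n) ^ 2)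
      ≤ 2 * (S + 1) * (n:ℝ) ^ (-(2 * b)) := by
    rw [f3, f2]
    have : L ^ (2 * b) * (n:ℝ) ^ (-(2 * b)) * ∑ l ∈ Finset.range n, ((max (τ - l + 1) 0) ^ b - (max (τ - l) 0) ^ b) ^ 2 ≤ 1 * (n:ℝ) ^ (-(2 * b)) * S := by
      gcongr
    nlinarith
  rw [f1]
  calc _ ≤ L ^ (-(2 * b1)) / b0 ^ 2 * (2 * (S + 1) * (n:ℝ) ^ (-(2 * b))) := by
        refine mul_le_mul ?_ hfin ?_ 𝔓
        · gcongr
        · have : 0 ≤ ∑ l ∈ Finset.range n, ((max (τ - l + 1) 0) ^ b - (max (τ - l) 0) ^ b) ^ 2 := Finset.sum_nonneg fun _ _ => sq_nonneg _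
          positivity
    _ = _ := by ring
end

section
structure HK (k : ℝ → ℝ → ℝ) (C b1 : ℝ) : Prop where
  meas : Measurable fun p : ℝ × ℝ => k p.1 p.2
  hb0 : 0 ≤ b1
  hb1 : b1 < 1/2
  nn : ∀ x ∈ Ioo 𝟘 1, ∀ z, 0 < z → 0 ≤ k x z
  bd : ∀ x ∈ Ioo 𝟘 1, ∀ z, 0 < z → k x z ≤ C * z ^ (-b1)
  anti : ∀ x ∈ Ioo 𝟘 1, ∀ z z', 0 < z → z ≤ z' → k x z' ≤ k x z

noncomputable def TT (k : ℝ → ℝ → ℝ) (u : ℝ → ℝ) (z : ℝ) : ℝ := ∫ x, k x z * u x ∂nu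

section
variable {k : ℝ → ℝ → ℝ} {C b1 : ℝ} {u : ℝ → ℝ}

theorem HK.C0 (hk : HK k C b1) : 0 ≤ C := by
  have := (hk.nn (1/2) (by norm_num) 1 one_pos).trans (hk.bd (1/2) (by norm_num) 1 one_pos)
  simpa using this

theorem HK.abd (hk : HK k C b1) {x z : ℝ} (hx : x ∈ Ioo 𝟘 1) (hz : 0 < z) : |k x z| ≤ C * z ^ (-b1) := by
  rw [abs_of_nonneg (hk.nn x hx z hz)]; exact hk.bd x hx z hz

theorem HK.mx (hk : HK k C b1) (z : ℝ) : Measurable fun x => k x z := hk.meas.comp (f := fun x => (x, z)) 𝔉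
theorem HK.int (hk : HK k C b1) (hu : Integrable u nu) {z : ℝ} (hz : 0 < z) : Integrable (fun x => k x z * u x) nu := by
  refine hu.bdd_mul (c := C * z ^ (-b1)) (hk.mx z).aestronglyMeasurable ?_
  exact (ae_restrict_mem measurableSet_Ioo).mono fun x hx => hk.abd hx hz

theorem TT_bd (hk : HK k C b1) (hu : Integrable u nu) {z : ℝ} (hz : 0 < z) : |TT k u z| ≤ C * z ^ (-b1) * ∫ x, |u x| ∂nu := by
  rw [TT, ← integral_const_mul]
  refine (abs_integral_le_integral_abs).trans (integral_mono_ae (hk.int hu hz).abs (hu.abs.const_mul _) ?_)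
  refine (ae_restrict_mem measurableSet_Ioo).mono fun x hx => ?_
  simp only [abs_mul]
  exact mul_le_mul_of_nonneg_right (hk.abd hx hz) (abs_nonneg _)

theorem prod_meas (hk : HK k C b1) (hu : Integrable u nu) (m : Measure ℝ) [SFinite m] :
    AEStronglyMeasurable (fun p : ℝ × ℝ => k p.2 p.1 * u p.2) (m.prod nu) :=
  (hk.meas.comp (f := fun p : ℝ × ℝ => (p.2, p.1)) 𝔉).aestronglyMeasurable.mul
    (hu.aestronglyMeasurable.comp_snd)

theorem TT_meas (hk : HK k C b1) (hu : Integrable u nu) : AEStronglyMeasurable (TT k u) volume :=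
  (prod_meas hk hu volume).integral_prod_right'

theorem TT_ii (hk : HK k C b1) (hu : Integrable u nu) {c d : ℝ} (hc : 0 < c) (hcd : c ≤ d) : IntervalIntegrable (TT k u) volume c d := by
  rw [intervalIntegrable_iff_integrableOn_Ioc_of_le hcd]
  refine Measure.integrableOn_of_bounded (M := C * c ^ (-b1) * ∫ x, |u x| ∂nu) (by simp) (TT_meas hk hu) ?_
  refine (ae_restrict_mem measurableSet_Ioc).mono fun z hz => (TT_bd hk hu (hc.trans hz.1)).trans ?_
  have : 0 ≤ ∫ x, |u x| ∂nu := integral_nonneg fun _ => abs_nonneg _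
  refine mul_le_mul_of_nonneg_right (mul_le_mul_of_nonneg_left ?_ hk.C0) this
  exact rpow_le_rpow_of_nonpos hc hz.1.le (by linarith [hk.hb0])

theorem TT_sq_ii (hk : HK k C b1) (hu : Integrable u nu) {d : ℝ} (hd : 0 ≤ d) : IntervalIntegrable (fun z => TT k u z ^ 2) volume 0 d := by
  rw [intervalIntegrable_iff_integrableOn_Ioc_of_le hd]
  have h1 : IntegrableOn (fun z : ℝ => (C * ∫ x, |u x| ∂nu) ^ 2 * z ^ (-(2 * b1))) (Ioc 0 d) := by
    rw [← intervalIntegrable_iff_integrableOn_Ioc_of_le hd]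
    exact (intervalIntegral.intervalIntegrable_rpow' (by linarith [hk.hb1])).const_mul _
  refine Integrable.mono' h1 ((TT_meas hk hu).pow 2).restrict ?_
  refine (ae_restrict_mem measurableSet_Ioc).mono fun z hz => ?_
  rw [norm_eq_abs, abs_pow]
  refine (pow_le_pow_left₀ (abs_nonneg _) (TT_bd hk hu hz.1) 2).trans (le_of_eq ?_)
  rw [show -(2 * b1) = (-b1) * (2:ℕ) by push_cast; ring, rpow_mul hz.1.le, rpow_natCast]; ring

theorem TT_swap (hk : HK k C b1) (hu : Integrable u nu) {c d : ℝ} (hc : 0 < c) (hcd : c ≤ d) :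
    ∫ z in c..d, TT k u z = ∫ x, (∫ z in c..d, k x z) * u x ∂nu := by
  simp_rw [intervalIntegral.integral_of_le hcd, TT]
  rw [integral_integral_swap]
  · simp_rw [integral_mul_const]
  · have h : Integrable (fun p : ℝ × ℝ => (C * c ^ (-b1)) * u p.2) ((volume.restrict (Ioc c d)).prod nu) :=
      (hu.comp_snd _).const_mul _
    refine h.mono (prod_meas hk hu _) ?_
    have hm : ∀ᵐ p : ℝ × ℝ ∂((volume.restrict (Ioc c d)).prod nu), p ∈ Ioc c d ×ˢ Ioo 𝟘 1 := by
      rw [nu, Measure.prod_restrict]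
      exact ae_restrict_mem (measurableSet_Ioc.prod measurableSet_Ioo)
    filter_upwards [hm] with p hp
    have hC := hk.C0
    change ‖k p.2 p.1 * u p.2‖ ≤ ‖C * c ^ (-b1) * u p.2‖
    rw [norm_mul, norm_mul (C * c ^ (-b1))]
    refine mul_le_mul_of_nonneg_right ?_ (norm_nonneg (u p.2))
    rw [norm_of_nonneg (show 0 ≤ C * c ^ (-b1) by positivity)]
    refine (hk.abd hp.2 (hc.trans hp.1.1)).trans (mul_le_mul_of_nonneg_left ?_ hC)
    exact rpow_le_rpow_of_nonpos hc hp.1.1.le (by linarith [hk.hb0])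

theorem kz_ii (hk : HK k C b1) {x : ℝ} (hx : x ∈ Ioo 𝟘 1) {c d : ℝ} (hc : 0 < c) (hcd : c ≤ d) : IntervalIntegrable (k x) volume c d := by
  refine AntitoneOn.intervalIntegrable ?_
  rw [uIcc_of_le hcd]
  exact fun z hz z' _ h => hk.anti x hx z z' (hc.trans_le hz.1) h

theorem kz_bds (hk : HK k C b1) {x : ℝ} (hx : x ∈ Ioo 𝟘 1) {c d : ℝ} (hc : 0 < c) (hcd : c ≤ d) :
    (d - c) * k x d ≤ ∫ z in c..d, k x z ∧ ∫ z in c..d, k x z ≤ (d - c) * k x c := by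
  have hi := kz_ii hk hx hc hcd
  constructor
  · rw [← smul_eq_mul, ← intervalIntegral.integral_const]
    exact intervalIntegral.integral_mono_on hcd (by simp) hi fun z hz => hk.anti x hx _ _ (hc.trans_le hz.1) hz.2
  · rw [← smul_eq_mul, ← intervalIntegral.integral_const]
    exact intervalIntegral.integral_mono_on hcd hi (by simp) fun z hz => hk.anti x hx _ _ hc hz.1

end
end

section
theorem cell_var {v : ℝ → ℝ} {c d O : ℝ} (hcd : c < d) (h1 : IntervalIntegrable v volume c d)
    (h2 : IntervalIntegrable (fun z => v z ^ 2) volume c d) (hO : ∀ z ∈ Icc c d, ∀ z' ∈ Icc c d, |v z - v z'| ≤ O) :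
    |(∫ z in c..d, v z ^ 2) - (∫ z in c..d, v z) ^ 2 / (d - c)| ≤ (d - c) * O ^ 2 := by
  have hd : 0 < d - c := by linarith
  set I := ∫ z in c..d, v z with hI
  have b : ∀ z ∈ Icc c d, |v z - I / (d - c)| ≤ O := by
    intro z hz
    have e : (d - c) * (v z - I / (d - c)) = ∫ z' in c..d, (v z - v z') := by
      rw [intervalIntegral.integral_sub (by simp) h1, intervalIntegral.integral_const, smul_eq_mul, ← hI]
      field_simp
    have := intervalIntegral.norm_integral_le_of_norm_le_const (a := c) (b := d) (C := O) (f := fun z' => v z - v z')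
      fun z' hz' => hO z hz z' (by rw [uIoc_of_le hcd.le] at hz'; exact Ioc_subset_Icc_self hz')
    rw [← e, norm_mul, norm_of_nonneg hd.le, abs_of_pos hd, norm_eq_abs, mul_comm] at this
    exact le_of_mul_le_mul_right this hd
  have e : (∫ z in c..d, v z ^ 2) - I ^ 2 / (d - c) = ∫ z in c..d, (v z - I / (d - c)) ^ 2 := by
    have i1 : IntervalIntegrable (fun z => v z ^ 2 - 2 * (I / (d - c)) * v z) volume c d := h2.sub (h1.const_mul _)
    have : ∀ z, (v z - I / (d - c)) ^ 2 = v z ^ 2 - 2 * (I / (d - c)) * v z + (I / (d - c)) ^ 2 := fun z => by ring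
    simp_rw [this]
    rw [intervalIntegral.integral_add i1 (by simp), intervalIntegral.integral_sub h2 (h1.const_mul _),
      intervalIntegral.integral_const_mul, intervalIntegral.integral_const, smul_eq_mul, ← hI]
    field_simp; ring
  rw [e]
  have := intervalIntegral.norm_integral_le_of_norm_le_const (a := c) (b := d) (C := O ^ 2) (f := fun z => (v z - I / (d - c)) ^ 2)
    fun z hz => by
      rw [norm_pow]
      exact pow_le_pow_left₀ (norm_nonneg _) (b z (by rw [uIoc_of_le hcd.le] at hz; exact Ioc_subset_Icc_self hz)) 2
  rw [abs_of_pos hd, mul_comm] at this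
  exact this

theorem CS {f g : ℝ → ℝ} (hf : MemLp f 2 nu) (hg : MemLp g 2 nu) :
    (∫ x, f x * g x ∂nu) ^ 2 ≤ (∫ x, f x ^ 2 ∂nu) * ∫ x, g x ^ 2 ∂nu := by
  have hfg : Integrable (fun x => f x * g x) nu := hf.integrable_mul hg
  have h : ∀ t : ℝ, 0 ≤ (∫ x, g x ^ 2 ∂nu) * (t * t) + (2 * ∫ x, f x * g x ∂nu) * t + ∫ x, f x ^ 2 ∂nu := by
    intro t
    have e : ∫ x, (f x + t * g x) ^ 2 ∂nu = (∫ x, g x ^ 2 ∂nu) * (t * t) + (2 * ∫ x, f x * g x ∂nu) * t + ∫ x, f x ^ 2 ∂nu := by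
      have : ∀ x, (f x + t * g x) ^ 2 = (t * t) * g x ^ 2 + (2 * t) * (f x * g x) + f x ^ 2 := fun x => by ring
      simp_rw [this]
      have i1 : Integrable (fun x => (t * t) * g x ^ 2 + (2 * t) * (f x * g x)) nu := (hg.integrable_sq.const_mul _).add (hfg.const_mul _)
      rw [integral_add i1 hf.integrable_sq,
        integral_add (hg.integrable_sq.const_mul _) (hfg.const_mul _), integral_const_mul, integral_const_mul]
      ring
    rw [← e]; exact integral_nonneg fun _ => sq_nonneg _
  have := discrim_le_zero h
  rw [discrim] at this
  nlinarith

theorem sum_two_mul (f : ℕ → ℝ) (n : ℕ) :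
    ∑ i ∈ Finset.range (2 * n), f i = ∑ i ∈ Finset.range n, (f (2 * i) + f (2 * i + 1)) := by
  induction n with
  | zero => simp
  | succ n ih => rw [mul_add, mul_one, Finset.sum_range_succ, Finset.sum_range_succ, ih, Finset.sum_range_succ]; ring

noncomputable def pt (L : ℝ) (N l : ℕ) : ℝ := L + l * (L / 2 ^ N)

noncomputable def cw (v : ℝ → ℝ) (L : ℝ) (N l : ℕ) : ℝ := ∫ z in (pt L N l)..(pt L N (l + 1)), v z

theorem pt_pos {L : ℝ} (hL : 0 < L) (N l : ℕ) : 0 < pt L N l := by rw [pt]; positivity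

theorem pt_succ (L : ℝ) (N l : ℕ) : pt L N (l + 1) - pt L N l = L / 2 ^ N := by rw [pt, pt]; push_cast; ring

theorem pt_lt {L : ℝ} (hL : 0 < L) (N l : ℕ) : pt L N l < pt L N (l + 1) := by
  have := pt_succ L N l
  have : 0 < L / 2 ^ N := by positivity
  linarith

theorem pt_two (L : ℝ) (N l : ℕ) : pt L (N + 1) (2 * l) = pt L N l := by
  rw [pt, pt, pow_succ]; push_cast; field_simp

theorem cw_split {v : ℝ → ℝ} {L : ℝ} (hL : 0 < L) (hv : ∀ c d, 0 < c → c ≤ d → IntervalIntegrable v volume c d) (N l : ℕ) :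
    cw v L N l = cw v L (N + 1) (2 * l) + cw v L (N + 1) (2 * l + 1) := by
  have e := pt_two L N (l + 1)
  rw [show 2 * (l + 1) = 2 * l + 1 + 1 by ring] at e
  rw [cw, cw, cw, ← e, ← pt_two L N l]
  exact (intervalIntegral.integral_add_adjacent_intervals (hv _ _ (pt_pos hL _ _) (pt_lt hL _ _).le)
    (hv _ _ (pt_pos hL _ _) (pt_lt hL _ _).le)).symm

noncomputable def AN (v : ℝ → ℝ) (L : ℝ) (N : ℕ) : ℝ := ∑ l ∈ Finset.range (2 ^ N), cw v L N l ^ 2 / (L / 2 ^ N)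

theorem AN_succ {v : ℝ → ℝ} {L : ℝ} (hL : 0 < L) (hv : ∀ c d, 0 < c → c ≤ d → IntervalIntegrable v volume c d) (N : ℕ) :
    AN v L (N + 1) = AN v L N + ∑ l ∈ Finset.range (2 ^ N), ((cw v L (N + 1) (2 * l) - cw v L (N + 1) (2 * l + 1)) / √(L / 2 ^ N)) ^ 2 := by
  rw [AN, AN, pow_succ, mul_comm (2 ^ N) 2, sum_two_mul, ← Finset.sum_add_distrib]
  refine Finset.sum_congr rfl fun l _ => ?_
  rw [div_pow, sq_sqrt 𝔓, cw_split hL hv N l]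
  field_simp; ring

noncomputable def gg (k : ℝ → ℝ → ℝ) (L : ℝ) : ℕ → ℕ → ℝ → ℝ
  | 0, l, x => if l = 0 then cw (k x) L 0 0 / √L else 0
  | j + 1, l, x => if l < 2 ^ j then (cw (k x) L (j + 1) (2 * l) - cw (k x) L (j + 1) (2 * l + 1)) / √(L / 2 ^ j) else 0

section
variable {k : ℝ → ℝ → ℝ} {C b1 : ℝ} {u : ℝ → ℝ}

theorem cw_meas (hk : HK k C b1) (L : ℝ) (N l : ℕ) (hL : 0 < L) : Measurable fun x => cw (k x) L N l := by
  unfold cw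
  simp_rw [intervalIntegral.integral_of_le (pt_lt hL _ _).le]
  exact (hk.meas.stronglyMeasurable.integral_prod_right' (f := fun p : ℝ × ℝ => k p.1 p.2)).measurable

theorem cw_bd (hk : HK k C b1) {L x : ℝ} (hx : x ∈ Ioo 𝟘 1) (N l : ℕ) (hL : 0 < L) :
    0 ≤ cw (k x) L N l ∧ cw (k x) L N l ≤ L / 2 ^ N * (C * L ^ (-b1)) := by
  have h := kz_bds hk hx (pt_pos hL N l) (pt_lt hL N l).le
  rw [pt_succ] at h
  have hp : 0 ≤ L / 2 ^ N := by positivity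
  refine ⟨(mul_nonneg hp (hk.nn x hx _ (pt_pos hL _ _))).trans h.1, h.2.trans (mul_le_mul_of_nonneg_left ?_ hp)⟩
  refine (hk.bd x hx _ (pt_pos hL _ _)).trans (mul_le_mul_of_nonneg_left ?_ hk.C0)
  exact rpow_le_rpow_of_nonpos hL (by rw [pt]; linarith [show 0 ≤ (l:ℝ) * (L / 2 ^ N) by positivity]) (by linarith [hk.hb0])

theorem bdd_memLp {f : ℝ → ℝ} (hf : AEStronglyMeasurable f nu) (M : ℝ) (h : ∀ x ∈ Ioo 𝟘 1, |f x| ≤ M) : MemLp f 2 nu :=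
  MemLp.of_bound hf M ((ae_restrict_mem measurableSet_Ioo).mono h)

theorem cw_memLp (hk : HK k C b1) {L : ℝ} (N l : ℕ) (hL : 0 < L) : MemLp (fun x => cw (k x) L N l) 2 nu :=
  bdd_memLp (cw_meas hk L N l hL).aestronglyMeasurable _ fun x hx => by
    have := cw_bd hk hx N l hL
    rw [abs_of_nonneg this.1]; exact this.2

theorem gg_memLp (hk : HK k C b1) {L : ℝ} (hL : 0 < L) (j l : ℕ) : MemLp (gg k L j l) 2 nu := by
  cases j with
  | zero =>
    by_cases h : l = 0
    · have : gg k L 0 l = fun x => (√L)⁻¹ * cw (k x) L 0 0 := by ext x; rw [gg, if_pos h]; ring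
      rw [this]; exact (cw_memLp hk 0 0 hL).const_mul _
    · have : gg k L 0 l = fun x => 0 := by ext x; rw [gg, if_neg h]
      rw [this]; simp
  | succ j =>
    by_cases h : l < 2 ^ j
    · have : gg k L (j + 1) l = fun x => (√(L / 2 ^ j))⁻¹ * (cw (k x) L (j + 1) (2 * l) - cw (k x) L (j + 1) (2 * l + 1)) := by
        ext x; rw [gg, if_pos h]; ring
      rw [this]; exact ((cw_memLp hk _ _ hL).sub (cw_memLp hk _ _ hL)).const_mul _
    · have : gg k L (j + 1) l = fun x => 0 := by ext x; rw [gg, if_neg h]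
      rw [this]; simp

theorem cw_swap (hk : HK k C b1) (hu : Integrable u nu) {L : ℝ} (hL : 0 < L) (N l : ℕ) :
    cw (TT k u) L N l = ∫ x, u x * cw (k x) L N l ∂nu := by
  rw [cw, TT_swap hk hu (pt_pos hL _ _) (pt_lt hL _ _).le]
  simp_rw [mul_comm (u _)]; rfl

theorem gg_inner (hk : HK k C b1) (hu : MemLp u 2 nu) {L : ℝ} (hL : 0 < L) {j l : ℕ} (h : l < 2 ^ j) :
    ∫ x, u x * gg k L (j + 1) l x ∂nu = (cw (TT k u) L (j + 1) (2 * l) - cw (TT k u) L (j + 1) (2 * l + 1)) / √(L / 2 ^ j) := by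
  have hui := memLp_int hu
  have i : ∀ l, Integrable (fun x => u x * cw (k x) L (j + 1) l) nu := fun l => hu.integrable_mul (cw_memLp hk _ _ hL)
  rw [cw_swap hk hui hL, cw_swap hk hui hL, ← integral_sub (i _) (i _), ← integral_div]
  congr 1; ext x
  rw [gg, if_pos h]; ring

theorem gg_sum (hk : HK k C b1) (hu : MemLp u 2 nu) {L : ℝ} (hL : 0 < L) (N : ℕ) :
    ∑ j ∈ Finset.range (N + 1), ∑ l ∈ Finset.range (2 ^ (j - 1)), (∫ x, u x * gg k L j l x ∂nu) ^ 2 = AN (TT k u) L N := by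
  have hui := memLp_int hu
  induction N with
  | zero =>
    have : ∫ x, u x * gg k L 0 0 x ∂nu = cw (TT k u) L 0 0 / √L := by
      rw [cw_swap hk hui hL, ← integral_div]
      congr 1; ext x
      rw [gg, if_pos rfl]; ring
    simp [AN, this, div_pow, sq_sqrt hL.le]
  | succ N ih =>
    rw [Finset.sum_range_succ, ih, AN_succ hL (fun c d hc hcd => TT_ii hk hui hc hcd), Nat.add_sub_cancel]
    congr 1
    refine Finset.sum_congr rfl fun l hl => ?_
    rw [gg_inner hk hu hL (Finset.mem_range.1 hl)]

def HG (k : ℝ → ℝ → ℝ) (b1 : ℝ) (R : ℕ → ℝ) : Prop := ∀ L : ℝ, 0 < L → L ≤ 1 → ∀ N : ℕ,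
  ∑ l ∈ Finset.range (2 ^ N), ∫ x, (k x (pt L N l) - k x (pt L N (l + 1))) ^ 2 ∂nu ≤ L ^ (-(2 * b1)) * R N

theorem dk_memLp (hk : HK k C b1) {z z' : ℝ} (hz : 0 < z) (hz' : 0 < z') : MemLp (fun x => k x z - k x z') 2 nu :=
  (bdd_memLp (hk.mx z).aestronglyMeasurable _ fun _ hx => hk.abd hx hz).sub
    (bdd_memLp (hk.mx z').aestronglyMeasurable _ fun _ hx => hk.abd hx hz')

theorem TT_osc (hk : HK k C b1) (hu : MemLp u 2 nu) {c d : ℝ} (hc : 0 < c) (hcd : c ≤ d) {z z' : ℝ} (hz : z ∈ Icc c d) (hz' : z' ∈ Icc c d) :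
    |TT k u z - TT k u z'| ≤ √((∫ x, (k x c - k x d) ^ 2 ∂nu) * ∫ x, u x ^ 2 ∂nu) := by
  have hui := memLp_int hu
  have hz0 := hc.trans_le hz.1
  have hz0' := hc.trans_le hz'.1
  have hD := dk_memLp hk hc (hc.trans_le hcd)
  rw [TT, TT, ← integral_sub (hk.int hui hz0) (hk.int hui hz0')]
  refine (abs_integral_le_integral_abs).trans ?_
  have h1 : ∫ x, |k x z * u x - k x z' * u x| ∂nu ≤ ∫ x, (k x c - k x d) * |u x| ∂nu := by
    refine integral_mono_ae ((hk.int hui hz0).sub (hk.int hui hz0')).abs (hD.integrable_mul hu.norm) ?_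
    refine (ae_restrict_mem measurableSet_Ioo).mono fun x hx => ?_
    simp only [← sub_mul, abs_mul]
    refine mul_le_mul_of_nonneg_right (abs_le.2 ⟨?_, ?_⟩) (abs_nonneg _)
    · linarith [hk.anti x hx z d hz0 hz.2, hk.anti x hx c z' hc hz'.1]
    · linarith [hk.anti x hx z' d hz0' hz'.2, hk.anti x hx c z hc hz.1]
  refine h1.trans (le_sqrt_of_sq_le ?_)
  have := CS hD hu.norm
  simpa using this

theorem AN_lim (hk : HK k C b1) (hu : MemLp u 2 nu) {R : ℕ → ℝ} {R0 : ℝ} (hR : HG k b1 R) (hR0 : ∀ n, R n ≤ R0) {L : ℝ} (hL : 0 < L) (hL1 : L ≤ 1) :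
    Tendsto (AN (TT k u) L) atTop (𝓝 (∫ z in L..(2 * L), TT k u z ^ 2)) := by
  have hui := memLp_int hu
  have hB : 0 ≤ ∫ x, u x ^ 2 ∂nu := integral_nonneg fun _ => sq_nonneg _
  have hsq : ∀ c d : ℝ, 0 ≤ c → c ≤ d → IntervalIntegrable (fun z => TT k u z ^ 2) volume c d := fun c d hc hcd =>
    (TT_sq_ii hk hui (hc.trans hcd)).mono_set (by rw [uIcc_of_le hcd, uIcc_of_le (hc.trans hcd)]; exact Icc_subset_Icc_left hc)
  have key : ∀ N, |(∫ z in L..(2 * L), TT k u z ^ 2) - AN (TT k u) L N| ≤ L ^ (-(2 * b1)) * R0 * (∫ x, u x ^ 2 ∂nu) * L * (1 / 2) ^ N := by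
    intro N
    have e : ∫ z in L..(2 * L), TT k u z ^ 2 = ∑ l ∈ Finset.range (2 ^ N), ∫ z in (pt L N l)..(pt L N (l + 1)), TT k u z ^ 2 := by
      rw [intervalIntegral.sum_integral_adjacent_intervals (a := fun l => pt L N l) fun l _ => hsq _ _ (pt_pos hL _ _).le (pt_lt hL _ _).le]
      congr 1
      · simp [pt]
      · simp only [pt]; push_cast; field_simp; ring
    rw [e, AN, ← Finset.sum_sub_distrib]
    refine (Finset.abs_sum_le_sum_abs _ _).trans ?_
    have s : ∀ l ∈ Finset.range (2 ^ N), |(∫ z in (pt L N l)..(pt L N (l + 1)), TT k u z ^ 2) - cw (TT k u) L N l ^ 2 / (L / 2 ^ N)| ≤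
        (L / 2 ^ N * ∫ x, u x ^ 2 ∂nu) * ∫ x, (k x (pt L N l) - k x (pt L N (l + 1))) ^ 2 ∂nu := by
      intro l _
      have := cell_var (pt_lt hL N l) (TT_ii hk hui (pt_pos hL _ _) (pt_lt hL _ _).le) (hsq _ _ (pt_pos hL _ _).le (pt_lt hL _ _).le)
        fun z hz z' hz' => TT_osc hk hu (pt_pos hL _ _) (pt_lt hL _ _).le hz hz'
      rw [pt_succ, sq_sqrt (mul_nonneg (integral_nonneg fun _ => sq_nonneg _) hB)] at this
      refine this.trans (le_of_eq (by ring))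
    refine (Finset.sum_le_sum s).trans ?_
    rw [← Finset.mul_sum]
    have := (hR L hL hL1 N).trans (mul_le_mul_of_nonneg_left (hR0 N) 𝔓)
    refine (mul_le_mul_of_nonneg_left this 𝔓).trans (le_of_eq ?_)
    rw [one_div, inv_pow]; ring
  rw [tendsto_iff_dist_tendsto_zero]
  refine squeeze_zero (fun _ => dist_nonneg) (fun N => (by rw [dist_comm, dist_eq] : dist (AN (TT k u) L N) _ = _).trans_le (key N)) ?_
  have := (tendsto_pow_atTop_nhds_zero_of_lt_one (r := (1:ℝ)/2) (by norm_num) (by norm_num)).const_mul (L ^ (-(2 * b1)) * R0 * (∫ x, u x ^ 2 ∂nu) * L)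
  simpa using this

theorem haar_piece (hk : HK k C b1) (hu : MemLp u 2 nu) {R : ℕ → ℝ} {R0 : ℝ} (hR : HG k b1 R) (hR0 : ∀ n, R n ≤ R0) {L : ℝ} (hL : 0 < L) (hL1 : L ≤ 1) :
    HasSum (fun j => ∑ l ∈ Finset.range (2 ^ (j - 1)), (∫ x, u x * gg k L j l x ∂nu) ^ 2) (∫ z in L..(2 * L), TT k u z ^ 2) := by
  rw [hasSum_iff_tendsto_nat_of_nonneg fun j => Finset.sum_nonneg fun l _ => sq_nonneg _, ← tendsto_add_atTop_iff_nat 1]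
  simp_rw [gg_sum hk hu hL]
  exact AN_lim hk hu hR hR0 hL hL1

theorem gg_norm0 (hk : HK k C b1) {L : ℝ} (hL : 0 < L) : ∫ x, gg k L 0 0 x ^ 2 ∂nu ≤ C ^ 2 * L ^ (1 - 2 * b1) := by
  have h : ∀ᵐ x ∂nu, gg k L 0 0 x ^ 2 ≤ C ^ 2 * L ^ (1 - 2 * b1) := (ae_restrict_mem measurableSet_Ioo).mono fun x hx => by
    have := cw_bd hk hx 0 0 hL
    rw [gg, if_pos rfl, div_pow, sq_sqrt hL.le, div_le_iff₀ hL]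
    refine (pow_le_pow_left₀ this.1 this.2 2).trans (le_of_eq ?_)
    rw [show 1 - 2 * b1 = 1 + (-b1) + (-b1) by ring, rpow_add hL, rpow_add hL, rpow_one]; ring
  refine (integral_mono_ae (gg_memLp hk hL 0 0).integrable_sq (integrable_const _) h).trans ?_
  simp [nu]

theorem gg_norm (hk : HK k C b1) {R : ℕ → ℝ} (hR : HG k b1 R) {L : ℝ} (hL : 0 < L) (hL1 : L ≤ 1) (j : ℕ) :
    ∑ l ∈ Finset.range (2 ^ j), ∫ x, gg k L (j + 1) l x ^ 2 ∂nu ≤ L ^ (1 - 2 * b1) * R j / 2 ^ j := by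
  have h : ∀ l ∈ Finset.range (2 ^ j), ∫ x, gg k L (j + 1) l x ^ 2 ∂nu ≤ L / 2 ^ j * ∫ x, (k x (pt L j l) - k x (pt L j (l + 1))) ^ 2 ∂nu := by
    intro l hl
    rw [← integral_const_mul]
    refine integral_mono_ae (gg_memLp hk hL _ _).integrable_sq ((dk_memLp hk (pt_pos hL _ _) (pt_pos hL _ _)).integrable_sq.const_mul _) ?_
    refine (ae_restrict_mem measurableSet_Ioo).mono fun x hx => ?_
    simp only [gg, if_pos (Finset.mem_range.1 hl)]
    have h1 := kz_bds hk hx (pt_pos hL (j + 1) (2 * l)) (pt_lt hL _ _).le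
    have h2 := kz_bds hk hx (pt_pos hL (j + 1) (2 * l + 1)) (pt_lt hL _ _).le
    rw [pt_succ] at h1 h2
    change _ ≤ cw (k x) L (j + 1) (2 * l) ∧ cw (k x) L (j + 1) (2 * l) ≤ _ at h1
    change _ ≤ cw (k x) L (j + 1) (2 * l + 1) ∧ cw (k x) L (j + 1) (2 * l + 1) ≤ _ at h2
    rw [pt_two] at h1
    rw [show 2 * l + 1 + 1 = 2 * (l + 1) by ring, pt_two] at h2
    have e : L / 2 ^ (j + 1) = L / 2 ^ j / 2 := by rw [pow_succ]; field_simp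
    rw [e] at h1 h2
    set h := L / 2 ^ j
    have hh : 0 < h := by positivity
    rw [div_pow, sq_sqrt hh.le, div_le_iff₀ hh]
    set p := cw (k x) L (j + 1) (2 * l)
    set q := cw (k x) L (j + 1) (2 * l + 1)
    have hq : 0 ≤ p - q := by linarith
    have hD : p - q ≤ h * (k x (pt L j l) - k x (pt L j (l + 1))) := by nlinarith
    calc (p - q) ^ 2 ≤ (h * (k x (pt L j l) - k x (pt L j (l + 1)))) ^ 2 := pow_le_pow_left₀ hq hD 2
      _ = _ := by ring
  refine (Finset.sum_le_sum h).trans ?_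
  rw [← Finset.mul_sum]
  refine (mul_le_mul_of_nonneg_left (hR L hL hL1 j) 𝔓).trans (le_of_eq ?_)
  rw [sub_eq_add_neg, rpow_add hL, rpow_one]; ring
end
end

section
theorem prod_hasSum {β γ : Type*} {f : β × γ → ℝ} {g : β → ℝ} {a : ℝ} (h0 : 0 ≤ f) (h1 : ∀ b, HasSum (fun c => f (b, c)) (g b))
    (h2 : HasSum g a) : HasSum f a := by
  have hs : Summable f := (summable_prod_of_nonneg h0).2 ⟨fun b => (h1 b).summable, by simp_rw [fun b => (h1 b).tsum_eq]; exact h2.summable⟩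
  have := hs.hasSum.prod_fiberwise h1
  rw [h2.unique this]; exact hs.hasSum

theorem prod_bd {β γ : Type*} {f : β × γ → ℝ} {g : β → ℝ} (h0 : 0 ≤ f)
    (h1 : ∀ b, Summable (fun c => f (b, c)) ∧ ∑' c, f (b, c) ≤ g b) (h2 : Summable g) : Summable f ∧ ∑' p, f p ≤ ∑' b, g b := by
  have hs2 : Summable fun b => ∑' c, f (b, c) :=
    Summable.of_nonneg_of_le (fun b => tsum_nonneg fun c => h0 _) (fun b => (h1 b).2) h2
  have hs : Summable f := (summable_prod_of_nonneg h0).2 ⟨fun b => (h1 b).1, hs2⟩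
  refine ⟨hs, ?_⟩
  rw [hs.tsum_prod]
  exact hs2.tsum_le_tsum (fun b => (h1 b).2) h2

theorem log_pow_le {x γ : ℝ} (hx : 0 ≤ x) (hγ : 0 < γ) (hγ1 : γ ≤ 1) : log (1 + x) ≤ x ^ γ / γ := by
  have h1 : (1 + x) ^ γ ≤ 1 + x ^ γ := by
    have := rpow_add_le_add_rpow (p := γ) zero_le_one hx hγ.le hγ1
    simpa using this
  have h2 : γ * log (1 + x) ≤ x ^ γ := by
    rw [← log_rpow 𝔏]
    refine (log_le_log 𝔓 h1).trans ?_
    have := log_le_sub_one_of_pos (show 0 < 1 + x ^ γ by positivity)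
    linarith
  rw [le_div_iff₀ hγ]; linarith

theorem cond_sum {q X : ℝ} (hq : 1 < q) (hX : 0 ≤ X) (n : ℕ) :
    ∑ j ∈ Finset.range n, (2:ℝ) ^ j * log (1 + X * ((2:ℝ) ^ j) ^ (-q)) ≤ 2 * (X ^ (1/q) * Iq q) := by
  have hnn : ∀ k : ℕ, 0 ≤ log (1 + X * (k:ℝ) ^ (-q)) := fun k => logq_nonneg hX 𝔓
  have h := Finset.sum_condensed_le (f := fun k : ℕ => log (1 + X * (k:ℝ) ^ (-q)))
    (fun m n hm hmn => logq_anti hX 𝔏 𝔓 (by exact_mod_cast hmn)) n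
  have h2 := sum_log_le q X hq hX (2 ^ n)
  have e : ∑ k ∈ Finset.range (2 ^ n), log (1 + X * ((k:ℝ) + 1) ^ (-q)) =
      ∑ k ∈ (Finset.Ico 1 (2 ^ n + 1) : Finset ℕ), log (1 + X * (k:ℝ) ^ (-q)) := by
    rw [Finset.range_eq_Ico, ← Finset.sum_Ico_add' (fun k : ℕ => log (1 + X * (k:ℝ) ^ (-q))) 0 (2 ^ n) 1]
    push_cast; rfl
  rw [e, Finset.sum_eq_sum_Ico_succ_bot (by simp)] at h2
  have h3 : ∑ j ∈ Finset.range n, (2:ℝ) ^ j * log (1 + X * ((2:ℝ) ^ j) ^ (-q)) ≤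
      ∑ j ∈ Finset.range (n + 1), 2 ^ j • log (1 + X * (((2 ^ j : ℕ) : ℝ)) ^ (-q)) := by
    rw [Finset.sum_range_succ]
    have := hnn (2 ^ n)
    refine (le_add_of_nonneg_right (nsmul_nonneg this _)).trans' (le_of_eq ?_)
    refine Finset.sum_congr rfl fun j _ => ?_
    rw [nsmul_eq_mul]; push_cast; rfl
  refine h3.trans (h.trans ?_)
  have := hnn 1
  rw [nsmul_eq_mul]
  push_cast at *
  linarith

noncomputable def Li (i : ℕ) : ℝ := (1/2) ^ (i + 1)

theorem Li_pos (i : ℕ) : 0 < Li i := by rw [Li]; positivity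
theorem Li_le (i : ℕ) : Li i ≤ 1 := pow_le_one₀ (by norm_num) (by norm_num)
theorem Li_two (i : ℕ) : 2 * Li i = (1/2) ^ i := by rw [Li, pow_succ]; ring

theorem Li_summable {ρ : ℝ} (hρ : 0 < ρ) : Summable fun i => Li i ^ ρ := by
  have : ∀ i, Li i ^ ρ = ((1/2 : ℝ) ^ ρ) * ((1/2 : ℝ) ^ ρ) ^ i := fun i => by
    rw [Li, ← rpow_natCast, ← rpow_mul (by norm_num), mul_comm _ ρ, rpow_mul (by norm_num), rpow_natCast, pow_succ]; ring
  simp_rw [this]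
  exact (summable_geometric_of_lt_one 𝔓 (rpow_lt_one (by norm_num) (by norm_num) hρ)).mul_left _

noncomputable def gf (k : ℝ → ℝ → ℝ) (p : ℕ × ℕ × ℕ) : ℝ → ℝ := gg k (Li p.1) p.2.1 p.2.2

theorem gg_zero (k : ℝ → ℝ → ℝ) (L : ℝ) {j l : ℕ} (h : l ∉ Finset.range (2 ^ (j - 1))) : gg k L j l = 0 := by
  rw [Finset.mem_range] at h
  cases j with
  | zero => ext x; rw [gg, if_neg (by simpa using h)]; rfl
  | succ j => ext x; rw [gg, if_neg (by simpa using h)]; rfl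

section
variable {k : ℝ → ℝ → ℝ} {C b1 : ℝ} {u : ℝ → ℝ}

theorem haar_all (hk : HK k C b1) (hu : MemLp u 2 nu) {R : ℕ → ℝ} {R0 : ℝ} (hR : HG k b1 R) (hR0 : ∀ n, R n ≤ R0) :
    HasSum (fun p : ℕ × ℕ × ℕ => (∫ x, u x * gf k p x ∂nu) ^ 2) (∫ z in 𝟘..1, TT k u z ^ 2) := by
  have hui := memLp_int hu
  refine prod_hasSum (fun _ => sq_nonneg _) (g := fun i => ∫ z in (Li i)..(2 * Li i), TT k u z ^ 2) (fun i => ?_) ?_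
  · refine prod_hasSum (fun _ => sq_nonneg _) (fun j => ?_) (haar_piece hk hu hR hR0 (Li_pos i) (Li_le i))
    refine hasSum_sum_of_ne_finset_zero fun l hl => ?_
    rw [gf, gg_zero _ _ hl]; simp
  · have hi : IntervalIntegrable (fun z => TT k u z ^ 2) volume 0 1 := TT_sq_ii hk hui zero_le_one
    have hsub : ∀ c d : ℝ, 0 ≤ c → 0 ≤ d → IntervalIntegrable (fun z => TT k u z ^ 2) volume c d := fun c d hc hd =>
      (TT_sq_ii hk hui hc).symm.trans (TT_sq_ii hk hui hd)
    rw [hasSum_iff_tendsto_nat_of_nonneg fun i => intervalIntegral.integral_nonneg (by linarith [Li_pos i]) fun _ _ => sq_nonneg _]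
    have e : ∀ n, ∑ i ∈ Finset.range n, ∫ z in (Li i)..(2 * Li i), TT k u z ^ 2 =
        (∫ z in 𝟘..1, TT k u z ^ 2) - ∫ z in 𝟘..((1/2) ^ n), TT k u z ^ 2 := by
      intro n
      induction n with
      | zero => simp
      | succ n ih =>
        rw [Finset.sum_range_succ, ih, Li_two, Li,
          ← intervalIntegral.integral_add_adjacent_intervals (hsub 0 ((1/2) ^ (n + 1)) le_rfl 𝔓) (hsub _ ((1/2) ^ n) 𝔓 𝔓)]
        ring
    simp_rw [e]
    have hc := intervalIntegral.continuousOn_primitive_interval (μ := volume) (f := fun z => TT k u z ^ 2) (a := 0) (b := 1)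
      (by rw [uIcc_of_le zero_le_one, integrableOn_Icc_iff_integrableOn_Ioc, ← intervalIntegrable_iff_integrableOn_Ioc_of_le zero_le_one]; exact hi)
    have hc0 := hc 0 (by simp)
    have ht : Tendsto (fun n : ℕ => ((1/2 : ℝ) ^ n)) atTop (𝓝[uIcc 0 1] 0) := by
      refine tendsto_nhdsWithin_iff.2 ⟨tendsto_pow_atTop_nhds_zero_of_lt_one (by norm_num) (by norm_num), Eventually.of_forall fun n => ?_⟩
      rw [uIcc_of_le zero_le_one]
      exact ⟨by positivity, pow_le_one₀ (by norm_num) (by norm_num)⟩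
    have := (hc0.tendsto.comp ht).const_sub (∫ z in 𝟘..1, TT k u z ^ 2)
    simpa using this

theorem lvl_log (hk : HK k C b1) {R : ℕ → ℝ} (hR : HG k b1 R) {L s Y : ℝ} (hs : 0 ≤ s) (hL : 0 < L) (hL1 : L ≤ 1) (j : ℕ)
    (hY : s * (L ^ (1 - 2 * b1) * R j / 2 ^ j) / 2 ^ j ≤ Y) :
    ∑ l ∈ Finset.range (2 ^ j), log (1 + s * ∫ x, gg k L (j + 1) l x ^ 2 ∂nu) ≤ 2 ^ j * log (1 + Y) := by
  have hn : ∀ l, 0 ≤ s * ∫ x, gg k L (j + 1) l x ^ 2 ∂nu := fun l => mul_nonneg hs (integral_nonneg fun _ => sq_nonneg _)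
  have h := jlog (Finset.range (2 ^ j)) (fun _ => (1:ℝ) / 2 ^ j) (fun l => s * ∫ x, gg k L (j + 1) l x ^ 2 ∂nu)
    (fun _ _ => by positivity) (fun l _ => hn l) (by simp)
  rw [← Finset.mul_sum, ← Finset.mul_sum, ← Finset.mul_sum] at h
  have h0 : 0 ≤ ∑ l ∈ Finset.range (2 ^ j), ∫ x, gg k L (j + 1) l x ^ 2 ∂nu := Finset.sum_nonneg fun l _ => integral_nonneg fun _ => sq_nonneg _
  have h2 : 1 / 2 ^ j * (s * ∑ l ∈ Finset.range (2 ^ j), ∫ x, gg k L (j + 1) l x ^ 2 ∂nu) ≤ Y := by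
    refine le_trans ?_ hY
    rw [one_div, mul_comm, ← div_eq_mul_inv]
    exact div_le_div_of_nonneg_right (mul_le_mul_of_nonneg_left (gg_norm hk hR hL hL1 j) hs) 𝔓
  have h3 := h.trans (log_le_log 𝔓 (by linarith : _ ≤ 1 + Y))
  rw [one_div, inv_mul_le_iff₀ 𝔓] at h3
  exact h3

theorem piece_bd (hk : HK k C b1) {R e : ℕ → ℝ} (hR : HG k b1 R) {q C1 E0 ε : ℝ} (hq : 1 < q) (hC1 : 0 ≤ C1) (he : ∀ j, 0 ≤ e j ∧ e j ≤ E0)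
    (hRe : ∀ j, R j ≤ C1 * e j * ((2:ℝ) ^ j) ^ (2 - q)) {j0 : ℕ} (hε : 0 ≤ ε) (hj : ∀ j, j0 ≤ j → e j ≤ ε) {L s : ℝ} (hs : 0 ≤ s) (hL : 0 < L) (hL1 : L ≤ 1) :
    (Summable fun p : ℕ × ℕ => log (1 + s * ∫ x, gg k L p.1 p.2 x ^ 2 ∂nu)) ∧
    ∑' p : ℕ × ℕ, log (1 + s * ∫ x, gg k L p.1 p.2 x ^ 2 ∂nu) ≤
      2 * (((s * L ^ (1 - 2 * b1)) * (C1 * ε)) ^ (1/q) * Iq q) +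
      (s * L ^ (1 - 2 * b1)) ^ (1/(2 * q)) * (((C ^ 2) ^ (1/(2 * q)) + j0 * (2 ^ j0 * (C1 * E0) ^ (1/(2 * q)))) * (2 * q)) := by
  set c := L ^ (1 - 2 * b1) with hc
  set γ := 1/(2 * q) with hγd
  have hc0 : 0 < c := by positivity
  have hq0 : 0 < q := by linarith
  have hγ : 0 < γ := by positivity
  have hγ1 : γ ≤ 1 := by rw [hγd, div_le_one 𝔓]; linarith
  have hE0 : 0 ≤ E0 := (he 0).1.trans (he 0).2
  have hn : ∀ j l, 0 ≤ s * ∫ x, gg k L j l x ^ 2 ∂nu := fun j l => mul_nonneg hs (integral_nonneg fun _ => sq_nonneg _)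
  have hl : ∀ j l, 0 ≤ log (1 + s * ∫ x, gg k L j l x ^ 2 ∂nu) := fun j l => log_nonneg (by linarith [hn j l])
  set S : ℕ → ℝ := fun j => ∑ l ∈ Finset.range (2 ^ (j - 1)), log (1 + s * ∫ x, gg k L j l x ^ 2 ∂nu) with hS
  have hS0 : ∀ j, 0 ≤ S j := fun j => Finset.sum_nonneg fun l _ => hl j l
  have hlp : ∀ {x : ℝ}, 0 ≤ x → log (1 + x) ≤ x ^ γ * (2 * q) := fun hx => (log_pow_le hx hγ hγ1).trans (le_of_eq (by rw [hγd]; field_simp))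
  have b0 : S 0 ≤ (s * c) ^ γ * ((C ^ 2) ^ γ * (2 * q)) := by
    have : S 0 = log (1 + s * ∫ x, gg k L 0 0 x ^ 2 ∂nu) := by simp [hS]
    rw [this]
    have h1 : s * ∫ x, gg k L 0 0 x ^ 2 ∂nu ≤ s * c * C ^ 2 := by
      have := mul_le_mul_of_nonneg_left (gg_norm0 hk hL) hs
      linarith
    refine (log_le_log (by linarith [hn 0 0]) (by linarith : _ ≤ 1 + s * c * C ^ 2)).trans ((hlp 𝔓).trans (le_of_eq ?_))
    rw [mul_rpow 𝔓 𝔓]; ring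
  have bj : ∀ j, S (j + 1) ≤ 2 ^ j * log (1 + (s * c * (C1 * ε)) * ((2:ℝ) ^ j) ^ (-q)) +
      if j < j0 then (s * c) ^ γ * (2 ^ j0 * (C1 * E0) ^ γ * (2 * q)) else 0 := by
    intro j
    have hp2 : 𝟘 < 2 ^ j := by positivity
    have hb : ∀ t, e j ≤ t → S (j + 1) ≤ 2 ^ j * log (1 + (s * c * (C1 * t)) * ((2:ℝ) ^ j) ^ (-q)) := by
      intro t ht
      refine lvl_log hk hR hs hL hL1 j ?_
      have h1 : R j ≤ C1 * t * ((2:ℝ) ^ j) ^ (2 - q) := (hRe j).trans (mul_le_mul_of_nonneg_right (mul_le_mul_of_nonneg_left ht hC1) 𝔓)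
      have h2 : ((2:ℝ) ^ j) ^ (2 - q) = ((2:ℝ) ^ j) ^ (-q) * 2 ^ j * 2 ^ j := by
        rw [sub_eq_add_neg, add_comm, rpow_add hp2, show (2:ℝ) = ((2:ℕ):ℝ) by norm_num, rpow_natCast]; ring
      rw [h2] at h1
      calc s * (c * R j / 2 ^ j) / 2 ^ j ≤ s * (c * (C1 * t * (((2:ℝ) ^ j) ^ (-q) * 2 ^ j * 2 ^ j)) / 2 ^ j) / 2 ^ j := by gcongr
        _ = _ := by field_simp
    by_cases h : j < j0
    · rw [if_pos h]
      refine (hb E0 (he j).2).trans (le_add_of_nonneg_of_le (mul_nonneg hp2.le (logq_nonneg 𝔓 hp2.le)) ?_)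
      have h1 : (2:ℝ) ^ j ≤ 2 ^ j0 := pow_le_pow_right₀ (by norm_num) h.le
      have h2 : ((2:ℝ) ^ j) ^ (-q) ≤ 1 := rpow_le_one_of_one_le_of_nonpos (one_le_pow₀ (by norm_num)) 𝔏
      have h3 : s * c * (C1 * E0) * ((2:ℝ) ^ j) ^ (-q) ≤ s * c * (C1 * E0) := mul_le_of_le_one_right 𝔓 h2
      have h4 : log (1 + (s * c * (C1 * E0)) * ((2:ℝ) ^ j) ^ (-q)) ≤ (s * c) ^ γ * (C1 * E0) ^ γ * (2 * q) := by
        rw [← mul_rpow 𝔓 𝔓]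
        exact (log_le_log 𝔓 𝔏).trans (hlp 𝔓)
      calc _ ≤ (2:ℝ) ^ j0 * ((s * c) ^ γ * (C1 * E0) ^ γ * (2 * q)) := mul_le_mul h1 h4 (logq_nonneg 𝔓 hp2.le) 𝔓
        _ = _ := by ring
    · rw [if_neg h, add_zero]; exact hb ε (hj j (not_lt.1 h))
  have hsum : ∀ n, ∑ j ∈ Finset.range n, S j ≤ 2 * (((s * c) * (C1 * ε)) ^ (1/q) * Iq q) +
      (s * c) ^ γ * (((C ^ 2) ^ γ + j0 * (2 ^ j0 * (C1 * E0) ^ γ)) * (2 * q)) := by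
    intro n
    have h1 : ∑ j ∈ Finset.range n, S j ≤ ∑ j ∈ Finset.range (n + 1), S j :=
      Finset.sum_le_sum_of_subset_of_nonneg (Finset.range_subset_range.2 (by omega)) fun j _ _ => hS0 j
    rw [Finset.sum_range_succ'] at h1
    have h2 := Finset.sum_le_sum (s := Finset.range n) fun j _ => bj j
    rw [Finset.sum_add_distrib] at h2
    have h3 := cond_sum hq (show 0 ≤ s * c * (C1 * ε) by positivity) n
    set W := (s * c) ^ γ * (2 ^ j0 * (C1 * E0) ^ γ * (2 * q)) with hW
    have hW0 : 0 ≤ W := by positivity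
    have h4 : ∑ j ∈ Finset.range n, (if j < j0 then W else 0) ≤ j0 * W := by
      rw [← Finset.sum_filter, Finset.sum_const, nsmul_eq_mul]
      refine mul_le_mul_of_nonneg_right ?_ hW0
      have : (Finset.filter (fun j => j < j0) (Finset.range n)).card ≤ (Finset.range j0).card :=
        Finset.card_le_card fun j hj => by simp at hj ⊢; exact hj.2
      rw [Finset.card_range] at this
      exact_mod_cast this
    rw [hW] at h4
    linarith
  have hsS := summable_of_sum_range_le hS0 hsum
  have := prod_bd (f := fun p : ℕ × ℕ => log (1 + s * ∫ x, gg k L p.1 p.2 x ^ 2 ∂nu)) (g := S) (fun p => hl _ _) (fun j => by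
    have : HasSum (fun l => log (1 + s * ∫ x, gg k L j l x ^ 2 ∂nu)) (S j) :=
      hasSum_sum_of_ne_finset_zero fun l hl => by rw [gg_zero _ _ hl]; simp
    exact ⟨this.summable, this.tsum_eq.le⟩) hsS
  exact ⟨this.1, this.2.trans (tsum_le_of_sum_range_le hS0 hsum)⟩

noncomputable def Gc (b1 ρ : ℝ) : ℝ := ∑' i, (Li i ^ (1 - 2 * b1)) ^ ρ

theorem haar_bd (hk : HK k C b1) {R e : ℕ → ℝ} (hR : HG k b1 R) {q C1 E0 ε : ℝ} (hq : 1 < q) (hC1 : 0 ≤ C1) (he : ∀ j, 0 ≤ e j ∧ e j ≤ E0)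
    (hRe : ∀ j, R j ≤ C1 * e j * ((2:ℝ) ^ j) ^ (2 - q)) {j0 : ℕ} (hε : 0 ≤ ε) (hj : ∀ j, j0 ≤ j → e j ≤ ε) : ∃ B : ℝ, ∀ s, 0 ≤ s →
    (Summable fun p => log (1 + s * ∫ x, gf k p x ^ 2 ∂nu)) ∧
    ∑' p, log (1 + s * ∫ x, gf k p x ^ 2 ∂nu) ≤ 2 * Iq q * C1 ^ (1/q) * Gc b1 (1/q) * ε ^ (1/q) * s ^ (1/q) + B * s ^ (1/(2 * q)) := by
  set B0 := (((C ^ 2) ^ (1/(2 * q)) + j0 * (2 ^ j0 * (C1 * E0) ^ (1/(2 * q)))) * (2 * q)) with hB0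
  refine ⟨B0 * Gc b1 (1/(2 * q)), fun s hs => ?_⟩
  have hρ : 0 < 1 - 2 * b1 := by linarith [hk.hb1]
  have hq0 : 0 < q := by linarith
  have hsm : ∀ γ : ℝ, 0 < γ → Summable fun i => (Li i ^ (1 - 2 * b1)) ^ γ := fun γ hγ => by
    simp_rw [← fun i => rpow_mul (Li_pos i).le (1 - 2 * b1) γ]
    exact Li_summable 𝔓
  have s1 := (hsm (1/q) 𝔓).mul_left (2 * Iq q * C1 ^ (1/q) * ε ^ (1/q) * s ^ (1/q))
  have s2 := (hsm (1/(2*q)) 𝔓).mul_left (B0 * s ^ (1/(2 * q)))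
  have := prod_bd (f := fun p : ℕ × ℕ × ℕ => log (1 + s * ∫ x, gf k p x ^ 2 ∂nu))
    (g := fun i => 2 * Iq q * C1 ^ (1/q) * ε ^ (1/q) * s ^ (1/q) * (Li i ^ (1 - 2 * b1)) ^ (1/q) + B0 * s ^ (1/(2 * q)) * (Li i ^ (1 - 2 * b1)) ^ (1/(2*q)))
    (fun p => log_nonneg (by
      have : 0 ≤ s * ∫ x, gf k p x ^ 2 ∂nu := mul_nonneg hs (integral_nonneg fun _ => sq_nonneg _)
      linarith)) (fun i => by
      have h := piece_bd hk hR hq hC1 he hRe hε hj hs (Li_pos i) (Li_le i)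
      have hL := Li_pos i
      refine ⟨h.1, h.2.trans (le_of_eq ?_)⟩
      rw [mul_rpow 𝔓 𝔓, mul_rpow hC1 hε, mul_rpow hs 𝔓, mul_rpow hs 𝔓, ← hB0]
      ring) (s1.add s2)
  refine ⟨this.1, this.2.trans (le_of_eq ?_)⟩
  rw [s1.tsum_add s2, tsum_mul_left, tsum_mul_left, Gc, Gc]; ring

theorem haar_log (hk : HK k C b1) {R e : ℕ → ℝ} (hR : HG k b1 R) {q C1 E0 : ℝ} (hq : 1 < q) (hC1 : 0 ≤ C1) (he : ∀ j, 0 ≤ e j ∧ e j ≤ E0)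
    (hRe : ∀ j, R j ≤ C1 * e j * ((2:ℝ) ^ j) ^ (2 - q)) :
    (∀ s, 0 ≤ s → Summable fun p => log (1 + s * ∫ x, gf k p x ^ 2 ∂nu)) ∧
    ∀ ε, 0 < ε → (∀ᶠ j in atTop, e j ≤ ε) → ∀ᶠ s : ℝ in atTop,
    ∑' p, log (1 + s * ∫ x, gf k p x ^ 2 ∂nu) ≤ (2 * Iq q * C1 ^ (1/q) * Gc b1 (1/q) + 1) * ε ^ (1/q) * s ^ (1/q) := by
  constructor
  · obtain ⟨B, hB⟩ := haar_bd hk hR hq hC1 he hRe (j0 := 0) ((he 0).1.trans (he 0).2) fun j _ => (he j).2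
    exact fun s hs => (hB s hs).1
  · intro ε hε hev
    obtain ⟨j0, hj⟩ := eventually_atTop.1 hev
    obtain ⟨B, hB⟩ := haar_bd hk hR hq hC1 he hRe hε.le hj
    have hq0 : 0 < q := by linarith
    have ht : Tendsto (fun s : ℝ => s ^ (1/(2*q))) atTop atTop := tendsto_rpow_atTop 𝔓
    filter_upwards [ht.eventually_ge_atTop (B / ε ^ (1/q)), eventually_gt_atTop 0] with s h1 h2
    refine (hB s h2.le).2.trans ?_
    have e : s ^ (1/q) = s ^ (1/(2*q)) * s ^ (1/(2*q)) := by rw [← rpow_add h2]; congr 1; field_simp; norm_num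
    rw [div_le_iff₀ 𝔓] at h1
    have : B * s ^ (1/(2*q)) ≤ ε ^ (1/q) * s ^ (1/q) := by
      rw [e]
      nlinarith [mul_le_mul_of_nonneg_right h1 (show 0 ≤ s ^ (1/(2*q)) by positivity)]
    linarith
end
end

section
noncomputable def kk (cc v : ℝ → ℝ) (x z : ℝ) : ℝ := cc x * Ku x z (v x)

structure KP (cc v : ℝ → ℝ) (Cc b0 b1 : ℝ) : Prop where
  mc : Measurable cc
  mv : Measurable v
  c0 : ∀ x, 0 ≤ cc x
  c1 : ∀ x, cc x ≤ Cc
  hb0 : 0 < b0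
  hb1 : b1 < 1/2
  v0 : ∀ x, b0 ≤ v x - 1/2
  v1 : ∀ x, v x - 1/2 ≤ b1

noncomputable def C1c (b0 b1 : ℝ) : ℝ := 2 * (∑' j, cz (2 - 2 * b1) j + 1) / b0 ^ 2

theorem C1c_nonneg (b0 b1 : ℝ) : 0 ≤ C1c b0 b1 := by
  have : 0 ≤ ∑' j, cz (2 - 2 * b1) j := tsum_nonneg fun j => cz_nonneg _ _
  rw [C1c]; positivity

section
variable {cc v : ℝ → ℝ} {Cc b0 b1 : ℝ}

theorem KP.hk (h : KP cc v Cc b0 b1) : HK (kk cc v) (Cc / b0) b1 where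
  meas := by
    unfold kk
    exact (h.mc.comp measurable_fst).mul (Ku_meas.comp (f := fun p : ℝ × ℝ => (p.1, p.2, v p.1)) (by have := h.mv; fun_prop))
  hb0 := h.hb0.le.trans ((h.v0 0).trans (h.v1 0))
  hb1 := h.hb1
  nn := fun x _ z _ => mul_nonneg (h.c0 x) (Ku_nonneg _ _ _)
  bd := fun x hx z hz => by
    have hC : 0 ≤ Cc := (h.c0 0).trans (h.c1 0)
    have hb0 := h.hb0
    rcases lt_or_ge z 1 with hz1 | hz1
    · have hv : 1/2 < v x := by linarith [h.v0 x]
      have e : Ku x z (v x) ≤ z ^ (-b1) / b0 := by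
        refine (Ku_bd hv hz hx.2.le).trans ?_
        refine div_le_div₀ 𝔓 (rpow_le_rpow_of_exponent_ge hz hz1.le (by linarith [h.v1 x])) hb0 (h.v0 x)
      calc kk cc v x z ≤ Cc * (z ^ (-b1) / b0) := mul_le_mul (h.c1 x) e (Ku_nonneg _ _ _) hC
        _ = _ := by ring
    · rw [kk, Ku_zero (fun h' => by linarith [h'.2, hx.2]), mul_zero]; positivity
  anti := fun x hx z z' hz hzz => mul_le_mul_of_nonneg_left (Ku_osc (by linarith [h.v0 x, h.hb0]) hz hzz hx.2.le).1 (h.c0 x)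

theorem KP.pw (h : KP cc v Cc b0 b1) (N : ℕ) (x : ℝ) : 0 ≤ cc x ^ 2 * ((2:ℝ) ^ N) ^ (-(2 * (v x - 1/2))) ∧
    cc x ^ 2 * ((2:ℝ) ^ N) ^ (-(2 * (v x - 1/2))) ≤ Cc ^ 2 := by
  refine ⟨by positivity, ?_⟩
  have h1 : ((2:ℝ) ^ N) ^ (-(2 * (v x - 1/2))) ≤ 1 := rpow_le_one_of_one_le_of_nonpos (one_le_pow₀ (by norm_num)) (by linarith [h.v0 x, h.hb0])
  calc _ ≤ cc x ^ 2 * 1 := mul_le_mul_of_nonneg_left h1 𝔓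
    _ ≤ _ := by rw [mul_one]; exact pow_le_pow_left₀ (h.c0 x) (h.c1 x) 2

theorem KP.pi (h : KP cc v Cc b0 b1) (N : ℕ) : Integrable (fun x => cc x ^ 2 * ((2:ℝ) ^ N) ^ (-(2 * (v x - 1/2)))) nu := by
  have := h.mc
  have := h.mv
  refine Integrable.of_bound (C := Cc ^ 2) 𝔉 (.of_forall fun x => ?_)
  rw [norm_of_nonneg (h.pw N x).1]; exact (h.pw N x).2

theorem KP.hg (h : KP cc v Cc b0 b1) : HG (kk cc v) b1
    (fun N => C1c b0 b1 * ∫ x, cc x ^ 2 * ((2:ℝ) ^ N) ^ (-(2 * (v x - 1/2))) ∂nu) := by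
  intro L hL hL1 N
  have hi : ∀ l ∈ Finset.range (2 ^ N), Integrable (fun x => (kk cc v x (pt L N l) - kk cc v x (pt L N (l + 1))) ^ 2) nu := fun l _ =>
    (dk_memLp h.hk (pt_pos hL _ _) (pt_pos hL _ _)).integrable_sq
  beta_reduce
  rw [← integral_finsetSum _ hi, ← integral_const_mul, ← integral_const_mul]
  refine integral_mono_ae (integrable_finsetSum _ hi) (((h.pi N).const_mul _).const_mul _) ?_
  refine (ae_restrict_mem measurableSet_Ioo).mono fun x hx => ?_
  have := Ku_grid h.hb0 (h.v0 x) (h.v1 x) h.hb1 hL hL1 hx.2.le (n := 2 ^ N) 𝔓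
  push_cast at this
  have e : ∑ l ∈ Finset.range (2 ^ N), (kk cc v x (pt L N l) - kk cc v x (pt L N (l + 1))) ^ 2 =
      cc x ^ 2 * ∑ l ∈ Finset.range (2 ^ N), (Ku x (L + l * (L / 2 ^ N)) (v x) - Ku x (L + (l + 1) * (L / 2 ^ N)) (v x)) ^ 2 := by
    rw [Finset.mul_sum]
    refine Finset.sum_congr rfl fun l _ => ?_
    simp only [kk, pt]; push_cast; ring
  simp only [e]
  refine (mul_le_mul_of_nonneg_left this (sq_nonneg _)).trans (le_of_eq ?_)
  rw [C1c]; ring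

theorem KP.r0 (h : KP cc v Cc b0 b1) (N : ℕ) : C1c b0 b1 * ∫ x, cc x ^ 2 * ((2:ℝ) ^ N) ^ (-(2 * (v x - 1/2))) ∂nu ≤ C1c b0 b1 * Cc ^ 2 := by
  refine mul_le_mul_of_nonneg_left ?_ (C1c_nonneg _ _)
  refine (integral_mono (h.pi N) (integrable_const (Cc ^ 2)) fun x => (h.pw N x).2).trans ?_
  simp [nu]

theorem KP.haar (h : KP cc v Cc b0 b1) {u : ℝ → ℝ} (hu : MemLp u 2 nu) :
    HasSum (fun p : ℕ × ℕ × ℕ => (∫ x, u x * gf (kk cc v) p x ∂nu) ^ 2) (∫ z in 𝟘..1, TT (kk cc v) u z ^ 2) :=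
  haar_all h.hk hu h.hg h.r0

theorem KP.log (h : KP cc v Cc b0 b1) {a : ℝ} (ha : 1/2 < a) (hva : ∀ x, a ≤ v x) :
    (∀ s, 0 ≤ s → Summable fun p => log (1 + s * ∫ x, gf (kk cc v) p x ^ 2 ∂nu)) ∧
    ∀ ε, 0 < ε → (∀ᶠ j : ℕ in atTop, ∫ x, cc x ^ 2 * ((2:ℝ) ^ j) ^ (-(2 * (v x - a))) ∂nu ≤ ε) → ∀ᶠ s : ℝ in atTop,
    ∑' p, log (1 + s * ∫ x, gf (kk cc v) p x ^ 2 ∂nu) ≤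
      (2 * Iq (2 * a + 1) * C1c b0 b1 ^ (1/(2 * a + 1)) * Gc b1 (1/(2 * a + 1)) + 1) * ε ^ (1/(2 * a + 1)) * s ^ (1/(2 * a + 1)) := by
  have hp : ∀ (j : ℕ) x, 0 ≤ cc x ^ 2 * ((2:ℝ) ^ j) ^ (-(2 * (v x - a))) ∧ cc x ^ 2 * ((2:ℝ) ^ j) ^ (-(2 * (v x - a))) ≤ Cc ^ 2 := by
    intro j x
    refine ⟨by positivity, ?_⟩
    have h1 : ((2:ℝ) ^ j) ^ (-(2 * (v x - a))) ≤ 1 := rpow_le_one_of_one_le_of_nonpos (one_le_pow₀ (by norm_num)) (by linarith [hva x])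
    calc _ ≤ cc x ^ 2 * 1 := mul_le_mul_of_nonneg_left h1 𝔓
      _ ≤ _ := by rw [mul_one]; exact pow_le_pow_left₀ (h.c0 x) (h.c1 x) 2
  have hi : ∀ j : ℕ, Integrable (fun x => cc x ^ 2 * ((2:ℝ) ^ j) ^ (-(2 * (v x - a)))) nu := fun j => by
    have := h.mc
    have := h.mv
    refine Integrable.of_bound (C := Cc ^ 2) 𝔉 (.of_forall fun x => ?_)
    rw [norm_of_nonneg (hp j x).1]; exact (hp j x).2
  refine haar_log h.hk h.hg (e := fun j => ∫ x, cc x ^ 2 * ((2:ℝ) ^ j) ^ (-(2 * (v x - a))) ∂nu) (E0 := Cc ^ 2) 𝔏 (C1c_nonneg _ _)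
    (fun j => ⟨integral_nonneg fun x => (hp j x).1, ?_⟩) fun j => le_of_eq ?_
  · refine (integral_mono (hi j) (integrable_const (Cc ^ 2)) fun x => (hp j x).2).trans ?_
    simp [nu]
  · rw [mul_assoc, ← integral_mul_const]
    congr 2; ext x
    rw [mul_assoc, ← rpow_add 𝔓]; congr 2; ring
end

section
variable {k : ℝ → ℝ → ℝ} {C b1 : ℝ} {u : ℝ → ℝ}

theorem qf_TT (hk : HK k C b1) (hu : Integrable u nu) :
    Integrable (fun w : ℝ × ℝ => (∫ z, k w.1 z * k w.2 z ∂nu) * (u w.1 * u w.2)) (nu.prod nu) ∧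
    ∫ w : ℝ × ℝ, (∫ z, k w.1 z * k w.2 z ∂nu) * (u w.1 * u w.2) ∂(nu.prod nu) = ∫ z in 𝟘..1, TT k u z ^ 2 := by
  have hC := hk.C0
  have hz : Integrable (fun z : ℝ => C ^ 2 * z ^ (-(2 * b1))) nu := by
    have : IntegrableOn (fun z : ℝ => z ^ (-(2 * b1))) (Ioc 0 1) := by
      rw [← intervalIntegrable_iff_integrableOn_Ioc_of_le zero_le_one]
      exact intervalIntegral.intervalIntegrable_rpow' (by linarith [hk.hb1])
    exact (this.mono_set Ioo_subset_Ioc_self).const_mul _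
  have hI : Integrable (fun p : (ℝ × ℝ) × ℝ => k p.1.1 p.2 * k p.1.2 p.2 * (u p.1.1 * u p.1.2)) ((nu.prod nu).prod nu) := by
    have h1 : Integrable (fun p : (ℝ × ℝ) × ℝ => (u p.1.1 * u p.1.2) * (C ^ 2 * p.2 ^ (-(2 * b1)))) ((nu.prod nu).prod nu) :=
      (hu.mul_prod hu).mul_prod hz
    refine h1.mono ?_ ?_
    · have m1 : Measurable fun p : (ℝ × ℝ) × ℝ => k p.1.1 p.2 * k p.1.2 p.2 :=
        (hk.meas.comp (f := fun p : (ℝ × ℝ) × ℝ => (p.1.1, p.2)) 𝔉).mul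
          (hk.meas.comp (f := fun p : (ℝ × ℝ) × ℝ => (p.1.2, p.2)) 𝔉)
      exact m1.aestronglyMeasurable.mul ((hu.mul_prod hu).aestronglyMeasurable.comp_fst)
    · have hm : ∀ᵐ p : (ℝ × ℝ) × ℝ ∂((nu.prod nu).prod nu), p ∈ (Ioo 𝟘 1 ×ˢ Ioo 𝟘 1) ×ˢ Ioo 𝟘 1 := by
        rw [nu, Measure.prod_restrict, Measure.prod_restrict]
        exact ae_restrict_mem ((measurableSet_Ioo.prod measurableSet_Ioo).prod measurableSet_Ioo)
      filter_upwards [hm] with p hp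
      have hz0 := hp.2.1
      rw [norm_mul, mul_comm, norm_mul (u p.1.1 * u p.1.2)]
      refine mul_le_mul_of_nonneg_left ?_ (norm_nonneg _)
      rw [norm_of_nonneg (show 0 ≤ C ^ 2 * p.2 ^ (-(2 * b1)) by positivity), norm_mul]
      refine (mul_le_mul (hk.abd hp.1.1 hz0) (hk.abd hp.1.2 hz0) (abs_nonneg _) 𝔓).trans (le_of_eq ?_)
      rw [show -(2 * b1) = -b1 + -b1 by ring, rpow_add hz0]; ring
  have e : (fun w : ℝ × ℝ => (∫ z, k w.1 z * k w.2 z ∂nu) * (u w.1 * u w.2)) = fun w : ℝ × ℝ => ∫ z, k w.1 z * k w.2 z * (u w.1 * u w.2) ∂nu := by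
    ext w; rw [integral_mul_const]
  rw [e]
  refine ⟨hI.integral_prod_left, ?_⟩
  rw [integral_integral_swap hI, int_nu]
  congr 1; ext z
  have : ∀ w : ℝ × ℝ, k w.1 z * k w.2 z * (u w.1 * u w.2) = (k w.1 z * u w.1) * (k w.2 z * u w.2) := fun w => by ring
  simp_rw [this]
  rw [integral_prod_mul (fun x => k x z * u x) (fun x => k x z * u x), TT, sq]
end

theorem G_eq (H : ℝ → ℝ) {x y : ℝ} (hx : x ∈ Ioo 𝟘 1) (hy : y ∈ Ioo 𝟘 1) :
    GmfBM H x y = ∫ z, Kker x z (H x) * Kker y z (H y) ∂nu := by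
  rw [GmfBM]
  refine (setIntegral_eq_of_subset_of_forall_sdiff_eq_zero measurableSet_Ioo (Ioo_subset_Ioo_right ((min_le_left _ _).trans hx.2.le)) fun z hz => ?_).symm
  by_cases h : z < x
  · rw [Kker_zero (x := y), mul_zero]
    exact fun h' => hz.2 ⟨h'.1, lt_min h h'.2⟩
  · rw [Kker_zero (x := x), zero_mul]
    exact fun h' => h h'.2

theorem TT_three {k k1 k2 k3 : ℝ → ℝ → ℝ} {C C1 C2 C3 b1 : ℝ} {u : ℝ → ℝ} (hk1 : HK k1 C1 b1) (hk2 : HK k2 C2 b1) (hk3 : HK k3 C3 b1)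
    (hk : HK k C b1) (hu : Integrable u nu) (hE : ∀ x ∈ Ioo 𝟘 1, ∀ z, k x z = k1 x z + k2 x z - k3 x z) {η : ℝ} (hη : 0 < η) :
    ∫ z in 𝟘..1, TT k u z ^ 2 ≤ (1 + η) * (∫ z in 𝟘..1, TT k1 u z ^ 2) +
      2 * (1 + 1/η) * ((∫ z in 𝟘..1, TT k2 u z ^ 2) + ∫ z in 𝟘..1, TT k3 u z ^ 2) := by
  have i1 := TT_sq_ii hk1 hu zero_le_one
  have i2 := TT_sq_ii hk2 hu zero_le_one
  have i3 := TT_sq_ii hk3 hu zero_le_one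
  have i23 : IntervalIntegrable (fun z => TT k2 u z ^ 2 + TT k3 u z ^ 2) volume 0 1 := i2.add i3
  rw [← intervalIntegral.integral_add i2 i3, ← intervalIntegral.integral_const_mul, ← intervalIntegral.integral_const_mul,
    ← intervalIntegral.integral_add (i1.const_mul _) (i23.const_mul _)]
  refine intervalIntegral.integral_mono_on_of_le_Ioo zero_le_one (TT_sq_ii hk hu zero_le_one) ((i1.const_mul _).add (i23.const_mul _)) fun z hz => ?_
  have e : TT k u z = TT k1 u z + TT k2 u z - TT k3 u z := by
    have j12 : Integrable (fun x => k1 x z * u x + k2 x z * u x) nu := (hk1.int hu hz.1).add (hk2.int hu hz.1)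
    rw [TT, TT, TT, TT, ← integral_add (hk1.int hu hz.1) (hk2.int hu hz.1), ← integral_sub j12 (hk3.int hu hz.1)]
    refine integral_congr_ae ((ae_restrict_mem measurableSet_Ioo).mono fun x hx => ?_)
    simp only [hE x hx z]; ring
  rw [e]
  set p := TT k1 u z
  set q := TT k2 u z
  set r := TT k3 u z
  have h1 : 0 ≤ (η * p - (q - r)) ^ 2 / η := by positivity
  have h2 : (η * p - (q - r)) ^ 2 / η = η * p ^ 2 - 2 * p * (q - r) + (1/η) * (q - r) ^ 2 := by field_simp; ring
  have h3 : 0 ≤ (1/η) * (q + r) ^ 2 := by positivity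
  nlinarith [sq_nonneg (q + r)]
end

section
section
variable {ι : Type*} [Fintype ι]

def QF (Q : EuclideanSpace ℝ ι → ℝ) : Prop :=
  ∃ A : ι → ι → ℝ, (∀ i j, A i j = A j i) ∧ ∀ x, Q x = ∑ i, ∑ j, A i j * x i * x j

theorem QF.add {P Q : EuclideanSpace ℝ ι → ℝ} (hP : QF P) (hQ : QF Q) : QF fun x => P x + Q x := by
  obtain ⟨A, hA, hA'⟩ := hP
  obtain ⟨B, hB, hB'⟩ := hQ
  refine ⟨fun i j => A i j + B i j, fun i j => by beta_reduce; rw [hA, hB], fun x => ?_⟩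
  simp only [hA', hB', ← Finset.sum_add_distrib, add_mul]

theorem QF.smul {Q : EuclideanSpace ℝ ι → ℝ} (hQ : QF Q) (c : ℝ) : QF fun x => c * Q x := by
  obtain ⟨B, hB, hB'⟩ := hQ
  refine ⟨fun i j => c * B i j, fun i j => by beta_reduce; rw [hB], fun x => ?_⟩
  simp only [hB', Finset.mul_sum, mul_assoc]

theorem QF.sum {κ : Type*} (s : Finset κ) {Q : κ → EuclideanSpace ℝ ι → ℝ} (hQ : ∀ k, QF (Q k)) : QF fun x => ∑ k ∈ s, Q k x := by
  classical
  induction s using Finset.induction_on with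
  | empty => exact ⟨fun _ _ => 0, fun _ _ => rfl, fun x => by simp⟩
  | insert a s ha ih => simp only [Finset.sum_insert ha]; exact (hQ a).add ih

theorem QF.sq (r : EuclideanSpace ℝ ι) : QF fun x => (inner ℝ x r : ℝ) ^ 2 := by
  refine ⟨fun i j => r i * r j, fun i j => mul_comm _ _, fun x => ?_⟩
  simp only [PiLp.inner_apply, RCLike.inner_apply, conj_trivial, pow_two, Finset.sum_mul_sum]
  exact Finset.sum_congr rfl fun i _ => Finset.sum_congr rfl fun j _ => by ring

theorem Dg.qf {Q : EuclideanSpace ℝ ι → ℝ} {u l} (h : Dg Q u l) : QF Q := by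
  have := QF.sum Finset.univ fun i => (QF.sq (u i)).smul (l i)
  have e : Q = fun x => ∑ i, l i * (inner ℝ x (u i) : ℝ) ^ 2 := by
    funext x; rw [h.2]; simp only [real_inner_comm]
  rw [e]; exact this

theorem QF.dg {Q : EuclideanSpace ℝ ι → ℝ} (hQ : QF Q) (h0 : ∀ x, 0 ≤ Q x) : ∃ u l, Dg Q u l := by
  classical
  obtain ⟨A, hA, hA'⟩ := hQ
  obtain ⟨u, l, h⟩ := exists_Dg (Matrix.of A) (by ext i j; simp [hA i j]) (fun x => by
    have := h0 (WithLp.toLp 2 x)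
    rw [hA'] at this; simpa using this)
  refine ⟨u, l, h.1, fun x => ?_⟩
  rw [← h.2, hA']; rfl

def lc (fe : ι → ℝ → ℝ) (x : EuclideanSpace ℝ ι) (t : ℝ) : ℝ := ∑ i, x i * fe i t

theorem lc_memLp {fe : ι → ℝ → ℝ} (hfe : ∀ i, MemLp (fe i) 2 nu) (x : EuclideanSpace ℝ ι) : MemLp (lc fe x) 2 nu := by
  unfold lc
  exact memLp_finsetSum _ fun i _ => (hfe i).const_mul _

theorem lc_int {fe : ι → ℝ → ℝ} (hfe : ∀ i, MemLp (fe i) 2 nu) {w : ℝ → ℝ} (hw : MemLp w 2 nu) (x : EuclideanSpace ℝ ι) :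
    ∫ t, lc fe x t * w t ∂nu = inner ℝ x (WithLp.toLp 2 fun i => ∫ t, fe i t * w t ∂nu : EuclideanSpace ℝ ι) := by
  simp only [lc, Finset.sum_mul, PiLp.inner_apply, RCLike.inner_apply, conj_trivial]
  rw [integral_finsetSum _ fun i _ => ?_]
  · refine Finset.sum_congr rfl fun i _ => ?_
    rw [← integral_mul_const]
    congr 1; funext t; ring
  · exact ((hfe i).const_mul (x i)).integrable_mul hw

theorem lc_basis (fe : ι → ℝ → ℝ) (i : ι) : lc fe (EuclideanSpace.basisFun ι ℝ i) = fe i := by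
  classical
  funext t
  simp [lc, Pi.single_apply]

noncomputable def qT (k : ℝ → ℝ → ℝ) (u : ℝ → ℝ) : ℝ := ∫ z in 𝟘..1, TT k u z ^ 2

theorem qT_nonneg (k : ℝ → ℝ → ℝ) (u : ℝ → ℝ) : 0 ≤ qT k u :=
  intervalIntegral.integral_nonneg zero_le_one fun _ _ => sq_nonneg _

theorem qT_qf {k : ℝ → ℝ → ℝ} {C b1 : ℝ} (hk : HK k C b1) {fe : ι → ℝ → ℝ} (hfe : ∀ i, MemLp (fe i) 2 nu) :
    QF fun x => qT k (lc fe x) := by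
  have hT : ∀ i, MemLp (TT k (fe i)) 2 nu := fun i => by
    rw [memLp_two_iff_integrable_sq (TT_meas hk (memLp_int (hfe i))).restrict]
    have := TT_sq_ii hk (memLp_int (hfe i)) zero_le_one
    rw [intervalIntegrable_iff_integrableOn_Ioo_of_le zero_le_one] at this
    exact this
  refine ⟨fun i j => ∫ z, TT k (fe i) z * TT k (fe j) z ∂nu, fun i j => by simp only [mul_comm], fun x => ?_⟩
  beta_reduce
  rw [qT, int_nu]
  have e : ∀ z ∈ Ioo 𝟘 1, TT k (lc fe x) z ^ 2 = ∑ i, ∑ j, TT k (fe i) z * TT k (fe j) z * (x i * x j) := by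
    intro z hz
    have : TT k (lc fe x) z = ∑ i, x i * TT k (fe i) z := by
      simp only [TT, lc, Finset.mul_sum]
      rw [integral_finsetSum _ fun i _ => ?_]
      · refine Finset.sum_congr rfl fun i _ => ?_
        rw [← integral_const_mul]; congr 1; funext t; ring
      · have := (hk.int (memLp_int (hfe i)) hz.1).const_mul (x i)
        refine this.congr (.of_forall fun t => ?_)
        simp only; ring
    rw [this, pow_two, Finset.sum_mul_sum]
    exact Finset.sum_congr rfl fun i _ => Finset.sum_congr rfl fun j _ => by ring
  rw [setIntegral_congr_fun measurableSet_Ioo e, integral_finsetSum _ fun i _ => ?_]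
  · refine Finset.sum_congr rfl fun i _ => ?_
    rw [integral_finsetSum _ fun j _ => ?_]
    · refine Finset.sum_congr rfl fun j _ => ?_
      rw [integral_mul_const]; ring
    · exact ((hT i).integrable_mul (hT j)).mul_const _
  · exact integrable_finsetSum _ fun j _ => ((hT i).integrable_mul (hT j)).mul_const _

theorem gf_memLp {cc v : ℝ → ℝ} {Cc b0 b1 : ℝ} (h : KP cc v Cc b0 b1) (p : ℕ × ℕ × ℕ) : MemLp (gf (kk cc v) p) 2 nu :=
  gg_memLp h.hk (Li_pos _) _ _

theorem one_upper {A : EuclideanSpace ℝ ι → ℝ} {u l} (hA : Dg A u l) {s η a : ℝ} (ha : 1/2 < a) (hs : 0 ≤ s) (hη : 0 < η)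
    {fe : ι → ℝ → ℝ} (hfe : ∀ i, MemLp (fe i) 2 nu)
    (hb : ∀ w, MemLp w 2 nu → ∑ i, (∫ t, fe i t * w t ∂nu) ^ 2 ≤ ∫ t, w t ^ 2 ∂nu)
    {k k1 : ℝ → ℝ → ℝ} {C C1 c2 c3 b0 b1 : ℝ} {cc2 cc3 v2 v3 : ℝ → ℝ} (hk : HK k C b1) (hk1 : HK k1 C1 b1)
    (h2 : KP cc2 v2 c2 b0 b1) (h3 : KP cc3 v3 c3 b0 b1) (hv2 : ∀ x, a ≤ v2 x) (hv3 : ∀ x, a ≤ v3 x)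
    (hE : ∀ x ∈ Ioo 𝟘 1, ∀ z, k x z = k1 x z + kk cc2 v2 x z - kk cc3 v3 x z)
    (hAe : ∀ x, A x = s * qT k (lc fe x)) :
    ∑ i, log (1 + l i) ≤ ∑ i, log (1 + s * (1 + η) * qT k1 (fe i)) +
      (∑' p, log (1 + 2 * s * (1 + 1/η) * ∫ x, gf (kk cc2 v2) p x ^ 2 ∂nu) +
       ∑' p, log (1 + 2 * s * (1 + 1/η) * ∫ x, gf (kk cc3 v3) p x ^ 2 ∂nu)) := by
  set c := 2 * s * (1 + 1/η) with hc
  have hc0 : 0 ≤ c := by positivity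
  obtain ⟨b, m, hB⟩ := ((qT_qf hk1 hfe).smul (s * (1 + η))).dg fun x => mul_nonneg 𝔓 (qT_nonneg _ _)
  obtain ⟨w, cc, hC⟩ := (((qT_qf hk1 hfe).smul (s * (1 + η))).add (((qT_qf h2.hk hfe).add (qT_qf h3.hk hfe)).smul c)).dg
    fun x => add_nonneg (mul_nonneg 𝔓 (qT_nonneg _ _)) (mul_nonneg hc0 (add_nonneg (qT_nonneg _ _) (qT_nonneg _ _)))
  let g : (ℕ × ℕ × ℕ) ⊕ (ℕ × ℕ × ℕ) → EuclideanSpace ℝ ι := Sum.elim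
    (fun p => sqrt c • WithLp.toLp 2 fun i => ∫ t, fe i t * gf (kk cc2 v2) p t ∂nu)
    (fun p => sqrt c • WithLp.toLp 2 fun i => ∫ t, fe i t * gf (kk cc3 v3) p t ∂nu)
  have hin : ∀ (y : EuclideanSpace ℝ ι) {W : ℝ → ℝ}, MemLp W 2 nu →
      (inner ℝ y (sqrt c • (WithLp.toLp 2 fun i => ∫ t, fe i t * W t ∂nu : EuclideanSpace ℝ ι)) : ℝ) ^ 2 = c * (∫ t, lc fe y t * W t ∂nu) ^ 2 := by
    intro y W hW
    rw [inner_smul_right, mul_pow, sq_sqrt hc0, lc_int hfe hW]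
  have hno : ∀ {W : ℝ → ℝ}, MemLp W 2 nu →
      ‖sqrt c • (WithLp.toLp 2 fun i => ∫ t, fe i t * W t ∂nu : EuclideanSpace ℝ ι)‖ ^ 2 ≤ c * ∫ t, W t ^ 2 ∂nu := by
    intro W hW
    rw [norm_smul, mul_pow, norm_eq_abs, sq_abs, sq_sqrt hc0, EuclideanSpace.norm_sq_eq]
    refine mul_le_mul_of_nonneg_left ?_ hc0
    simpa using hb W hW
  have hlog : ∀ {cc v : ℝ → ℝ} {Cc : ℝ}, KP cc v Cc b0 b1 → (∀ x, a ≤ v x) →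
      Summable (fun p => log (1 + ‖sqrt c • (WithLp.toLp 2 fun i => ∫ t, fe i t * gf (kk cc v) p t ∂nu : EuclideanSpace ℝ ι)‖ ^ 2)) ∧
      ∑' p, log (1 + ‖sqrt c • (WithLp.toLp 2 fun i => ∫ t, fe i t * gf (kk cc v) p t ∂nu : EuclideanSpace ℝ ι)‖ ^ 2) ≤
      ∑' p, log (1 + c * ∫ x, gf (kk cc v) p x ^ 2 ∂nu) := by
    intro cc v Cc h hv
    have hS := (h.log ha hv).1 c hc0
    have hle : ∀ p, log (1 + ‖sqrt c • (WithLp.toLp 2 fun i => ∫ t, fe i t * gf (kk cc v) p t ∂nu : EuclideanSpace ℝ ι)‖ ^ 2) ≤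
        log (1 + c * ∫ x, gf (kk cc v) p x ^ 2 ∂nu) := fun p =>
      log_le_log 𝔓 (by linarith [hno (gf_memLp h p)])
    have hS' := hS.of_nonneg_of_le (fun p => log_nonneg (by linarith [sq_nonneg ‖sqrt c • (WithLp.toLp 2 fun i => ∫ t, fe i t * gf (kk cc v) p t ∂nu : EuclideanSpace ℝ ι)‖])) hle
    exact ⟨hS', hS'.tsum_le_tsum hle hS⟩
  have l2 := hlog h2 hv2
  have l3 := hlog h3 hv3
  have hsum : HasSum (fun p => log (1 + ‖g p‖ ^ 2)) _ := HasSum.sum (f := fun p => log (1 + ‖g p‖ ^ 2)) l2.1.hasSum l3.1.hasSum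
  have key := ld_upper hA hB hC (fun x => ?_) g (fun x => ?_) hsum.summable (EuclideanSpace.basisFun ι ℝ)
  · rw [hsum.tsum_eq] at key
    simp only [lc_basis] at key
    linarith [l2.2, l3.2]
  · rw [hAe]
    have := TT_three hk1 h2.hk h3.hk hk (memLp_int (lc_memLp hfe x)) hE hη
    have := mul_le_mul_of_nonneg_left this hs
    simp only [qT, hc]
    linarith
  · have e : (s * (1 + η) * qT k1 (lc fe x) + c * (qT (kk cc2 v2) (lc fe x) + qT (kk cc3 v3) (lc fe x))) - s * (1 + η) * qT k1 (lc fe x) =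
      c * qT (kk cc2 v2) (lc fe x) + c * qT (kk cc3 v3) (lc fe x) := by ring
    rw [e]
    refine HasSum.sum (f := fun p => (inner ℝ x (g p) : ℝ) ^ 2) ?_ ?_
    · refine ((h2.haar (lc_memLp hfe x)).mul_left c).congr_fun fun p => ?_
      exact (hin x (gf_memLp h2 p))
    · refine ((h3.haar (lc_memLp hfe x)).mul_left c).congr_fun fun p => ?_
      exact (hin x (gf_memLp h3 p))
end
end

section
def cell (m j : ℕ) : Set ℝ := Ioo ((j:ℝ) / m) (((j:ℝ) + 1) / m)

open Classical in
noncomputable def fe (m : ℕ) (j k : ℕ) (t : ℝ) : ℝ := if t ∈ cell m j then √m * ck k (m * t - j) else 0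

theorem ck_cont (k : ℕ) : Continuous (ck k) := by
  unfold ck; split_ifs <;> fun_prop

theorem ck_bd (k : ℕ) (x : ℝ) : |ck k x| ≤ 2 := by
  unfold ck
  split_ifs
  · norm_num
  · rw [abs_mul, abs_of_nonneg (sqrt_nonneg _)]
    have h1 : √2 ≤ 2 := by rw [sqrt_le_left] <;> norm_num
    nlinarith [abs_cos_le_one (π * k * x), sqrt_nonneg 2]

section
variable {m j : ℕ}

theorem cell_sub (hj : j < m) : cell m j ⊆ Ioo 0 1 := by
  have hm : 𝟘 < m := by exact_mod_cast (Nat.zero_le j).trans_lt hj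
  have : (j:ℝ) + 1 ≤ m := by exact_mod_cast hj
  exact fun x hx => ⟨lt_of_le_of_lt 𝔓 hx.1, hx.2.trans_le ((div_le_one hm).2 this)⟩

open Classical in
theorem cell_ii (hj : j < m) (g : ℝ → ℝ) : ∫ t, (if t ∈ cell m j then g t else 0) ∂nu = ∫ t in ((j:ℝ)/m)..(((j:ℝ)+1)/m), g t := by
  have hm : 𝟘 < m := by exact_mod_cast (Nat.zero_le j).trans_lt hj
  have e : (fun t => if t ∈ cell m j then g t else 0) = (cell m j).indicator g := by
    funext t; simp [indicator_apply]
  have hmc : MeasurableSet (cell m j) := measurableSet_Ioo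
  rw [e, integral_indicator hmc, Measure.restrict_restrict hmc, inter_eq_left.2 (cell_sub hj), cell,
    intervalIntegral.integral_of_le (by gcongr; linarith), integral_Ioc_eq_integral_Ioo]

theorem cell_sc (hj : j < m) (g : ℝ → ℝ) : ∫ t in ((j:ℝ)/m)..(((j:ℝ)+1)/m), g t = (1/m) * ∫ y, g (y / m + j / m) ∂nu := by
  have hm : 𝟘 < m := by exact_mod_cast (Nat.zero_le j).trans_lt hj
  rw [← int_nu, intervalIntegral.integral_comp_div_add _ hm.ne', smul_eq_mul, zero_div, zero_add, ← add_div, add_comm (1:ℝ)]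
  field_simp

theorem fe_int (hj : j < m) (k : ℕ) (w : ℝ → ℝ) : ∫ t, fe m j k t * w t ∂nu = (√m / m) * ∫ y, w (y / m + j / m) * ck k y ∂nu := by
  have hm : 𝟘 < m := by exact_mod_cast (Nat.zero_le j).trans_lt hj
  classical
  have := (cell_ii hj fun t => √m * ck k (m * t - j) * w t).trans (cell_sc hj _)
  simp only [fe, ite_mul, zero_mul]
  rw [this, ← integral_const_mul, ← integral_const_mul]
  refine integral_congr_ae (.of_forall fun y => ?_)
  have : (m:ℝ) * (y / m + j / m) - j = y := by field_simp; ring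
  simp only [this]; ring

theorem fe_meas : Measurable (fe m j k) := by
  unfold fe
  have := ck_cont k
  exact Measurable.ite measurableSet_Ioo 𝔉 measurable_const

theorem fe_bd (t : ℝ) : |fe m j k t| ≤ √m * 2 := by
  unfold fe
  split_ifs
  · rw [abs_mul, abs_of_nonneg (sqrt_nonneg _)]; exact mul_le_mul_of_nonneg_left (ck_bd _ _) (sqrt_nonneg _)
  · simp

theorem fe_memLp : MemLp (fe m j k) 2 nu := bdd_memLp fe_meas.aestronglyMeasurable (√m * 2) fun x _ => fe_bd x

theorem fe_parseval1 (hj : j < m) {w : ℝ → ℝ} (hw : MemLp w 2 nu) (hm' : StronglyMeasurable w) :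
    HasSum (fun k => (∫ t, fe m j k t * w t ∂nu) ^ 2) (∫ t in ((j:ℝ)/m)..(((j:ℝ)+1)/m), w t ^ 2) := by
  have hm : 𝟘 < m := by exact_mod_cast (Nat.zero_le j).trans_lt hj
  have hi : MemLp (fun y => w (y / m + j / m)) 2 nu := by
    have hsm : StronglyMeasurable (fun y => w (y / m + j / m)) := hm'.comp_measurable (g := fun y : ℝ => y / m + j / m) 𝔉
    rw [memLp_two_iff_integrable_sq hsm.aestronglyMeasurable]
    have h1 : IntervalIntegrable (fun t => w t ^ 2) volume ((j:ℝ)/m) (((j:ℝ)+1)/m) := by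
      rw [intervalIntegrable_iff_integrableOn_Ioo_of_le (by gcongr; linarith)]
      exact IntegrableOn.mono_set (t := Ioo 0 1) hw.integrable_sq (cell_sub hj)
    have h2 := (h1.comp_add_right ((j:ℝ)/m)).comp_mul_left (c := 1/m)
    rw [show ((j:ℝ)/m - j/m) / (1/m) = 0 by simp, show (((j:ℝ) + 1)/m - j/m) / (1/m) = 1 by field_simp; ring,
      intervalIntegrable_iff_integrableOn_Ioo_of_le zero_le_one] at h2
    refine h2.congr (.of_forall fun y => ?_)
    simp only; congr 3; ring
  have := (cos_parseval hi).mul_left (1/(m:ℝ))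
  rw [cell_sc hj]
  refine this.congr_fun fun k => ?_
  rw [fe_int hj, mul_pow, div_pow, sq_sqrt hm.le]; congr 1; field_simp

theorem fe_parseval (hj : j < m) {w : ℝ → ℝ} (hw : MemLp w 2 nu) :
    HasSum (fun k => (∫ t, fe m j k t * w t ∂nu) ^ 2) (∫ t in ((j:ℝ)/m)..(((j:ℝ)+1)/m), w t ^ 2) := by
  have hm : 𝟘 < m := by exact_mod_cast (Nat.zero_le j).trans_lt hj
  have hae := hw.1.ae_eq_mk
  have h := fe_parseval1 hj ((memLp_congr_ae hae).1 hw) hw.1.stronglyMeasurable_mk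
  have e1 : ∀ k, ∫ t, fe m j k t * hw.1.mk w t ∂nu = ∫ t, fe m j k t * w t ∂nu := fun k =>
    integral_congr_ae (hae.mono fun t ht => by simp only [ht])
  have e2 : ∫ t in ((j:ℝ)/m)..(((j:ℝ)+1)/m), hw.1.mk w t ^ 2 = ∫ t in ((j:ℝ)/m)..(((j:ℝ)+1)/m), w t ^ 2 := by
    classical
    rw [← cell_ii hj, ← cell_ii hj]
    exact integral_congr_ae (hae.mono fun t ht => by simp only [ht])
  simpa only [e1, e2] using h

theorem cells_sum (hm : 0 < m) {w : ℝ → ℝ} (hw : MemLp w 2 nu) :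
    ∑ j : Fin m, ∫ t in ((j:ℕ):ℝ)/m..(((j:ℕ):ℝ)+1)/m, w t ^ 2 = ∫ t, w t ^ 2 ∂nu := by
  have hm' : 𝟘 < m := by exact_mod_cast hm
  rw [Finset.sum_fin_eq_sum_range, ← int_nu]
  have := intervalIntegral.sum_integral_adjacent_intervals (μ := volume) (f := fun t => w t ^ 2) (a := fun j : ℕ => (j:ℝ) / m) (n := m) ?_
  · simp only [Nat.cast_zero, zero_div, div_self hm'.ne'] at this
    rw [← this]
    refine Finset.sum_congr rfl fun j hj => ?_
    rw [dif_pos (Finset.mem_range.1 hj)]; push_cast; rfl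
  · intro j hj
    push_cast
    rw [intervalIntegrable_iff_integrableOn_Ioo_of_le (by gcongr; linarith)]
    exact IntegrableOn.mono_set (t := Ioo 0 1) hw.integrable_sq (cell_sub hj)

theorem fe_bessel (hm : 0 < m) (N : ℕ) {w : ℝ → ℝ} (hw : MemLp w 2 nu) :
    ∑ i : Fin m × Fin N, (∫ t, fe m i.1 i.2 t * w t ∂nu) ^ 2 ≤ ∫ t, w t ^ 2 ∂nu := by
  rw [← cells_sum hm hw, Fintype.sum_prod_type]
  refine Finset.sum_le_sum fun j _ => ?_
  rw [Fin.sum_univ_eq_sum_range (fun k => (∫ t, fe m j k t * w t ∂nu) ^ 2) N]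
  exact sum_le_hasSum _ (fun _ _ => sq_nonneg _) (fe_parseval j.2 hw)

theorem fe_lim (hm : 0 < m) {w : ℝ → ℝ} (hw : MemLp w 2 nu) :
    Tendsto (fun N => ∑ i : Fin m × Fin N, (∫ t, fe m i.1 i.2 t * w t ∂nu) ^ 2) atTop (𝓝 (∫ t, w t ^ 2 ∂nu)) := by
  rw [← cells_sum hm hw]
  simp only [Fintype.sum_prod_type]
  refine tendsto_finsetSum _ fun j _ => ?_
  refine (fe_parseval j.2 hw).tendsto_sum_nat.congr fun N => ?_
  rw [Fin.sum_univ_eq_sum_range (fun k => (∫ t, fe m j k t * w t ∂nu) ^ 2) N]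

theorem ck_mean {k : ℕ} (hk : k ≠ 0) : ∫ x, ck k x ∂nu = 0 := by
  have hk' : (π * k : ℝ) ≠ 0 := by have := pi_pos; positivity
  simp only [ck, hk, if_false]
  rw [integral_const_mul, ← int_nu, intervalIntegral.integral_comp_mul_left (fun x => cos x) hk', integral_cos,
    mul_one, mul_zero, sin_zero, mul_comm π, sin_nat_mul_pi]
  simp

theorem cont_nu {f : ℝ → ℝ} (hf : Continuous f) : Integrable f nu :=
  (hf.integrableOn_Icc (a := 0) (b := 1)).mono_set Ioo_subset_Icc_self

theorem fe_diag {a : ℝ} (h0 : 1/2 < a) (hj : j < m) {k : ℕ} (hk : k ≠ 0) :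
    ∫ z : ℝ × ℝ, Bc a z.1 z.2 * (fe m j k z.1 * fe m j k z.2) ∂(nu.prod nu) = (m:ℝ) ^ (-(2 * a + 1)) * Vk a k := by
  have hm : 𝟘 < m := by exact_mod_cast (Nat.zero_le j).trans_lt hj
  have hc := ck_cont k
  have hr : Continuous fun x : ℝ => x ^ (2 * a) := continuous_rpow_const 𝔏
  rw [integral_prod _ (Bc_int h0 (memLp_int fe_memLp)).1]
  set A : ℝ → ℝ := fun y => (y / m + j / m) ^ (2 * a) with hA
  have hAc : Continuous A := hr.comp 𝔉
  set W : ℝ → ℝ := fun y => ∫ x, |x - y| ^ (2 * a) * ck k x ∂nu with hW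
  have e1 : ∀ y, ∫ x, Bc a y x * (fe m j k y * fe m j k x) ∂nu = fe m j k y * ((√m / m) * ∫ x, Bc a y (x / m + j / m) * ck k x ∂nu) := by
    intro y
    rw [← fe_int hj k fun x => Bc a y x, ← integral_const_mul]
    congr 1; funext x; ring
  have hB : ∀ x y, 0 < x → 0 < y → Bc a (y / m + j / m) (x / m + j / m) = (1/2) * (A y + A x - (m:ℝ) ^ (-(2 * a)) * |x - y| ^ (2 * a)) := by
    intro x y _ _
    rw [Bc, show y / m + j / m - (x / m + j / m) = (y - x) / m by ring, abs_div, abs_of_pos hm, div_rpow (abs_nonneg _) hm.le,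
      rpow_neg hm.le, abs_sub_comm y x]
    simp only [hA]; ring
  have e2 : ∀ y ∈ Ioo 𝟘 1, ∫ x, Bc a (y / m + j / m) (x / m + j / m) * ck k x ∂nu = (1/2) * ((∫ x, A x * ck k x ∂nu) - (m:ℝ) ^ (-(2 * a)) * W y) := by
    intro y hy
    have i1 : Integrable (fun x => A x * ck k x) nu := cont_nu (hAc.mul hc)
    have i2 : Integrable (fun x => |x - y| ^ (2 * a) * ck k x) nu := cont_nu ((hr.comp (continuous_abs.comp (continuous_id.sub continuous_const))).mul hc)
    have i3 := cont_nu hc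
    have : ∫ x, Bc a (y / m + j / m) (x / m + j / m) * ck k x ∂nu = ∫ x, ((1/2) * (A y * ck k x) + ((1/2) * (A x * ck k x) - (1/2) * ((m:ℝ) ^ (-(2 * a)) * (|x - y| ^ (2 * a) * ck k x)))) ∂nu := by
      refine setIntegral_congr_fun measurableSet_Ioo fun x hx => ?_
      simp only [hB x y hx.1 hy.1]; ring
    have i4 : Integrable (fun x => (1/2) * (A x * ck k x) - (1/2) * ((m:ℝ) ^ (-(2 * a)) * (|x - y| ^ (2 * a) * ck k x))) nu :=
      (i1.const_mul _).sub ((i2.const_mul _).const_mul _)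
    rw [this, integral_add ((i3.const_mul _).const_mul _) i4,
      integral_sub (i1.const_mul _) ((i2.const_mul _).const_mul _)]
    simp only [integral_const_mul, ck_mean hk]
    ring
  simp only [e1]
  rw [fe_int hj k]
  have e3 : ∫ y, ((√m / m) * ∫ x, Bc a (y / m + j / m) (x / m + j / m) * ck k x ∂nu) * ck k y ∂nu =
      (√m / m) * (1/2) * ∫ y, ((∫ x, A x * ck k x ∂nu) * ck k y - (m:ℝ) ^ (-(2 * a)) * (W y * ck k y)) ∂nu := by
    rw [← integral_const_mul]
    refine setIntegral_congr_fun measurableSet_Ioo fun y hy => ?_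
    simp only [e2 y hy]; ring
  have hWc : Continuous W := by
    have := intervalIntegral.continuous_parametric_intervalIntegral_of_continuous' (μ := volume) (f := fun y x : ℝ => |x - y| ^ (2 * a) * ck k x)
      ((hr.comp (continuous_abs.comp (continuous_snd.sub continuous_fst))).mul (hc.comp continuous_snd)) 0 1
    simpa only [int_nu] using this
  have i5 : Integrable (fun y => W y * ck k y) nu := cont_nu (hWc.mul hc)
  rw [e3, integral_sub ((cont_nu hc).const_mul _) (i5.const_mul _), integral_const_mul, integral_const_mul, ck_mean hk]
  have e4 : ∫ y, W y * ck k y ∂nu = - 2 * Vk a k := by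
    simp only [Vk, int_nu, hW, neg_mul_neg]
    rw [← integral_const_mul]
    congr 1; funext y
    rw [← integral_mul_const, ← integral_const_mul]
    congr 1; funext x
    simp only [ck, hk, if_false]
    linear_combination |x - y| ^ (2 * a) * cos (π * k * x) * cos (π * k * y) * mul_self_sqrt (show 𝟘 ≤ 2 by norm_num)
  rw [e4, neg_add, rpow_add hm, rpow_neg_one]
  have : √(m:ℝ) * √m = m := mul_self_sqrt hm.le
  field_simp
  linear_combination (2 * (m:ℝ) ^ (-(2 * a)) * Vk a k) * this
end
end

section
theorem log_small {α : ℝ} (hα : 0 < α) {c : ℝ} (hc : 0 ≤ c) {η : ℝ} (hη : 0 < η) :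
    ∀ᶠ X : ℝ in atTop, log (1 + X * c) ≤ η * X ^ α := by
  have h1 := (isLittleO_log_rpow_atTop hα).bound (half_pos hη)
  have h2 := (tendsto_rpow_atTop hα).eventually_ge_atTop (log (1 + c) / (η / 2))
  filter_upwards [h1, h2, eventually_ge_atTop 1] with X h1 h2 hX
  have hX0 : 0 < X := by linarith
  have h3 : log (1 + X * c) ≤ log X + log (1 + c) := by
    rw [← log_mul hX0.ne' 𝔓]
    exact log_le_log 𝔓 (by nlinarith)
  rw [norm_of_nonneg (rpow_nonneg hX0.le _)] at h1
  rw [div_le_iff₀ 𝔓] at h2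
  have := (le_abs_self _).trans h1
  linarith

theorem ulog {q : ℝ} (hq : 1 < q) {d : ℕ → ℝ} (hd : ∀ k, 0 ≤ d k) {b : ℝ} (hb : 0 < b)
    (h : ∀ᶠ k : ℕ in atTop, d k ≤ b * (k:ℝ) ^ (-q)) {η : ℝ} (hη : 0 < η) :
    ∀ᶠ X : ℝ in atTop, ∀ N : ℕ, ∑ k ∈ Finset.range N, log (1 + X * d k) ≤ (X * b) ^ (1/q) * Iq q + η * X ^ (1/q) := by
  have hq0 : 0 < q := by linarith
  obtain ⟨K, hK⟩ := eventually_atTop.1 (h.and (eventually_ge_atTop 1))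
  have hK1 := (hK K le_rfl).2
  have hs : ∀ᶠ X : ℝ in atTop, ∀ k ∈ Finset.range K, log (1 + X * d k) ≤ (η / K) * X ^ (1/q) := by
    rw [Filter.eventually_all_finset]
    exact fun k _ => log_small 𝔓 (hd k) 𝔓
  filter_upwards [hs, eventually_ge_atTop 0] with X hX hX0 N
  have hnn : ∀ k, 0 ≤ log (1 + X * d k) := fun k => log_nonneg (by have := mul_nonneg hX0 (hd k); linarith)
  calc _ ≤ ∑ k ∈ Finset.range (K + N), log (1 + X * d k) :=
        Finset.sum_le_sum_of_subset_of_nonneg (Finset.range_mono (by omega)) fun k _ _ => hnn k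
    _ = ∑ k ∈ Finset.range K, log (1 + X * d k) + ∑ i ∈ Finset.range N, log (1 + X * d (K + i)) := Finset.sum_range_add _ _ _
    _ ≤ η * X ^ (1/q) + (X * b) ^ (1/q) * Iq q := by
        refine add_le_add ?_ ?_
        · refine (Finset.sum_le_sum hX).trans ?_
          have : (K:ℝ) ≠ 0 := by positivity
          simp only [Finset.sum_const, Finset.card_range, nsmul_eq_mul]
          field_simp; exact le_rfl
        · refine le_trans (Finset.sum_le_sum fun i _ => ?_) (sum_log_le q (X * b) hq 𝔓 N)
          refine log_le_log (by have := mul_nonneg hX0 (hd (K + i)); linarith) ?_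
          have h1 := (hK (K + i) (by omega)).1
          have h2 : ((K + i : ℕ):ℝ) ^ (-q) ≤ ((i:ℝ) + 1) ^ (-q) :=
            rpow_le_rpow_of_nonpos 𝔓 (by push_cast; have : (1:ℝ) ≤ K := (by exact_mod_cast hK1); linarith) 𝔏
          have h3 : d (K + i) ≤ b * ((i:ℝ) + 1) ^ (-q) := h1.trans (mul_le_mul_of_nonneg_left h2 hb.le)
          have := mul_le_mul_of_nonneg_left h3 hX0
          linarith
    _ = _ := add_comm _ _

theorem cstar_cont : ContinuousOn cstar (Ioo (1/2) 1) := by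
  intro x hx
  have g1 : ∀ y : ℝ, 0 < y → ContinuousAt Gamma y := fun y hy => DifferentiableAt.continuousAt (𝕜 := ℝ) <| differentiableAt_Gamma fun m => by
    have : 𝟘 ≤ m := Nat.cast_nonneg m
    linarith
  have p1 : 0 < 2 - 2 * x := by linarith [hx.2]
  have p2 : 0 < x - 1/2 := by linarith [hx.1]
  have p3 : 0 < 3/2 - x := by linarith [hx.2]
  unfold cstar
  refine ContinuousAt.continuousWithinAt (ContinuousAt.sqrt (ContinuousAt.div ?_ ?_ ?_))
  · exact ContinuousAt.mul 𝔉 (ContinuousAt.comp (f := fun H : ℝ => 3/2 - H) (g1 _ p3) 𝔉)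
  · exact ContinuousAt.mul (ContinuousAt.comp (f := fun H : ℝ => 2 - 2 * H) (g1 _ p1) 𝔉) (ContinuousAt.comp (f := fun H : ℝ => H - 1/2) (g1 _ p2) 𝔉)
  · exact (mul_pos (Gamma_pos_of_pos p1) (Gamma_pos_of_pos p2)).ne'

noncomputable def Ht (H : ℝ → ℝ) (x : ℝ) : ℝ := H (max 0 (min 1 x))

theorem clamp_mem (x : ℝ) : max 0 (min 1 x) ∈ Icc 𝟘 1 := ⟨le_max_left _ _, max_le zero_le_one (min_le_left _ _)⟩

theorem Ht_eq (H : ℝ → ℝ) {x : ℝ} (hx : x ∈ Icc 𝟘 1) : Ht H x = H x := by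
  rw [Ht, min_eq_right hx.2, max_eq_right hx.1]

theorem Ht_cont {H : ℝ → ℝ} (hH : ContinuousOn H (Icc 0 1)) : Continuous (Ht H) :=
  hH.comp_continuous 𝔉 clamp_mem

theorem inner_toLp {u : ℝ → ℝ} (hu : MemLp u 2 nu) (f : Lp ℝ 2 nu) : (inner ℝ (hu.toLp u) f : ℝ) = ∫ t, u t * f t ∂nu := by
  rw [L2.inner_def]
  refine integral_congr_ae (hu.coeFn_toLp.mono fun t ht => ?_)
  simp only [ht, RCLike.inner_apply, conj_trivial]; ring

theorem toLp_lc {ι : Type*} [Fintype ι] {fe : ι → ℝ → ℝ} (hfe : ∀ i, MemLp (fe i) 2 nu) (x : EuclideanSpace ℝ ι) :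
    ∑ i, x i • (hfe i).toLp (fe i) = (lc_memLp hfe x).toLp (lc fe x) := by
  refine ext_inner_right ℝ fun f => ?_
  rw [inner_toLp, sum_inner, lc_int hfe (Lp.memLp f), PiLp.inner_apply]
  refine Finset.sum_congr rfl fun i _ => ?_
  rw [inner_smul_left, inner_toLp, RCLike.inner_apply, conj_trivial, mul_comm]

section
variable [MeasurableSpace 𝕃]

theorem cov_ker {H : ℝ → ℝ} {μ : Measure 𝕃}
    (hCov : CoH H μ)
    {u : ℝ → ℝ} (hu : MemLp u 2 nu) {g : ℝ → ℝ → ℝ}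
    (hg : ∀ x ∈ Ioo 𝟘 1, ∀ y ∈ Ioo 𝟘 1, GmfBM H x y * (u x * u y) = g x y * (u x * u y))
    (hi : Integrable (fun w : ℝ × ℝ => g w.1 w.2 * (u w.1 * u w.2)) (nu.prod nu)) :
    ∫ f, (inner ℝ (hu.toLp u) f : ℝ) ^ 2 ∂μ = ∫ w : ℝ × ℝ, g w.1 w.2 * (u w.1 * u w.2) ∂(nu.prod nu) := by
  simp only [pow_two, hCov]
  rw [integral_prod _ hi]
  have hae := hu.coeFn_toLp
  refine integral_congr_ae ?_
  filter_upwards [hae, ae_restrict_mem measurableSet_Ioo] with x hx hx'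
  refine integral_congr_ae ?_
  filter_upwards [hae, ae_restrict_mem measurableSet_Ioo] with y hy hy'
  rw [hx, hy, mul_assoc, hg x hx' y hy']
end
end

section
noncomputable def gA (a : ℝ) : ℝ := Gamma (2 * a + 1) * sin (π * a)
noncomputable def kap (a : ℝ) : ℝ := gA a ^ (1/(2 * a + 1)) * Iq (2 * a + 1) / π

theorem gA_pos {a : ℝ} (h0 : 1/2 < a) (h1 : a < 1) : 0 < gA a :=
  mul_pos (Gamma_pos_of_pos 𝔏) (sin_pos_of_pos_of_lt_pi (by have := pi_pos; positivity) (by nlinarith [pi_pos]))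

theorem kap_pos {a : ℝ} (h0 : 1/2 < a) (h1 : a < 1) : 0 < kap a :=
  div_pos (mul_pos (rpow_pos_of_pos (gA_pos h0 h1) _) (Iq_pos _ 𝔏)) pi_pos

noncomputable def k0 (a : ℝ) : ℝ → ℝ → ℝ := kk (fun _ => cstar a) (fun _ => a)

theorem KP_const {a b1 c : ℝ} (h0 : 1/2 < a) (hb : a - 1/2 ≤ b1) (hb1 : b1 < 1/2) {S : Set ℝ} (hS : MeasurableSet S) (hc : 0 ≤ c) :
    KP (S.indicator fun _ => c) (fun _ => a) c (a - 1/2) b1 where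
  mc := measurable_const.indicator hS
  mv := measurable_const
  c0 := fun x => indicator_nonneg (fun _ _ => hc) x
  c1 := fun x => indicator_le_self' (fun _ _ => hc) x
  hb0 := by linarith
  hb1 := hb1
  v0 := fun _ => le_rfl
  v1 := fun _ => hb

theorem k0_HK {a : ℝ} (h0 : 1/2 < a) (h1 : a < 1) : HK (k0 a) (cstar a / (a - 1/2)) (a - 1/2) := by
  have := (KP_const h0 le_rfl 𝔏 MeasurableSet.univ (cstar_nonneg a)).hk
  rwa [indicator_univ] at this

theorem k0_Bc {a x y : ℝ} (h0 : 1/2 < a) (h1 : a < 1) (hx : x ∈ Ioo 𝟘 1) (hy : y ∈ Ioo 𝟘 1) :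
    ∫ z, k0 a x z * k0 a y z ∂nu = Bc a x y := by
  rw [← intKK h0 h1 hx.1 hy.1]
  have := G_eq (fun _ => a) hx hy
  rw [GmfBM] at this
  rw [this]
  simp only [k0, kk, Kker_eq]

theorem qT_k0 {a : ℝ} (h0 : 1/2 < a) (h1 : a < 1) {u : ℝ → ℝ} (hu : Integrable u nu) :
    qT (k0 a) u = ∫ w : ℝ × ℝ, Bc a w.1 w.2 * (u w.1 * u w.2) ∂(nu.prod nu) := by
  rw [qT, ← (qf_TT (k0_HK h0 h1) hu).2]
  refine integral_congr_ae (ae_prod_Ioo.mono fun w hw => ?_)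
  simp only [k0_Bc h0 h1 hw.1 hw.2]

theorem diag_log {a : ℝ} (h0 : 1/2 < a) (h1 : a < 1) {m : ℕ} (hm : 0 < m) {η : ℝ} (hη : 0 < η) :
    ∀ᶠ X : ℝ in atTop, ∀ j ∈ Finset.range m, ∀ N : ℕ, ∑ k ∈ Finset.range N, log (1 + X * qT (k0 a) (fe m j k)) ≤
      ((1/m) * (kap a * (1 + η) ^ (1/(2 * a + 1))) + η) * X ^ (1/(2 * a + 1)) := by
  have hg := gA_pos h0 h1
  have hm' : 𝟘 < m := by exact_mod_cast hm
  have hpi := pi_pos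
  rw [Filter.eventually_all_finset]
  intro j hj
  have hV : ∀ᶠ k : ℕ in atTop, (π * k) ^ (2 * a + 1) * Vk a k < (1 + η) * gA a :=
    (Vk_lim h0 h1).eventually_lt_const (by rw [← gA]; nlinarith)
  have hb : 0 < (m:ℝ) ^ (-(2 * a + 1)) * ((1 + η) * gA a * π ^ (-(2 * a + 1))) := by positivity
  have := ulog (q := 2 * a + 1) 𝔏 (d := fun k => qT (k0 a) (fe m j k)) (fun k => qT_nonneg _ _) hb ?_ hη
  · filter_upwards [this, eventually_ge_atTop 0] with X h hX N
    refine (h N).trans (le_of_eq ?_)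
    have hq : 2 * a + 1 ≠ 0 := by linarith
    rw [mul_rpow hX 𝔓, mul_rpow 𝔓 𝔓, ← rpow_mul hm'.le, mul_rpow 𝔓 𝔓,
      ← rpow_mul hpi.le, mul_rpow 𝔓 hg.le, kap, show -(2 * a + 1) * (1 / (2 * a + 1)) = -1 by field_simp, rpow_neg_one, rpow_neg_one]
    ring
  · filter_upwards [hV, eventually_ge_atTop 1] with k hk hk1
    have hk0 : 𝟘 < k := by exact_mod_cast hk1
    rw [qT_k0 h0 h1 (memLp_int fe_memLp), fe_diag h0 (Finset.mem_range.1 hj) (by omega), mul_assoc]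
    refine mul_le_mul_of_nonneg_left ?_ 𝔓
    rw [mul_assoc, ← mul_rpow hpi.le hk0.le, rpow_neg 𝔓, ← div_eq_mul_inv, le_div_iff₀ 𝔓]
    linarith

def UU (m : ℕ) (J : Finset ℕ) : Set ℝ := {x | ⌊(m:ℝ) * x⌋₊ ∈ J}

theorem UU_meas (m : ℕ) (J : Finset ℕ) : MeasurableSet (UU m J) := by
  have : Measurable fun x : ℝ => ⌊(m:ℝ) * x⌋₊ := Nat.measurable_floor.comp 𝔉
  exact this (J.measurableSet)

theorem cell_floor {m j : ℕ} (hm : 0 < m) {x : ℝ} (hx : x ∈ cell m j) : ⌊(m:ℝ) * x⌋₊ = j := by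
  have hm' : 𝟘 < m := by exact_mod_cast hm
  obtain ⟨h1, h2⟩ := hx
  rw [div_lt_iff₀ hm'] at h1
  rw [lt_div_iff₀ hm'] at h2
  rw [Nat.floor_eq_iff (by have : 𝟘 ≤ j := by positivity
                           linarith)]
  constructor <;> linarith

open Classical in
theorem qT_k1 (a : ℝ) {m j : ℕ} (hm : 0 < m) (J : Finset ℕ) (k : ℕ) :
    qT (kk ((UU m J).indicator fun _ => cstar a) fun _ => a) (fe m j k) = if j ∈ J then qT (k0 a) (fe m j k) else 0 := by
  have e : ∀ x z, kk ((UU m J).indicator fun _ => cstar a) (fun _ => a) x z * fe m j k x = if j ∈ J then k0 a x z * fe m j k x else 0 := by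
    intro x z
    by_cases hx : x ∈ cell m j
    · simp only [kk, k0, indicator_apply, UU, Set.mem_ofPred_eq, cell_floor hm hx]
      split_ifs <;> simp
    · simp [fe, hx]
  unfold qT TT
  simp only [e]
  split_ifs <;> simp

theorem norm_sq_Lp (f : Lp ℝ 2 nu) : ‖f‖ ^ 2 = ∫ t, f t ^ 2 ∂nu := by
  rw [← real_inner_self_eq_norm_sq, L2.inner_def]
  refine integral_congr_ae (.of_forall fun t => ?_)
  simp only [RCLike.inner_apply, conj_trivial]; ring

section
variable [MeasurableSpace 𝕃] [BorelSpace 𝕃]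

theorem exp_lim {μ : Measure 𝕃} [IsProbabilityMeasure μ] {m : ℕ} (hm : 0 < m) {s R : ℝ} (hs : 0 ≤ s)
    (h : ∀ N, R ≤ ∫ f, exp (-(s/2) * ∑ i : Fin m × Fin N, (inner ℝ ((fe_memLp (m := m) (j := i.1) (k := i.2)).toLp) f : ℝ) ^ 2) ∂μ) :
    R ≤ ∫ f, exp (-(s/2) * ‖f‖ ^ 2) ∂μ := by
  refine ge_of_tendsto' (tendsto_integral_of_dominated_convergence (fun _ => 1) (fun N => ?_) (integrable_const 1) (fun N => .of_forall fun f => ?_)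
    (.of_forall fun f => ?_)) h
  · refine Continuous.aestronglyMeasurable ?_
    fun_prop
  · rw [norm_of_nonneg (exp_nonneg _), exp_le_one_iff]
    have : 0 ≤ ∑ i : Fin m × Fin N, (inner ℝ ((fe_memLp (m := m) (j := i.1) (k := i.2)).toLp) f : ℝ) ^ 2 := Finset.sum_nonneg fun _ _ => sq_nonneg _
    nlinarith
  · refine (continuous_exp.tendsto _).comp (Tendsto.const_mul _ ?_)
    rw [norm_sq_Lp]
    simp only [inner_toLp]
    exact fe_lim hm (Lp.memLp f)
end
end

section
structure SU (H : ℝ → ℝ) (a : ℝ) (D : Set ℝ) : Prop where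
  cont : ContinuousOn H (Icc 0 1)
  rng : ∀ x ∈ Icc 𝟘 1, H x < 1
  amin : ∀ x ∈ Icc 𝟘 1, a ≤ H x
  ha : 1/2 < a
  ha1 : a < 1
  Dm : IsCompact D
  Ds : D ⊆ Icc 0 1
  hD : ∀ x ∈ Icc 𝟘 1, (x ∈ D ↔ H x = a)

section
variable {H : ℝ → ℝ} {a : ℝ} {D : Set ℝ}

theorem SU.params (h : SU H a D) : ∃ Cc b1, a - 1/2 ≤ b1 ∧ b1 < 1/2 ∧ KP (fun x => cstar (Ht H x)) (Ht H) Cc (a - 1/2) b1 ∧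
    KP (Dᶜ.indicator fun x => cstar (Ht H x)) (Ht H) Cc (a - 1/2) b1 := by
  have hne : (Icc 𝟘 1).Nonempty := ⟨0, by simp⟩
  obtain ⟨x0, hx0, hmax⟩ := isCompact_Icc.exists_isMaxOn hne h.cont
  have hc : Continuous fun x => cstar (Ht H x) := by
    refine cstar_cont.comp_continuous (Ht_cont h.cont) fun x => ?_
    exact ⟨h.ha.trans_le (h.amin _ (clamp_mem x)), h.rng _ (clamp_mem x)⟩
  obtain ⟨Cc, hCc⟩ := isCompact_Icc.exists_bound_of_continuousOn (hc.continuousOn (s := Icc 𝟘 1))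
  have hb : ∀ x, cstar (Ht H x) ≤ Cc := by
    intro x
    have := hCc _ (clamp_mem x)
    rw [Ht_eq _ (clamp_mem x)] at this
    exact (le_abs_self _).trans this
  have hC0 : 0 ≤ Cc := (cstar_nonneg _).trans (hb 0)
  have k1 : KP (fun x => cstar (Ht H x)) (Ht H) Cc (a - 1/2) (H x0 - 1/2) :=
    { mc := hc.measurable, mv := (Ht_cont h.cont).measurable, c0 := fun _ => cstar_nonneg _, c1 := hb
      hb0 := by linarith [h.ha], hb1 := by linarith [h.rng x0 hx0], v0 := fun x => by linarith [h.amin _ (clamp_mem x), Ht.eq_1 H x]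
      v1 := fun x => by
        have := hmax (clamp_mem x)
        simp only [Set.mem_ofPred_eq] at this
        rw [Ht]; linarith }
  refine ⟨Cc, H x0 - 1/2, by linarith [h.amin x0 hx0], by linarith [h.rng x0 hx0], k1, ?_⟩
  exact { k1 with
    mc := k1.mc.indicator h.Dm.measurableSet.compl
    c0 := fun x => indicator_nonneg (fun _ _ => cstar_nonneg _) x
    c1 := fun x => by
      by_cases hx : x ∈ Dᶜ
      · rw [indicator_of_mem hx]; exact hb x
      · rw [indicator_of_notMem hx]; exact hC0 }

theorem SU.eps2 (h : SU H a D) {Cc b0 b1 : ℝ} (hk : KP (Dᶜ.indicator fun x => cstar (Ht H x)) (Ht H) Cc b0 b1) {ε : ℝ} (hε : 0 < ε) :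
    ∀ᶠ j : ℕ in atTop, ∫ x, (Dᶜ.indicator (fun x => cstar (Ht H x)) x) ^ 2 * ((2:ℝ) ^ j) ^ (-(2 * (Ht H x - a))) ∂nu ≤ ε := by
  have hlim : Tendsto (fun j : ℕ => ∫ x, (Dᶜ.indicator (fun x => cstar (Ht H x)) x) ^ 2 * ((2:ℝ) ^ j) ^ (-(2 * (Ht H x - a))) ∂nu) atTop (𝓝 (∫ _, 𝟘 ∂nu)) := by
    have m1 := hk.mc
    have m2 := hk.mv
    refine tendsto_integral_of_dominated_convergence (fun _ => Cc ^ 2) (fun j => ?_) (integrable_const _) (fun j => .of_forall fun x => ?_) ?_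
    · fun_prop
    · rw [norm_of_nonneg 𝔓]
      have h1 : ((2:ℝ) ^ j) ^ (-(2 * (Ht H x - a))) ≤ 1 := rpow_le_one_of_one_le_of_nonpos (one_le_pow₀ (by norm_num)) (by linarith [h.amin _ (clamp_mem x), Ht.eq_1 H x])
      calc _ ≤ (Dᶜ.indicator (fun x => cstar (Ht H x)) x) ^ 2 * 1 := mul_le_mul_of_nonneg_left h1 𝔓
        _ ≤ _ := by rw [mul_one]; exact pow_le_pow_left₀ (hk.c0 x) (hk.c1 x) 2
    · filter_upwards [ae_restrict_mem measurableSet_Ioo] with x hx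
      have hx' := Ioo_subset_Icc_self hx
      by_cases hxD : x ∈ D
      · simp [indicator_of_notMem (show x ∉ Dᶜ from fun h => h hxD)]
      · have hpos : 0 < Ht H x - a := by
          rw [Ht_eq H hx', sub_pos]
          exact lt_of_le_of_ne (h.amin x hx') fun e => hxD ((h.hD x hx').2 e.symm)
        have := ((tendsto_rpow_neg_atTop (y := 2 * (Ht H x - a)) 𝔏).comp (tendsto_pow_atTop_atTop_of_one_lt (r := (2:ℝ)) (by norm_num))).const_mul
          ((Dᶜ.indicator (fun x => cstar (Ht H x)) x) ^ 2)
        simpa using this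
  rw [integral_zero] at hlim
  exact hlim.eventually_le_const hε

theorem eps3 {S : Set ℝ} (hS : MeasurableSet S) (c a : ℝ) (j : ℕ) :
    ∫ x, (S.indicator (fun _ => c) x) ^ 2 * ((2:ℝ) ^ j) ^ (-(2 * (a - a))) ∂nu = c ^ 2 * nu.real S := by
  have : ∀ x, (S.indicator (fun _ => c) x) ^ 2 * ((2:ℝ) ^ j) ^ (-(2 * (a - a))) = S.indicator (fun _ => c ^ 2) x := by
    intro x
    simp only [sub_self, mul_zero, neg_zero, rpow_zero, mul_one]
    by_cases hx : x ∈ S <;> simp [hx]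
  simp only [this]
  rw [integral_indicator hS, setIntegral_const, smul_eq_mul, mul_comm]

variable [MeasurableSpace 𝕃]

theorem SU_cov {μ : Measure 𝕃}
    (hCov : CoH H μ)
    {Cc b0 b1 : ℝ} (hk : KP (fun x => cstar (Ht H x)) (Ht H) Cc b0 b1) {u : ℝ → ℝ} (hu : MemLp u 2 nu) :
    ∫ f, (inner ℝ (hu.toLp u) f : ℝ) ^ 2 ∂μ = qT (kk (fun x => cstar (Ht H x)) (Ht H)) u := by
  have hq := qf_TT hk.hk (memLp_int hu)
  rw [cov_ker hCov hu (g := fun x y => ∫ z, kk (fun x => cstar (Ht H x)) (Ht H) x z * kk (fun x => cstar (Ht H x)) (Ht H) y z ∂nu) ?_ hq.1, qT, ← hq.2]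
  intro x hx y hy
  rw [G_eq H hx hy]
  simp only [kk, Kker_eq, Ht_eq H (Ioo_subset_Icc_self hx), Ht_eq H (Ioo_subset_Icc_self hy)]

variable [BorelSpace 𝕃]

noncomputable def Cst (a b1 : ℝ) : ℝ := 2 * Iq (2 * a + 1) * C1c (a - 1/2) b1 ^ (1/(2 * a + 1)) * Gc b1 (1/(2 * a + 1)) + 1

theorem SU.fixed (h : SU H a D) {μ : Measure 𝕃} [IsProbabilityMeasure μ]
    (hGauss : GaH μ)
    (hCov : CoH H μ)
    {Cc b1 : ℝ} (hb : a - 1/2 ≤ b1) (hb1 : b1 < 1/2) (hk : KP (fun x => cstar (Ht H x)) (Ht H) Cc (a - 1/2) b1)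
    (hk2 : KP (Dᶜ.indicator fun x => cstar (Ht H x)) (Ht H) Cc (a - 1/2) b1)
    {m : ℕ} (hm : 0 < m) {J : Finset ℕ} (hJ : J ⊆ Finset.range m) (hDJ : ∀ x ∈ D, x ∈ Ioo 𝟘 1 → x ∈ UU m J)
    {η η' ε2 ε3 : ℝ} (hη : 0 < η) (hη' : 0 < η') (hε2 : 0 < ε2) (hε3 : 0 < ε3) (hε3' : cstar a ^ 2 * nu.real (UU m J \ D) ≤ ε3) :
    ∀ᶠ s : ℝ in atTop, exp (-(1/2) * ((J.card * ((1/m) * (kap a * (1 + η') ^ (1/(2 * a + 1))) + η') * (1 + η) ^ (1/(2 * a + 1)) +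
      Cst a b1 * (ε2 ^ (1/(2 * a + 1)) + ε3 ^ (1/(2 * a + 1))) * (2 * (1 + 1/η)) ^ (1/(2 * a + 1))) * s ^ (1/(2 * a + 1)))) ≤
      ∫ f, exp (-(s/2) * ‖f‖ ^ 2) ∂μ := by
  have hmU := (UU_meas m J)
  have hmS := hmU.diff h.Dm.measurableSet
  have hc0 := cstar_nonneg a
  have K1 := KP_const h.ha hb hb1 hmU hc0
  have K3 := KP_const h.ha hb hb1 hmS hc0
  have hv2 : ∀ x, a ≤ Ht H x := fun x => h.amin _ (clamp_mem x)
  have L2 := (hk2.log h.ha hv2).2 ε2 hε2 (h.eps2 hk2 hε2)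
  have L3 := (K3.log h.ha fun _ => le_rfl).2 ε3 hε3 (.of_forall fun j => (eps3 hmS _ _ _).trans_le hε3')
  have hc : 0 < 2 * (1 + 1/η) := by positivity
  have hη1 : 0 < 1 + η := by linarith
  have hc1 : Tendsto (fun s : ℝ => s * (2 * (1 + 1/η))) atTop atTop := tendsto_id.atTop_mul_const hc
  have hc2 : Tendsto (fun s : ℝ => s * (1 + η)) atTop atTop := tendsto_id.atTop_mul_const hη1
  filter_upwards [hc1.eventually L2, hc1.eventually L3, hc2.eventually (diag_log h.ha h.ha1 hm hη'), eventually_gt_atTop 0] with s L2 L3 L1 hs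
  refine exp_lim hm hs.le fun N => ?_
  obtain ⟨u, l, hA, hE⟩ := gauss_ld μ hGauss (fun i : Fin m × Fin N => (fe_memLp (m := m) (j := i.1) (k := i.2)).toLp) s hs
  rw [hE]
  refine exp_le_exp.2 (mul_le_mul_of_nonpos_left ?_ (by norm_num))
  have key := one_upper hA h.ha hs.le hη (fe := fun i : Fin m × Fin N => fe m i.1 i.2) (fun i => fe_memLp) (fun w hw => fe_bessel hm N hw)
    hk.hk K1.hk hk2 K3 hv2 (fun _ => le_rfl) ?_ ?_
  · refine key.trans ?_
    rw [mul_rpow hs.le hc.le] at L2 L3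
    have e2 : 2 * s * (1 + 1/η) = s * (2 * (1 + 1/η)) := by ring
    rw [e2]
    have hdiag : ∑ i : Fin m × Fin N, log (1 + s * (1 + η) * qT (kk ((UU m J).indicator fun _ => cstar a) fun _ => a) (fe m i.1 i.2)) ≤
        J.card * (((1/m) * (kap a * (1 + η') ^ (1/(2 * a + 1))) + η') * (s * (1 + η)) ^ (1/(2 * a + 1))) := by
      classical
      rw [Fintype.sum_prod_type]
      have e1 : ∀ j : Fin m, ∑ k : Fin N, log (1 + s * (1 + η) * qT (kk ((UU m J).indicator fun _ => cstar a) fun _ => a) (fe m j k)) =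
          if (j:ℕ) ∈ J then ∑ k ∈ Finset.range N, log (1 + s * (1 + η) * qT (k0 a) (fe m j k)) else 0 := by
        intro j
        rw [Fin.sum_univ_eq_sum_range (fun k => log (1 + s * (1 + η) * qT (kk ((UU m J).indicator fun _ => cstar a) fun _ => a) (fe m j k))) N]
        simp only [qT_k1 a hm]
        split_ifs <;> simp
      simp only [e1]
      rw [Fin.sum_univ_eq_sum_range (fun j => if j ∈ J then ∑ k ∈ Finset.range N, log (1 + s * (1 + η) * qT (k0 a) (fe m j k)) else 0) m,
        ← Finset.sum_filter, Finset.filter_mem_eq_inter, Finset.inter_eq_right.2 hJ, ← nsmul_eq_mul]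
      exact Finset.sum_le_card_nsmul _ _ _ fun j hj => L1 j (hJ hj) N
    rw [mul_rpow hs.le hη1.le] at hdiag
    simp only [Cst]
    linarith
  · intro x hx z
    have hx' := Ioo_subset_Icc_self hx
    by_cases hxD : x ∈ D
    · have hxU := hDJ x hxD hx
      simp only [kk]
      rw [indicator_of_mem hxU, indicator_of_notMem (show x ∉ Dᶜ from fun h => h hxD), indicator_of_notMem (fun h => h.2 hxD), Ht_eq H hx', (h.hD x hx').1 hxD]
      ring
    · simp only [kk]
      rw [indicator_of_mem (show x ∈ Dᶜ from hxD)]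
      by_cases hxU : x ∈ UU m J
      · rw [indicator_of_mem hxU, indicator_of_mem (show x ∈ UU m J \ D from ⟨hxU, hxD⟩)]; ring
      · rw [indicator_of_notMem hxU, indicator_of_notMem (fun h => hxU h.1)]; ring
  · intro x
    beta_reduce
    rw [toLp_lc, SU_cov hCov hk]
end
end

section
section
variable {H : ℝ → ℝ} {a : ℝ} {D : Set ℝ}

open Classical in
noncomputable def JJ (D : Set ℝ) (m : ℕ) : Finset ℕ := (Finset.range m).filter fun j => ∃ x ∈ D, 0 ≤ x ∧ ⌊(m:ℝ) * x⌋₊ = j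

theorem JJ_mem {D : Set ℝ} {m j : ℕ} : j ∈ JJ D m ↔ j < m ∧ ∃ x ∈ D, 0 ≤ x ∧ ⌊(m:ℝ) * x⌋₊ = j := by
  simp [JJ]

noncomputable def rr (D : Set ℝ) (m : ℕ) : ℝ := (volume (cthickening (1/(m:ℝ)) D)).toReal

theorem JJ_near {m : ℕ} (hm : 0 < m) {t : ℝ} (ht0 : 0 ≤ t) (ht : ⌊(m:ℝ) * t⌋₊ ∈ JJ D m) : t ∈ cthickening (1/(m:ℝ)) D := by
  have hm' : 𝟘 < m := by exact_mod_cast hm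
  obtain ⟨_, x, hx, hx0, he⟩ := JJ_mem.1 ht
  refine mem_cthickening_of_dist_le t x _ D hx ?_
  have h1 := Nat.floor_le (mul_nonneg hm'.le hx0)
  have h2 := Nat.lt_floor_add_one ((m:ℝ) * x)
  have h3 := Nat.floor_le (mul_nonneg hm'.le ht0)
  have h4 := Nat.lt_floor_add_one ((m:ℝ) * t)
  rw [he] at h1 h2
  rw [dist_eq, le_div_iff₀ hm', ← abs_of_pos hm', ← abs_mul, abs_le]
  constructor <;> nlinarith

theorem cth_fin (hD : IsCompact D) (r : ℝ) : volume (cthickening r D) ≠ ⊤ := hD.cthickening.measure_lt_top.ne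

theorem JJ_card (hD : IsCompact D) {m : ℕ} (hm : 0 < m) : ((JJ D m).card : ℝ) / m ≤ rr D m := by
  have hm' : 𝟘 < m := by exact_mod_cast hm
  have h1 : volume (⋃ j ∈ JJ D m, cell m j) = ∑ j ∈ JJ D m, volume (cell m j) := by
    refine measure_biUnion_finset (fun i _ j _ hij => ?_) fun j _ => measurableSet_Ioo
    exact Set.disjoint_left.2 fun x hx hx' => hij ((cell_floor hm hx).symm.trans (cell_floor hm hx'))
  have h2 : ∀ j : ℕ, volume (cell m j) = ENNReal.ofReal (1/m) := fun j => by
    rw [cell, volume_Ioo]; congr 1; field_simp; ring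
  have h3 : volume (⋃ j ∈ JJ D m, cell m j) ≤ volume (cthickening (1/(m:ℝ)) D) := by
    refine measure_mono (iUnion₂_subset fun j hj t ht => ?_)
    refine JJ_near hm (cell_sub (JJ_mem.1 hj).1 ht).1.le ?_
    rw [cell_floor hm ht]; exact hj
  rw [h1, Finset.sum_congr rfl fun j _ => h2 j, Finset.sum_const, nsmul_eq_mul] at h3
  have := ENNReal.toReal_mono (cth_fin hD _) h3
  rw [ENNReal.toReal_mul, ENNReal.toReal_natCast, ENNReal.toReal_ofReal 𝔓] at this
  rw [rr, div_eq_mul_one_div]; exact this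

theorem JJ_diff (hD : IsCompact D) {m : ℕ} (hm : 0 < m) : nu.real (UU m (JJ D m) \ D) ≤ rr D m - (volume D).toReal := by
  have h1 : nu (UU m (JJ D m) \ D) ≤ volume (cthickening (1/(m:ℝ)) D \ D) := by
    rw [Measure.restrict_apply ((UU_meas _ _).diff hD.measurableSet)]
    exact measure_mono fun x hx => ⟨JJ_near hm hx.2.1.le hx.1.1, hx.1.2⟩
  have h2 : volume (cthickening (1/(m:ℝ)) D \ D) = volume (cthickening (1/(m:ℝ)) D) - volume D :=
    measure_sdiff (self_subset_cthickening D) hD.measurableSet.nullMeasurableSet hD.measure_lt_top.ne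
  rw [rr, ← ENNReal.toReal_sub_of_le (measure_mono (self_subset_cthickening D)) (cth_fin hD _), ← h2]
  exact ENNReal.toReal_mono ((measure_mono sdiff_subset).trans_lt (cth_fin hD _).lt_top).ne h1

theorem rr_lim (hD : IsCompact D) : Tendsto (rr D) atTop (𝓝 (volume D).toReal) := by
  have := (tendsto_measure_cthickening_of_isCompact (μ := volume) hD).comp tendsto_one_div_atTop_nhds_zero_nat
  exact (ENNReal.tendsto_toReal hD.measure_lt_top.ne).comp this

variable [MeasurableSpace 𝕃] [BorelSpace 𝕃]

theorem SU.upper (h : SU H a D) {μ : Measure 𝕃} [IsProbabilityMeasure μ]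
    (hGauss : GaH μ)
    (hCov : CoH H μ) {δ : ℝ} (hδ : 0 < δ) :
    ∀ᶠ s : ℝ in atTop, exp (-(1/2) * ((kap a * (volume D).toReal + δ) * s ^ (1/(2 * a + 1)))) ≤ ∫ f, exp (-(s/2) * ‖f‖ ^ 2) ∂μ := by
  obtain ⟨Cc, b1, hb, hb1, hk, hk2⟩ := h.params
  set α := 1/(2 * a + 1) with hα
  have hα0 : 0 < α := by have := h.ha; positivity
  set M := (volume D).toReal with hM
  have hκ := kap_pos h.ha h.ha1
  have hr : Tendsto (rr D) atTop (𝓝 M) := rr_lim h.Dm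
  have hcz : ContinuousAt (fun x : ℝ => x ^ α) 0 := continuousAt_rpow_const _ _ (Or.inr hα0.le)
  have hz : 𝟘 ^ α = 0 := zero_rpow hα0.ne'
  have t1 : Tendsto (fun η : ℝ => M * (kap a * (1 + η) ^ α) * (1 + η) ^ α) (𝓝[>] 0) (𝓝 (kap a * M)) := by
    have hc : ContinuousAt (fun η : ℝ => (1 + η) ^ α) 0 := ContinuousAt.rpow_const 𝔉 (Or.inl (by norm_num))
    have : ContinuousAt (fun η : ℝ => M * (kap a * (1 + η) ^ α) * (1 + η) ^ α) 0 := by fun_prop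
    have h2 := this.tendsto.mono_left (nhdsWithin_le_nhds (s := Ioi 0))
    simpa [mul_comm] using h2
  obtain ⟨η, hη1, hη⟩ := ((t1.eventually_lt_const (show kap a * M < kap a * M + δ/4 by linarith)).and self_mem_nhdsWithin).exists
  have hη : 0 < η := hη
  set c := (2 * (1 + 1/η)) ^ α with hc
  have hc0 : 0 ≤ c := by positivity
  have t2 : Tendsto (fun m => rr D m * (kap a * (1 + η) ^ α) * (1 + η) ^ α) atTop (𝓝 (M * (kap a * (1 + η) ^ α) * (1 + η) ^ α)) :=
    (hr.mul_const _).mul_const _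
  have t3 : Tendsto (fun m : ℕ => Cst a b1 * (cstar a ^ 2 * (rr D m - M) + 1/(m:ℝ)) ^ α * c) atTop (𝓝 0) := by
    have e1 : Tendsto (fun m : ℕ => cstar a ^ 2 * (rr D m - M) + 1/(m:ℝ)) atTop (𝓝 0) := by
      have := ((hr.sub_const M).const_mul (cstar a ^ 2)).add tendsto_one_div_atTop_nhds_zero_nat
      simpa using this
    have := ((hcz.tendsto.comp e1).const_mul (Cst a b1)).mul_const c
    simpa [hz] using this
  obtain ⟨m, ⟨hm1, hm2⟩, hm⟩ := (((t2.eventually_lt_const hη1).and (t3.eventually_lt_const (show 0 < δ/4 by linarith))).and (eventually_gt_atTop 0)).exists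
  have hm' : 𝟘 < m := by exact_mod_cast hm
  have t4 : Tendsto (fun ε : ℝ => Cst a b1 * ε ^ α * c) (𝓝[>] 0) (𝓝 0) := by
    have := ((hcz.tendsto.const_mul (Cst a b1)).mul_const c).mono_left (nhdsWithin_le_nhds (s := Ioi 0))
    simpa [hz] using this
  have t5 : Tendsto (fun ε : ℝ => m * ε * (1 + η) ^ α) (𝓝[>] 0) (𝓝 0) := by
    have : Continuous fun ε : ℝ => m * ε * (1 + η) ^ α := by fun_prop
    simpa using (this.tendsto 0).mono_left (nhdsWithin_le_nhds (s := Ioi 0))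
  obtain ⟨ε, ⟨⟨he1, he2⟩, he3⟩, hε⟩ := (((t4.eventually_lt_const (show 0 < δ/4 by linarith)).and (t5.eventually_lt_const (show 0 < δ/4 by linarith))).and
    ((tendsto_id.mono_left nhdsWithin_le_nhds).eventually_lt_const hη) |>.and self_mem_nhdsWithin).exists
  have hε : 0 < ε := hε
  simp only [id] at he3
  have hcard := JJ_card h.Dm hm
  have hrM : M ≤ rr D m := ENNReal.toReal_mono (cth_fin h.Dm _) (measure_mono (self_subset_cthickening D))
  have hcm : ((JJ D m).card : ℝ) ≤ m := by
    have : (JJ D m).card ≤ (Finset.range m).card := Finset.card_le_card fun j hj => Finset.mem_range.2 (JJ_mem.1 hj).1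
    rw [Finset.card_range] at this
    exact_mod_cast this
  have key := h.fixed hGauss hCov hb hb1 hk hk2 hm (J := JJ D m) (fun j hj => Finset.mem_range.2 (JJ_mem.1 hj).1) (fun x hx hx' => by
      have hlt : ⌊(m:ℝ) * x⌋₊ < m := (Nat.floor_lt (by have := hx'.1; positivity)).2 (by nlinarith [hx'.2])
      exact JJ_mem.2 ⟨hlt, x, hx, hx'.1.le, rfl⟩) hη hε hε
      (show 0 < cstar a ^ 2 * (rr D m - M) + 1/(m:ℝ) by have := mul_nonneg (sq_nonneg (cstar a)) (sub_nonneg.2 hrM); positivity)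
      ((mul_le_mul_of_nonneg_left (JJ_diff h.Dm hm) (sq_nonneg _)).trans (by rw [← hM]; have := one_div_pos.2 hm'; linarith))
  filter_upwards [key, eventually_gt_atTop 0] with s hs hs0
  refine le_trans (exp_le_exp.2 (mul_le_mul_of_nonpos_left ?_ (by norm_num))) hs
  refine mul_le_mul_of_nonneg_right ?_ (rpow_nonneg hs0.le _)
  have hp : 0 ≤ (1 + η) ^ α := by positivity
  have hp2 : (1 + ε) ^ α ≤ (1 + η) ^ α := rpow_le_rpow 𝔏 𝔏 hα0.le
  have b1' : ((JJ D m).card : ℝ) * ((1/m) * (kap a * (1 + ε) ^ α) + ε) * (1 + η) ^ α ≤ rr D m * (kap a * (1 + η) ^ α) * (1 + η) ^ α + m * ε * (1 + η) ^ α := by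
    rw [← add_mul]
    refine mul_le_mul_of_nonneg_right ?_ hp
    have g1 : ((JJ D m).card : ℝ) / m * (kap a * (1 + ε) ^ α) ≤ rr D m * (kap a * (1 + η) ^ α) :=
      mul_le_mul hcard (mul_le_mul_of_nonneg_left hp2 hκ.le) 𝔓 (by rw [rr]; positivity)
    have g2 : ((JJ D m).card : ℝ) * ε ≤ m * ε := mul_le_mul_of_nonneg_right hcm hε.le
    calc _ = ((JJ D m).card : ℝ) / m * (kap a * (1 + ε) ^ α) + ((JJ D m).card : ℝ) * ε := by ring
      _ ≤ _ := add_le_add g1 g2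
  rw [← hc]
  linarith
end
end

section
section
variable {D : Set ℝ}

noncomputable def de (D : Set ℝ) (k : ℕ) : ℝ → ℝ := D.indicator (ck k)

theorem de_memLp (hD : MeasurableSet D) (k : ℕ) : MemLp (de D k) 2 nu :=
  bdd_memLp ((ck_cont k).measurable.indicator hD).aestronglyMeasurable 2 fun x _ => by
    by_cases h : x ∈ D
    · rw [de, indicator_of_mem h]; exact ck_bd k x
    · rw [de, indicator_of_notMem h]; simp

theorem de_int (k : ℕ) (w : ℝ → ℝ) : ∫ t, de D k t * w t ∂nu = ∫ t, D.indicator w t * ck k t ∂nu := by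
  congr 1; funext t
  by_cases h : t ∈ D <;> simp [de, h, mul_comm]

noncomputable def Wv (D : Set ℝ) (N : ℕ) (w : ℝ → ℝ) : EuclideanSpace ℝ (Fin N) := WithLp.toLp 2 fun i : Fin N => ∫ t, de D i t * w t ∂nu

theorem Wv_norm (N : ℕ) (w : ℝ → ℝ) : ‖Wv D N w‖ ^ 2 = ∑ k ∈ Finset.range N, (∫ t, D.indicator w t * ck k t ∂nu) ^ 2 := by
  rw [EuclideanSpace.real_norm_sq_eq, ← Fin.sum_univ_eq_sum_range (fun k => (∫ t, D.indicator w t * ck k t ∂nu) ^ 2) N]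
  exact Finset.sum_congr rfl fun i _ => by rw [← de_int]; rfl

theorem Wv_le (hD : MeasurableSet D) (N : ℕ) {w : ℝ → ℝ} (hw : MemLp w 2 nu) : ‖Wv D N w‖ ^ 2 ≤ ∫ t, w t ^ 2 ∂nu := by
  rw [Wv_norm]
  have h1 := sum_le_hasSum (Finset.range N) (fun _ _ => sq_nonneg _) (cos_parseval (hw.indicator hD))
  refine h1.trans (integral_mono (hw.indicator hD).integrable_sq hw.integrable_sq fun t => ?_)
  by_cases h : t ∈ D <;> simp [h, sq_nonneg]

theorem Wv_lim (hD : MeasurableSet D) {w : ℝ → ℝ} (hw : MemLp w 2 nu) :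
    Tendsto (fun N => ‖Wv D N w‖ ^ 2) atTop (𝓝 (∫ t, D.indicator w t ^ 2 ∂nu)) := by
  simp only [Wv_norm]
  exact (cos_parseval (hw.indicator hD)).tendsto_sum_nat

theorem de_lc (hD : MeasurableSet D) {N : ℕ} (x : EuclideanSpace ℝ (Fin N)) {w : ℝ → ℝ} (hw : MemLp w 2 nu) :
    ∫ t, lc (fun i : Fin N => de D i) x t * w t ∂nu = inner ℝ x (Wv D N w) :=
  lc_int (fe := fun i : Fin N => de D i) (fun i => de_memLp hD i) hw x

theorem de_lc_norm (hD : MeasurableSet D) {N : ℕ} (x : EuclideanSpace ℝ (Fin N)) :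
    ∫ t, lc (fun i : Fin N => de D i) x t ^ 2 ∂nu ≤ ‖x‖ ^ 2 := by
  have hm := lc_memLp (fun i : Fin N => de_memLp hD i) x
  have h1 := de_lc hD x hm
  simp only [← pow_two] at h1
  have h2 := Wv_le hD N hm
  have h3 := real_inner_le_norm x (Wv D N (lc (fun i : Fin N => de D i) x))
  rw [← h1] at h3
  set I := ∫ t, lc (fun i : Fin N => de D i) x t ^ 2 ∂nu
  nlinarith [sq_nonneg (‖x‖ - ‖Wv D N (lc (fun i : Fin N => de D i) x)‖)]

noncomputable def cs (b : Bool) (n : ℕ) (x : ℝ) : ℝ := if b then cos (π * n * x) else sin (π * n * x)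

theorem cs_le (b : Bool) (n : ℕ) (x : ℝ) : |cs b n x| ≤ 1 := by
  cases b <;> simp [cs, abs_cos_le_one, abs_sin_le_one]

theorem cs_memLp (b : Bool) (n : ℕ) : MemLp (cs b n) 2 nu := by
  refine bdd_memLp (Continuous.aestronglyMeasurable ?_) 1 fun x _ => cs_le b n x
  unfold cs; cases b <;> simp <;> fun_prop

theorem bdd_sq {w : ℝ → ℝ} (hw : MemLp w 2 nu) (h : ∀ x, |w x| ≤ 1) : ∫ t, w t ^ 2 ∂nu ≤ 1 := by
  have := integral_mono hw.integrable_sq (integrable_const (1:ℝ)) fun t => (sq_le_one_iff_abs_le_one _).2 (h t)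
  simpa using this

theorem rs_log (hD : MeasurableSet D) {s c B : ℝ} (hs : 0 ≤ s) (hc : 0 ≤ c) (N : ℕ) {w : ℝ → ℝ} (hw : MemLp w 2 nu) (hB : ∫ t, w t ^ 2 ∂nu ≤ B) :
    log (1 + ‖√(s * c) • Wv D N w‖ ^ 2) ≤ log (1 + s * (c * B)) := by
  refine log_le_log 𝔓 ?_
  rw [norm_smul, mul_pow, norm_eq_abs, sq_abs, sq_sqrt 𝔓, mul_assoc]
  have := (Wv_le hD N hw).trans hB
  gcongr

noncomputable def Rm (a : ℝ) (K : ℕ) (s : ℝ) : ℝ := log (1 + s * (1 * ∫ t, pf a t ^ 2 ∂nu)) + log (1 + s * ((1 + |fh a 0|) * 1)) +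
  ∑ p : Fin K × Bool, log (1 + s * (|fh a p.1| * 1))

theorem pf_memLp {a : ℝ} (h0 : 1/2 < a) : MemLp (pf a) 2 nu := by
  obtain ⟨C, hC⟩ := isCompact_Icc.exists_bound_of_continuousOn ((pf_cont h0).continuousOn (s := Icc 𝟘 1))
  exact bdd_memLp (pf_cont h0).aestronglyMeasurable C fun x hx => hC x (Ioo_subset_Icc_self hx)

theorem low_fix (hD : MeasurableSet D) {a : ℝ} (h0 : 1/2 < a) {K : ℕ} (hK : 1 ≤ K) (hpos : ∀ n, K ≤ n → 0 ≤ -fh a n) (K' N : ℕ) {s : ℝ} (hs : 0 ≤ s)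
    {A : EuclideanSpace ℝ (Fin N) → ℝ} {u l} (hA : Dg A u l) (hA0 : ∀ x, 0 ≤ A x)
    (hA' : ∀ x, A x = s * ∫ z : ℝ × ℝ, Bc a z.1 z.2 * (lc (fun i : Fin N => de D i) x z.1 * lc (fun i : Fin N => de D i) x z.2) ∂(nu.prod nu)) :
    ∑ n ∈ Finset.Ico K K', log (1 + s * (-fh a n)) * (‖Wv D N (cs true n)‖ ^ 2 + ‖Wv D N (cs false n)‖ ^ 2) - Rm a K s ≤ ∑ i, log (1 + l i) := by
  have hfe : ∀ i : Fin N, MemLp (de D i) 2 nu := fun i => de_memLp hD i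
  have h1m : MemLp (fun _ : ℝ => (1:ℝ)) 2 nu := memLp_const 1
  let r : Bool ⊕ (Fin K × Bool) → EuclideanSpace ℝ (Fin N) := Sum.elim
    (fun b => if b then √(s * 1) • Wv D N (pf a) else √(s * (1 + |fh a 0|)) • Wv D N (fun _ => 1))
    (fun p => √(s * |fh a p.1|) • Wv D N (cs p.2 p.1))
  have hq := hA.qf.add (QF.sum Finset.univ fun m => QF.sq (r m))
  obtain ⟨w, c, hC⟩ := hq.dg fun x => add_nonneg (hA0 x) (Finset.sum_nonneg fun _ _ => sq_nonneg _)
  have key := ld_lower hA hC r (fun x => rfl) (Finset.Ico K K' ×ˢ (Finset.univ : Finset Bool)) (fun p => s * (-fh a p.1))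
    (fun p hp => mul_nonneg hs (hpos _ (Finset.mem_Ico.1 (Finset.mem_product.1 hp).1).1)) (fun p => Wv D N (cs p.2 p.1)) ?_ ?_
  · rw [Finset.sum_product] at key
    simp only [Fintype.univ_bool, Finset.sum_pair (show true ≠ false by decide), ← mul_add] at key
    refine le_trans (sub_le_sub_left ?_ _) key
    rw [Fintype.sum_sum_type, Fintype.sum_bool, Rm]
    refine add_le_add (add_le_add ?_ ?_) (Finset.sum_le_sum fun p _ => ?_)
    · exact rs_log hD hs zero_le_one N (pf_memLp h0) le_rfl
    · exact rs_log hD hs 𝔓 N h1m (by simp)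
    · exact rs_log hD hs (abs_nonneg _) N (cs_memLp _ _) (bdd_sq (cs_memLp _ _) (cs_le _ _))
  · intro x
    have hsq : ∀ c : ℝ, 0 ≤ c → ∀ v : EuclideanSpace ℝ (Fin N), (inner ℝ x (√(s * c) • v) : ℝ) ^ 2 = s * (c * (inner ℝ x v : ℝ) ^ 2) := fun c hc v => by
      rw [inner_smul_right, mul_pow, sq_sqrt 𝔓, mul_assoc]
    have hq := mul_le_mul_of_nonneg_left (qf_lower h0 (memLp_int (lc_memLp hfe x)) hK hpos K') hs
    rw [hA', Fintype.sum_sum_type, Fintype.sum_bool, Finset.sum_product]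
    simp only [Fintype.univ_bool, Finset.sum_pair (show true ≠ false by decide), Fintype.sum_prod_type]
    simp only [r, Sum.elim_inl, Sum.elim_inr, if_true, Bool.false_eq_true, if_false, hsq 1 zero_le_one, hsq _ (abs_nonneg _), hsq _ (show 0 ≤ 1 + |fh a 0| by positivity)]
    have ec : ∀ n : ℕ, ∫ t, lc (fun i : Fin N => de D i) x t * cos (π * n * t) ∂nu = inner ℝ x (Wv D N (cs true n)) := fun n => de_lc hD x (cs_memLp true n)
    have es : ∀ n : ℕ, ∫ t, lc (fun i : Fin N => de D i) x t * sin (π * n * t) ∂nu = inner ℝ x (Wv D N (cs false n)) := fun n => de_lc hD x (cs_memLp false n)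
    simp only [ec, es, de_lc hD x (pf_memLp h0), de_lc hD x h1m] at hq
    have e2 : ∑ n ∈ Finset.Ico 1 K, |fh a n| * ((inner ℝ x (Wv D N (cs true n)) : ℝ) ^ 2 + (inner ℝ x (Wv D N (cs false n)) : ℝ) ^ 2) ≤
        ∑ n : Fin K, |fh a n| * ((inner ℝ x (Wv D N (cs true n)) : ℝ) ^ 2 + (inner ℝ x (Wv D N (cs false n)) : ℝ) ^ 2) := by
      rw [Fin.sum_univ_eq_sum_range (fun n => |fh a n| * ((inner ℝ x (Wv D N (cs true n)) : ℝ) ^ 2 + (inner ℝ x (Wv D N (cs false n)) : ℝ) ^ 2)) K, Finset.range_eq_Ico]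
      exact Finset.sum_le_sum_of_subset_of_nonneg (Finset.Ico_subset_Ico_left zero_le_one) fun _ _ _ => by positivity
    have e3 := mul_le_mul_of_nonneg_left e2 hs
    simp only [Finset.mul_sum, mul_add, add_mul] at hq e3 ⊢
    simp only [mul_assoc, one_mul] at hq e3 ⊢
    linarith
  · intro x
    refine le_trans ?_ ((bessel_full (lc_memLp hfe x) K').trans (de_lc_norm hD x))
    have ec : ∀ n : ℕ, ∫ t, lc (fun i : Fin N => de D i) x t * cos (π * n * t) ∂nu = inner ℝ x (Wv D N (cs true n)) := fun n => de_lc hD x (cs_memLp true n)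
    have es : ∀ n : ℕ, ∫ t, lc (fun i : Fin N => de D i) x t * sin (π * n * t) ∂nu = inner ℝ x (Wv D N (cs false n)) := fun n => de_lc hD x (cs_memLp false n)
    rw [Finset.sum_product]
    simp only [Fintype.univ_bool, Finset.sum_pair (show true ≠ false by decide), ec, es]
    exact Finset.sum_le_sum_of_subset_of_nonneg (Finset.Ico_subset_Ico_left hK) fun _ _ _ => by positivity

theorem cs_lim (hD : MeasurableSet D) (hDs : D ⊆ Icc 0 1) (n : ℕ) :
    Tendsto (fun N => ‖Wv D N (cs true n)‖ ^ 2 + ‖Wv D N (cs false n)‖ ^ 2) atTop (𝓝 (volume D).toReal) := by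
  have h := (Wv_lim hD (cs_memLp true n)).add (Wv_lim hD (cs_memLp false n))
  rw [← integral_add ((cs_memLp true n).indicator hD).integrable_sq ((cs_memLp false n).indicator hD).integrable_sq] at h
  have e : ∀ t, D.indicator (cs true n) t ^ 2 + D.indicator (cs false n) t ^ 2 = D.indicator (fun _ => (1:ℝ)) t := fun t => by
    by_cases h : t ∈ D <;> simp [h, cs]
  simp only [e] at h
  rw [integral_indicator hD, setIntegral_const, smul_eq_mul, mul_one, Measure.real, Measure.restrict_apply hD] at h
  have e2 : volume (D ∩ Ioo 0 1) = volume D := by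
    rw [← Measure.restrict_apply hD, Measure.restrict_congr_set Ioo_ae_eq_Icc, Measure.restrict_apply hD, inter_eq_left.2 hDs]
  rwa [e2] at h

theorem Rm_small {a : ℝ} (K : ℕ) {α η : ℝ} (hα : 0 < α) (hη : 0 < η) : ∀ᶠ s : ℝ in atTop, Rm a K s ≤ η * s ^ α := by
  set η' := η / (2 + (Fintype.card (Fin K × Bool) : ℝ)) with hη'
  have hp : 0 < η' := by positivity
  have h1 := log_small hα (show 0 ≤ 1 * ∫ t, pf a t ^ 2 ∂nu by rw [one_mul]; exact integral_nonneg fun _ => sq_nonneg _) hp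
  have h2 := log_small hα (show 0 ≤ (1 + |fh a 0|) * 1 by positivity) hp
  have h3 : ∀ᶠ s : ℝ in atTop, ∀ p : Fin K × Bool, log (1 + s * (|fh a p.1| * 1)) ≤ η' * s ^ α :=
    eventually_all.2 fun p => log_small hα 𝔓 hp
  filter_upwards [h1, h2, h3] with s h1 h2 h3
  have h4 := Finset.sum_le_card_nsmul Finset.univ _ _ fun p _ => h3 p
  rw [nsmul_eq_mul, Finset.card_univ] at h4
  have e : η * s ^ α = (2 + (Fintype.card (Fin K × Bool) : ℝ)) * (η' * s ^ α) := by rw [hη']; field_simp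
  rw [e, Rm]; linarith
end
end

section
section
variable {H : ℝ → ℝ} {a : ℝ} {D : Set ℝ}
variable [MeasurableSpace 𝕃] [BorelSpace 𝕃]

theorem de_exp (hD : MeasurableSet D) {μ : Measure 𝕃} [IsProbabilityMeasure μ] {s : ℝ} (hs : 0 ≤ s) (N : ℕ) :
    ∫ f, exp (-(s/2) * ‖f‖ ^ 2) ∂μ ≤ ∫ f, exp (-(s/2) * ∑ i : Fin N, (inner ℝ ((de_memLp hD i).toLp) f : ℝ) ^ 2) ∂μ := by
  have hb : ∀ g : 𝕃 → ℝ, Continuous g → (∀ f, 0 ≤ g f) → Integrable (fun f => exp (-(s/2) * g f)) μ := fun g hg h0 =>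
    Integrable.of_bound (C := 1) (Continuous.aestronglyMeasurable 𝔉) (.of_forall fun f => by
      rw [norm_of_nonneg (exp_nonneg _), exp_le_one_iff]; nlinarith [h0 f])
  refine integral_mono (hb _ 𝔉 fun _ => by positivity) (hb _ 𝔉 fun _ => Finset.sum_nonneg fun _ _ => sq_nonneg _) fun f => ?_
  refine exp_le_exp.2 (mul_le_mul_of_nonpos_left ?_ 𝔏)
  rw [norm_sq_Lp]
  have := Wv_le hD N (Lp.memLp f)
  rw [EuclideanSpace.real_norm_sq_eq] at this
  simp only [inner_toLp]
  exact this

theorem SU.low_s (h : SU H a D) {μ : Measure 𝕃} [IsProbabilityMeasure μ]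
    (hGauss : GaH μ)
    (hCov : CoH H μ) {K : ℕ} (hK : 1 ≤ K) (hpos : ∀ n, K ≤ n → 0 ≤ -fh a n) (K' : ℕ) {s : ℝ} (hs : 0 < s) :
    ∫ f, exp (-(s/2) * ‖f‖ ^ 2) ∂μ ≤ exp (-(1/2) * (∑ n ∈ Finset.Ico K K', log (1 + s * (-fh a n)) * (volume D).toReal - Rm a K s)) := by
  have hD := h.Dm.measurableSet
  have hlim : Tendsto (fun N => exp (-(1/2) * (∑ n ∈ Finset.Ico K K', log (1 + s * (-fh a n)) * (‖Wv D N (cs true n)‖ ^ 2 + ‖Wv D N (cs false n)‖ ^ 2) - Rm a K s)))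
      atTop (𝓝 (exp (-(1/2) * (∑ n ∈ Finset.Ico K K', log (1 + s * (-fh a n)) * (volume D).toReal - Rm a K s)))) :=
    (continuous_exp.tendsto _).comp (((tendsto_finsetSum _ fun n _ => (cs_lim hD h.Ds n).const_mul _).sub_const _).const_mul _)
  refine ge_of_tendsto' hlim fun N => ?_
  obtain ⟨u, l, hA, hE⟩ := gauss_ld μ hGauss (fun i : Fin N => (de_memLp hD i).toLp) s hs
  refine (de_exp hD hs.le N).trans ?_
  rw [hE]
  refine exp_le_exp.2 (mul_le_mul_of_nonpos_left ?_ (by norm_num))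
  refine low_fix hD h.ha hK hpos K' N hs.le hA (fun x => mul_nonneg hs.le (integral_nonneg fun _ => sq_nonneg _)) fun x => ?_
  beta_reduce
  have hfe : ∀ i : Fin N, MemLp (de D i) 2 nu := fun i => de_memLp hD i
  have e := toLp_lc hfe x
  rw [e, cov_ker hCov (lc_memLp hfe x) (g := Bc a) ?_ (Bc_int h.ha (memLp_int (lc_memLp hfe x))).1]
  have hz : ∀ x', x' ∉ D → lc (fun i : Fin N => de D i) x x' = 0 := fun x' hx' => by
    simp [lc, de, indicator_of_notMem hx']
  intro p hp q hq
  by_cases hpD : p ∈ D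
  · by_cases hqD : q ∈ D
    · rw [GmfBM, (h.hD p (Ioo_subset_Icc_self hp)).1 hpD, (h.hD q (Ioo_subset_Icc_self hq)).1 hqD, intKK h.ha h.ha1 hp.1 hq.1]
    · rw [hz q hqD]; simp
  · rw [hz p hpD]; simp

theorem SU.lower (h : SU H a D) {μ : Measure 𝕃} [IsProbabilityMeasure μ]
    (hGauss : GaH μ)
    (hCov : CoH H μ) {δ : ℝ} (hδ : 0 < δ) :
    ∀ᶠ s : ℝ in atTop, ∫ f, exp (-(s/2) * ‖f‖ ^ 2) ∂μ ≤ exp (-(1/2) * ((kap a * (volume D).toReal - δ) * s ^ (1/(2 * a + 1)))) := by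
  have ha := h.ha
  have hg := gA_pos h.ha h.ha1
  have hpi := pi_pos
  set q := 2 * a + 1 with hq
  have hq1 : 1 < q := by linarith
  have hq0 : 0 < q := by linarith
  set α := 1/q with hα
  have hα0 : 0 < α := by positivity
  set M := (volume D).toReal with hM
  have hM0 : 0 ≤ M := ENNReal.toReal_nonneg
  have t1 : Tendsto (fun η : ℝ => M * ((Iq q - η) * (((1 - η) * gA a) ^ α / π))) (𝓝[>] 0) (𝓝 (kap a * M)) := by
    have hc : ContinuousAt (fun η : ℝ => ((1 - η) * gA a) ^ α) 0 := ContinuousAt.rpow_const 𝔉 (Or.inl (by simpa using hg.ne'))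
    have : ContinuousAt (fun η : ℝ => M * ((Iq q - η) * (((1 - η) * gA a) ^ α / π))) 0 := by fun_prop
    have h2 := this.tendsto.mono_left (nhdsWithin_le_nhds (s := Ioi 0))
    have e : kap a * M = M * ((Iq q - 0) * (((1 - 0) * gA a) ^ α / π)) := by rw [kap, ← hq, ← hα]; simp; ring
    rw [e]; exact h2
  obtain ⟨η, ⟨hη1, hη2⟩, hη⟩ := (((t1.eventually_const_lt (show kap a * M - δ/2 < kap a * M by linarith)).and
    ((tendsto_id.mono_left nhdsWithin_le_nhds).eventually_lt_const (zero_lt_one (α := ℝ)))).and self_mem_nhdsWithin).exists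
  simp only [id] at hη2
  have hη : 0 < η := hη
  obtain ⟨K, hK, hKf⟩ : ∃ K : ℕ, 1 ≤ K ∧ ∀ n, K ≤ n → (1 - η) * gA a * π ^ (-q) * (n:ℝ) ^ (-q) ≤ -fh a n := by
    have := ((fk_lim h.ha h.ha1).eventually_const_lt (show (1 - η) * gA a < Gamma (2 * a + 1) * sin (π * a) by rw [← gA]; nlinarith)).and (eventually_ge_atTop 1)
    obtain ⟨K, hK⟩ := eventually_atTop.1 this
    refine ⟨max K 1, le_max_right _ _, fun n hn => ?_⟩
    obtain ⟨h1, h2⟩ := hK n ((le_max_left _ _).trans hn)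
    have hn0 : 𝟘 < n := by exact_mod_cast h2
    rw [fh_eq h.ha (by omega), neg_neg, mul_assoc, ← mul_rpow hpi.le hn0.le, rpow_neg 𝔓, ← div_eq_mul_inv, div_le_iff₀ 𝔓, mul_comm _ ((π * n) ^ q)]
    exact h1.le
  have hc : 0 < (1 - η) * gA a * π ^ (-q) := mul_pos (mul_pos 𝔏 hg) 𝔓
  have hpos : ∀ n, K ≤ n → 0 ≤ -fh a n := fun n hn => le_trans 𝔓 (hKf n hn)
  have hX := (tendsto_id.atTop_mul_const hc).eventually (sum_log_ge q hq1 K hK η hη)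
  filter_upwards [hX, Rm_small (a := a) K hα0 (half_pos hδ), eventually_gt_atTop 0] with s hs hR hs0
  obtain ⟨K', hK'⟩ := hs
  refine (h.low_s hGauss hCov hK hpos K' hs0).trans (exp_le_exp.2 (mul_le_mul_of_nonpos_left ?_ (by norm_num)))
  rw [← Finset.sum_mul]
  have h1 : ∑ k ∈ Finset.Ico K K', log (1 + id s * ((1 - η) * gA a * π ^ (-q)) * (k:ℝ) ^ (-q)) ≤ ∑ n ∈ Finset.Ico K K', log (1 + s * (-fh a n)) := by
    refine Finset.sum_le_sum fun n hn => log_le_log (by simp only [id]; positivity) ?_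
    have := mul_le_mul_of_nonneg_left (hKf n (Finset.mem_Ico.1 hn).1) hs0.le
    simp only [id]; rw [mul_assoc]; linarith
  have h2 := mul_le_mul_of_nonneg_right (hK'.trans h1) hM0
  have e : (id s * ((1 - η) * gA a * π ^ (-q))) ^ (1/q) = s ^ α * (((1 - η) * gA a) ^ α / π) := by
    have hg' : 0 ≤ (1 - η) * gA a := mul_nonneg 𝔏 hg.le
    rw [id, mul_rpow hs0.le hc.le, mul_rpow hg' 𝔓, ← rpow_mul hpi.le, show -q * (1/q) = -1 by field_simp, rpow_neg_one, ← div_eq_mul_inv]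
  rw [e] at h2
  have h3 := mul_le_mul_of_nonneg_right hη1.le (rpow_nonneg hs0.le α)
  nlinarith

theorem SU.logl (h : SU H a D) {μ : Measure 𝕃} [IsProbabilityMeasure μ]
    (hGauss : GaH μ)
    (hCov : CoH H μ) :
    Tendsto (fun s : ℝ => -log (∫ f, exp (-s * (‖f‖ ^ 2 / 2)) ∂μ) / s ^ (1/(2 * a + 1))) atTop (𝓝 (kap a * (volume D).toReal / 2)) := by
  rw [Metric.tendsto_nhds]
  intro ε hε
  filter_upwards [h.upper hGauss hCov hε, h.lower hGauss hCov hε, eventually_gt_atTop 0] with s h1 h2 hs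
  have e : ∀ f : 𝕃, -s * (‖f‖ ^ 2 / 2) = -(s/2) * ‖f‖ ^ 2 := fun f => by ring
  simp only [e]
  have hp := (exp_pos _).trans_le h1
  have g1 := log_le_log (exp_pos _) h1
  have g2 := log_le_log hp h2
  rw [log_exp] at g1 g2
  have hsp : 0 < s ^ (1/(2 * a + 1)) := rpow_pos_of_pos hs _
  rw [dist_eq, abs_lt]
  constructor
  · rw [lt_sub_iff_add_lt, lt_div_iff₀ hsp]; nlinarith
  · rw [sub_lt_iff_lt_add, div_lt_iff₀ hsp]; nlinarith

theorem SU.final (h : SU H a D) (hM : 0 < (volume D).toReal) {μ : Measure 𝕃} [IsProbabilityMeasure μ]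
    (hGauss : GaH μ)
    (hCov : CoH H μ) :
    Tendsto (fun ε : ℝ => ε ^ (1 / a) * log (μ {f | ‖f‖ ≤ ε}).toReal) (nhdsWithin 0 (Ioi 0))
      (nhds (-(a * (volume D).toReal / ((2 * a + 1) * sin (Real.pi / (2 * a + 1))) *
        (Gamma (2 * a + 1) * sin (Real.pi * a) * (volume D).toReal /
            ((2 * a + 1) * sin (Real.pi / (2 * a + 1)))) ^ (1 / (2 * a))))) := by
  have ha := h.ha
  have ha0 : 0 < a := by linarith
  have hg := gA_pos h.ha h.ha1
  have hpi := pi_pos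
  have hκ := kap_pos h.ha h.ha1
  set M := (volume D).toReal
  have hα1 : 1/(2 * a + 1) < 1 := by rw [div_lt_one 𝔓]; linarith
  have T := taub μ (fun f => ‖f‖ ^ 2 / 2) 𝔉 (fun _ => by positivity) (1/(2 * a + 1)) (kap a * M / 2) 𝔓 hα1 𝔓 (h.logl hGauss hCov)
  have e0 : 1/(2 * a + 1) / (1 - 1/(2 * a + 1)) = 1/(2 * a) := by field_simp; ring
  rw [e0] at T
  have ht : Tendsto (fun ε : ℝ => ε ^ 2 / 2) (𝓝[>] 0) (𝓝[>] 0) := by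
    refine tendsto_nhdsWithin_iff.2 ⟨?_, ?_⟩
    · have : Continuous fun ε : ℝ => ε ^ 2 / 2 := by fun_prop
      simpa using (this.tendsto 0).mono_left (nhdsWithin_le_nhds (s := Ioi 0))
    · filter_upwards [self_mem_nhdsWithin] with ε hε
      have : 0 < ε := hε
      exact show 0 < ε ^ 2 / 2 by positivity
  have T2 := ((T.comp ht).const_mul ((2:ℝ) ^ (1/(2 * a))))
  have hS : 0 < sin (π / (2 * a + 1)) := sin_pos_of_pos_of_lt_pi 𝔓 (by rw [div_lt_iff₀ 𝔓]; nlinarith)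
  convert T2.congr' ?_ using 2
  · rw [kap, Iq, gA]
    rw [gA] at hg
    set g := Gamma (2 * a + 1) * sin (π * a)
    set S := sin (π / (2 * a + 1))
    clear T T2
    clear_value g S
    set γ := 1/(2 * a) with hγ
    set α := 1/(2 * a + 1) with hα
    have hgα : 0 < g ^ α := rpow_pos_of_pos hg _
    have e1 : α * (g ^ α * (π / S) / π * M / 2) = (g ^ α / 2) * (M / ((2 * a + 1) * S)) := by rw [hα]; field_simp
    have e2 : α * (g ^ α * (π / S) / π * M / 2) - g ^ α * (π / S) / π * M / 2 = - (g ^ α * (a * M / ((2 * a + 1) * S))) := by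
      rw [e1]; field_simp; ring
    rw [e2, e1]
    have e3 : g ^ γ = (g ^ α) ^ γ * g ^ α := by
      rw [← rpow_mul hg.le, ← rpow_add hg]; congr 1; rw [hα, hγ]; field_simp; ring
    rw [mul_div_assoc g, mul_rpow hg.le 𝔓, mul_rpow 𝔓 𝔓, div_rpow hgα.le (by norm_num), e3]
    have : (2:ℝ) ^ γ ≠ 0 := by positivity
    field_simp
  · filter_upwards [self_mem_nhdsWithin] with ε hε
    have hε : 0 < ε := hε
    have e1 : {f : 𝕃 | ‖f‖ ^ 2 / 2 ≤ ε ^ 2 / 2} = {f | ‖f‖ ≤ ε} := by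
      ext f
      simp only [Set.mem_ofPred_eq]
      rw [div_le_div_iff_of_pos_right two_pos, sq_le_sq₀ (norm_nonneg _) hε.le]
    simp only [Function.comp, e1]
    rw [← mul_assoc, ← mul_rpow (by norm_num) 𝔓, show (2:ℝ) * (ε ^ 2 / 2) = ε ^ (2:ℝ) by rw [rpow_two]; ring, ← rpow_mul hε.le,
      show (2:ℝ) * (1/(2 * a)) = 1/a by field_simp]
end

theorem holder_cont {H : ℝ → ℝ} {r : ℝ} (hr : 0 < r) {S : Set ℝ} (h : HolderOn H r S) : ContinuousOn H S := by
  obtain ⟨C, hC⟩ := h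
  intro x hx
  rw [ContinuousWithinAt, tendsto_iff_dist_tendsto_zero]
  have hc : Continuous fun y : ℝ => C * |y - x| ^ r := continuous_const.mul ((by fun_prop : Continuous fun y : ℝ => |y - x|).rpow_const fun _ => Or.inr hr.le)
  have := (hc.tendsto x).mono_left (nhdsWithin_le_nhds (s := S))
  simp only [sub_self, abs_zero, zero_rpow hr.ne', mul_zero] at this
  refine squeeze_zero' (.of_forall fun _ => dist_nonneg) ?_ this
  filter_upwards [self_mem_nhdsWithin] with y hy
  exact hC y hy x hx

theorem mkSU {H : ℝ → ℝ} {r : ℝ} (hr : 0 < r) (hHol : HolderOn H r (Icc 0 1))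
    (hrange : ∀ x ∈ Icc 𝟘 1, 1/2 < H x ∧ H x < 1)
    {Hmin : ℝ} (hHmin : IsLeast (H '' Icc 0 1) Hmin)
    {D : Set ℝ} (hD : D = {x | x ∈ Icc 𝟘 1 ∧ H x = Hmin}) : SU H Hmin D := by
  have hc := holder_cont hr hHol
  obtain ⟨x0, hx0, e0⟩ := hHmin.1
  have hcl : IsClosed D := by
    rw [hD]; exact hc.preimage_isClosed_of_isClosed isClosed_Icc (isClosed_singleton (x := Hmin))
  have hs : D ⊆ Icc 0 1 := by rw [hD]; exact fun x hx => hx.1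
  exact { cont := hc, rng := fun x hx => (hrange x hx).2, amin := fun x hx => hHmin.2 ⟨x, hx, rfl⟩, ha := e0 ▸ (hrange x0 hx0).1, ha1 := e0 ▸ (hrange x0 hx0).2
          Dm := isCompact_Icc.of_isClosed_subset hcl hs, Ds := hs, hD := fun x hx => by rw [hD]; exact ⟨fun h => h.2, fun h => ⟨hx, h⟩⟩ }
end
end

/-- Small ball asymptotics for the multifractal Brownian motion, case `Leb(D) > 0`. -/
theorem mfBM_small_ball_posD
    (H : ℝ → ℝ) (r : ℝ) (hr : 0 < r) (hHol : HolderOn H r (Icc 0 1))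
    (hrange : ∀ x ∈ Icc (0:ℝ) 1, 1/2 < H x ∧ H x < 1)
    (Hmin : ℝ) (hHmin : IsLeast (H '' Icc 0 1) Hmin)
    (D : Set ℝ) (hD : D = {x | x ∈ Icc (0:ℝ) 1 ∧ H x = Hmin})
    -- Assumption 1
    (d : ℝ → ℝ) (c₁ c₂ C₀ κ : ℝ) (hc₁ : 0 < c₁) (hc₂ : 0 < c₂) (hC₀ : 0 < C₀) (hκ : 0 < κ)
    (hd₁ : ∀ x ∈ Icc (0:ℝ) 1, c₁ * infDist x D ≤ d x ∧ d x ≤ c₂ * infDist x D)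
    (hd₂ : ContDiffOn ℝ (⊤ : ℕ∞) d (Icc 0 1 \ D))
    (hd₃ : ∀ n : ℕ, 1 ≤ n → ∃ Cn : ℝ, ∀ x ∈ Icc (0:ℝ) 1 \ D,
      |iteratedDerivWithin n d (Icc 0 1 \ D) x| ≤ Cn * d x ^ ((1:ℝ) - n))
    (hhd : ∀ x ∈ Icc (0:ℝ) 1, H x - Hmin ≤ C₀ * d x ^ κ)
    -- Assumption 2
    (h₀ h₁ : ℝ → ℝ) (β : ℝ) (hβ : 0 < β)
    (hsplit : ∀ x ∈ Icc (0:ℝ) 1, H x - Hmin = h₀ x + h₁ x)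
    (hh₀Hol : HolderOn h₀ β (Icc 0 1)) (hh₁Hol : HolderOn h₁ β (Icc 0 1))
    (hh₀sm : ContDiffOn ℝ (⊤ : ℕ∞) h₀ (Icc 0 1 \ D))
    (hh₀der : ∀ n : ℕ, 1 ≤ n → ∃ Cn : ℝ, ∀ x ∈ Icc (0:ℝ) 1 \ D,
      |iteratedDerivWithin n h₀ (Icc 0 1 \ D) x| ≤ Cn * h₀ x * d x ^ (-(n:ℝ)))
    (τ δ₀ C' : ℝ) (hτ : 0 < τ) (hδ₀ : 0 < δ₀) (hC' : 0 < C')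
    (hh₁sm : ∀ x ∈ Icc (0:ℝ) 1, h₀ x < δ₀ → |h₁ x| ≤ C' * h₀ x ^ (1 + τ))
    -- Assumption 3
    (σ s₀ : ℝ) (φ : ℝ → ℝ) (hσ : 0 < σ) (hs₀ : 0 < s₀)
    (hφm : Measurable φ) (hφpos : ∀ u : ℝ, 0 < u → 0 < φ u)
    (hφslow : ∀ c : ℝ, 0 < c → Tendsto (fun u => φ (c * u) / φ u) atTop (nhds 1))
    (hmeas : ∀ s : ℝ, 0 < s → s < s₀ →
      (volume {x | x ∈ Icc (0:ℝ) 1 ∧ 0 < H x - Hmin ∧ H x - Hmin < s}).toReal = s ^ σ * φ (1 / s))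
    -- τ-condition: Leb(D) > 0
    (hDpos : 0 < volume D)
    (hτD : max 0 ((1 - σ) / 2) < τ)
    -- the Gaussian measure
    [MeasurableSpace (Lp ℝ 2 (volume.restrict (Ioo (0:ℝ) 1)))]
    [BorelSpace (Lp ℝ 2 (volume.restrict (Ioo (0:ℝ) 1)))]
    (μ : Measure (Lp ℝ 2 (volume.restrict (Ioo (0:ℝ) 1)))) [IsProbabilityMeasure μ]
    (hGauss : ∀ L : Lp ℝ 2 (volume.restrict (Ioo (0:ℝ) 1)) →L[ℝ] ℝ,
      ∃ v : ℝ≥0, μ.map L = ProbabilityTheory.gaussianReal 0 v)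
    (hCov : ∀ u v : Lp ℝ 2 (volume.restrict (Ioo (0:ℝ) 1)),
      ∫ f, (@inner ℝ _ _ u f) * (@inner ℝ _ _ v f) ∂μ =
        ∫ x in Ioo (0:ℝ) 1, ∫ y in Ioo (0:ℝ) 1, GmfBM H x y * u x * v y) :
    Tendsto (fun ε : ℝ =>
        ε ^ (1 / Hmin) * Real.log (μ {f | ‖f‖ ≤ ε}).toReal)
      (nhdsWithin 0 (Ioi 0))
      (nhds (-(Hmin * (volume D).toReal /
          ((2 * Hmin + 1) * Real.sin (Real.pi / (2 * Hmin + 1))) *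
        (Real.Gamma (2 * Hmin + 1) * Real.sin (Real.pi * Hmin) * (volume D).toReal /
            ((2 * Hmin + 1) * Real.sin (Real.pi / (2 * Hmin + 1)))) ^ (1 / (2 * Hmin))))) := by
  have h := mkSU hr hHol hrange hHmin hD
  exact h.final (ENNReal.toReal_pos hDpos.ne' h.Dm.measure_lt_top.ne) hGauss hCov
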